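/- arXiv:1410.6210 — 2 statements merged into one kernel-verified Lean document; each statement's English description precedes it below -/
import Mathlib

section
/- Let q be an odd prime power. If ω(q−1) ≥ 50, or if q ≥ 2^{302}, then 𝔽_q contains three consecutive primitive elements. -/
open Finset

/-- An element `g` of a finite field is primitive if it generates the multiplicative
group of nonzero elements, i.e. every nonzero element is a power of `g`. -/
def IsPrimitiveElem {F : Type*} [Field F] (g : F) : Prop :=
  ∀ x : F, x ≠ 0 → ∃ k : ℕ, g ^ k = x

/-- The field `F` contains `n` consecutive distinct primitive elements: there is `g`
such that `g, g+1, …, g+n-1` are `n` distinct primitive elements. -/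
def HasConsecutivePrimitives (F : Type*) [Field F] (n : ℕ) : Prop :=
  ∃ g : F, (∀ k : ℕ, k < n → IsPrimitiveElem (g + (k : F))) ∧
    ∀ i : ℕ, i < n → ∀ j : ℕ, j < n → g + (i : F) = g + (j : F) → i = j

namespace MulChar

variable {F : Type*} [Field F] [Fintype F]

theorem norm_apply_of_ne_zero (χ : MulChar F ℂ) {a : F} (ha : a ≠ 0) : ‖χ a‖ = 1 := by
  classical
  simpa using Complex.norm_eq_one_of_mem_rootsOfUnity (χ.apply_mem_rootsOfUnity (Units.mk0 a ha))

theorem norm_apply_le_one (χ : MulChar F ℂ) (a : F) : ‖χ a‖ ≤ 1 := by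
  rcases eq_or_ne a 0 with rfl | ha
  · simp
  · exact (norm_apply_of_ne_zero χ ha).le

theorem sum_add_eq_zero {χ : MulChar F ℂ} (hχ : χ ≠ 1) (a : F) : ∑ t, χ (t + a) = 0 := by
  rw [← sum_eq_zero_of_ne_one hχ]
  exact Fintype.sum_equiv (Equiv.addRight a) _ _ fun _ => rfl

theorem sum_add_mul_add (χ ψ : MulChar F ℂ) {a b : F} (h : a ≠ b) :
    ∑ t, χ (t + a) * ψ (t + b) = χ (a - b) * ψ (b - a) * jacobiSum χ ψ := by
  have hab : a - b ≠ 0 := sub_ne_zero.2 h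
  rw [jacobiSum, mul_sum]
  symm
  apply Fintype.sum_bijective (fun y => (a - b) * y - a)
  · exact (Equiv.subRight a).bijective.comp (mulLeft_bijective₀ _ hab)
  · intro y
    rw [mul_mul_mul_comm, ← map_mul, ← map_mul]
    congr 2 <;> ring

theorem sum_add_mul_inv_add {χ : MulChar F ℂ} (hχ : χ ≠ 1) {a b : F} (h : a ≠ b) :
    ∑ t, χ (t + a) * χ⁻¹ (t + b) = -1 := by
  have hab : a - b ≠ 0 := sub_ne_zero.2 h
  have h1 : χ (-1) * χ (-1) = 1 := by rw [← map_mul]; simp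
  have h2 : χ⁻¹ (b - a) * χ (b - a) = 1 := by
    rw [← mul_apply, inv_mul]
    exact one_apply (sub_ne_zero.2 h.symm).isUnit
  rw [sum_add_mul_add _ _ h, jacobiSum_nontrivial_inv hχ,
    show a - b = -1 * (b - a) by ring, map_mul]
  linear_combination (-1 : ℂ) * h1 - h2 * (χ (-1) * χ (-1))

theorem norm_jacobiSum_sq_le {χ ψ : MulChar F ℂ} (hχ : χ ≠ 1) (hψ : ψ ≠ 1) :
    ‖jacobiSum χ ψ‖ ^ 2 ≤ Fintype.card F := by
  have hq : (1 : ℝ) ≤ Fintype.card F := by exact_mod_cast Fintype.card_pos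
  by_cases h : χ * ψ = 1
  · rw [← inv_eq_of_mul_eq_one_right h, jacobiSum_nontrivial_inv hχ, norm_neg]
    calc ‖χ (-1)‖ ^ 2 ≤ 1 ^ 2 := by gcongr; exact norm_apply_le_one _ _
      _ ≤ _ := by simpa using hq
  · have hc : ringChar ℂ ≠ ringChar F := by
      rw [ringChar.eq_zero]
      exact (CharP.char_ne_zero_of_finite F (ringChar F)).symm
    have h1 := jacobiSum_mul_jacobiSum_inv hc hχ hψ h
    have h2 : jacobiSum χ⁻¹ ψ⁻¹ = star (jacobiSum χ ψ) := by
      simp only [jacobiSum, star_sum, star_mul', star_apply']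
    rw [h2] at h1
    have h3 := congrArg norm h1
    rw [norm_mul, norm_star, Complex.norm_natCast] at h3
    rw [pow_two, h3]

theorem norm_sum_add_mul_add_sq_le {χ ψ : MulChar F ℂ} (hχ : χ ≠ 1) (hψ : ψ ≠ 1) {a b : F}
    (h : a ≠ b) : ‖∑ t, χ (t + a) * ψ (t + b)‖ ^ 2 ≤ Fintype.card F := by
  rw [sum_add_mul_add _ _ h, norm_mul, norm_mul, norm_apply_of_ne_zero _ (sub_ne_zero.2 h),
    norm_apply_of_ne_zero _ (sub_ne_zero.2 h.symm), one_mul, one_mul]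
  exact norm_jacobiSum_sq_le hχ hψ

end MulChar

section FourthMoment

variable {I J X : Type*} [Fintype I] [Fintype J]

/-- The correlation `∑ i, g i x₁ * g i x₂ * conj (g i x₃) * conj (g i x₄)` of the family `g`
at the quadruple `x`. -/
noncomputable def quadCorr (g : I → X → ℂ) (x : X × X × X × X) : ℂ :=
  ∑ i, g i x.1 * g i x.2.1 * star (g i x.2.2.1) * star (g i x.2.2.2)

theorem sum_norm_sum_pow_four [Fintype X] (g : I → X → ℂ) :
    ((∑ i, ‖∑ x, g i x‖ ^ 4 : ℝ) : ℂ) = ∑ x, quadCorr g x := by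
  simp only [quadCorr]
  rw [sum_comm]
  push_cast
  refine sum_congr rfl fun i _ => ?_
  have h : ((‖∑ x, g i x‖ : ℂ)) ^ 4 =
      (∑ x, g i x) * ((∑ x, g i x) * ((∑ x, star (g i x)) * ∑ x, star (g i x))) := by
    have := Complex.mul_conj' (∑ x, g i x)
    rw [← star_sum]
    change _ * star _ = _ at this
    linear_combination (-(‖∑ x, g i x‖ : ℂ) ^ 2 - (∑ x, g i x) * star (∑ x, g i x)) * this
  rw [h]
  simp only [Fintype.sum_prod_type, mul_assoc, ← mul_sum, ← sum_mul]

theorem quadCorr_prod (g : I → X → ℂ) (h : J → X → ℂ) (x : X × X × X × X) :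
    quadCorr (fun (p : I × J) y => g p.1 y * h p.2 y) x = quadCorr g x * quadCorr h x := by
  simp only [quadCorr, Fintype.sum_prod_type, Fintype.sum_mul_sum, star_mul']
  refine sum_congr rfl fun i _ => sum_congr rfl fun j _ => ?_
  ring

theorem quadCorr_star (g : I → X → ℂ) (x : X × X × X × X) :
    quadCorr (fun i y => star (g i y)) x = star (quadCorr g x) := by
  simp only [quadCorr, star_sum, star_mul', star_star]

theorem sum_comp_le_two_mul_sum {α β : Type*} [Fintype β] [DecidableEq β] (s : Finset α)
    (φ : α → β) (hφ : ∀ b, #{a ∈ s | φ a = b} ≤ 2) (f : β → ℝ) (hf : ∀ b, 0 ≤ f b) :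
    ∑ a ∈ s, f (φ a) ≤ 2 * ∑ b, f b := by
  rw [← sum_fiberwise s φ, mul_sum]
  refine sum_le_sum fun b _ => ?_
  rw [sum_congr rfl fun a ha => by rw [(mem_filter.1 ha).2], sum_const, nsmul_eq_mul]
  gcongr
  · exact hf b
  · exact_mod_cast hφ b

theorem mul_mul_mul_le_sum_pow_four (a b c d : ℝ) :
    a * b * c * d ≤ (a ^ 4 + b ^ 4 + c ^ 4 + d ^ 4) / 4 := by
  nlinarith [sq_nonneg (a * b - c * d), sq_nonneg (a ^ 2 - b ^ 2), sq_nonneg (c ^ 2 - d ^ 2)]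

end FourthMoment

section QuadraticFamily

variable {F : Type*} [Field F] [Fintype F]

/-- The value at `u` of the polynomial `a X ^ 2 + b X + c`, where `Q = (a, b, c)`. -/
def quadEval (Q : F × F × F) (u : F) : F := Q.1 * u ^ 2 + Q.2.1 * u + Q.2.2

omit [Fintype F] in
theorem quadEval_add_smul (Q P : F × F × F) (t u : F) :
    quadEval (Q + t • P) u = quadEval Q u + t * quadEval P u := by
  simp only [quadEval, Prod.fst_add, Prod.snd_add, Prod.smul_fst, Prod.smul_snd, smul_eq_mul]
  ring

theorem card_mul_sum_eq_sum_sum_add_smul (P : F × F × F) (H : F × F × F → ℂ) :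
    (Fintype.card F : ℂ) * ∑ Q, H Q = ∑ Q, ∑ t : F, H (Q + t • P) := by
  rw [sum_comm, ← nsmul_eq_mul, ← card_univ, ← sum_const]
  exact sum_congr rfl fun t _ =>
    (Fintype.sum_equiv (Equiv.addRight (t • P)) _ _ fun _ => rfl).symm

theorem sum_quadEval_mul_eq_zero {χ : MulChar F ℂ} (hχ : χ ≠ 1) {u a b : F} (hua : u ≠ a)
    (hub : u ≠ b) (G : F → F → ℂ) :
    ∑ Q, χ (quadEval Q u) * G (quadEval Q a) (quadEval Q b) = 0 := by
  have h1 : u - a ≠ 0 := sub_ne_zero.2 hua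
  have h2 : u - b ≠ 0 := sub_ne_zero.2 hub
  set k := ((u - a) * (u - b))⁻¹
  have hk : k * ((u - a) * (u - b)) = 1 := inv_mul_cancel₀ (mul_ne_zero h1 h2)
  set P : F × F × F := (k, -k * (a + b), k * a * b) with hP
  have hPu : quadEval P u = 1 := by simp only [hP, quadEval]; linear_combination hk
  have hPa : quadEval P a = 0 := by simp only [hP, quadEval]; ring
  have hPb : quadEval P b = 0 := by simp only [hP, quadEval]; ring
  have hq : (Fintype.card F : ℂ) ≠ 0 := by exact_mod_cast Fintype.card_ne_zero
  refine (mul_eq_zero.1 ?_).resolve_left hq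
  rw [card_mul_sum_eq_sum_sum_add_smul P]
  refine sum_eq_zero fun Q _ => ?_
  simp only [quadEval_add_smul, hPu, hPa, hPb, mul_zero, mul_one, add_zero, ← sum_mul]
  simp only [add_comm _ (_ : F), MulChar.sum_add_eq_zero hχ, zero_mul]

theorem card_quadEval_div_eq_le [DecidableEq F] {u v p r : F} (huv : u ≠ v) (hp : p ≠ 0)
    (hr : r ≠ 0) : #{Q : F × F × F | quadEval Q u / p = quadEval Q v / r} ≤ Fintype.card F ^ 2 := by
  have hcard : #(univ : Finset (F × F)) = Fintype.card F ^ 2 := by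
    simp [pow_two]
  rw [← hcard]
  by_cases hpr : p = r
  · refine card_le_card_of_injOn (fun Q => (Q.1, Q.2.2)) (fun _ _ => mem_coe.2 (mem_univ _)) ?_
    rintro ⟨a, b, c⟩ h ⟨a', b', c'⟩ h' he
    have h := (mem_filter.1 (mem_coe.1 h)).2
    have h' := (mem_filter.1 (mem_coe.1 h')).2
    simp only [quadEval, hpr] at h h'
    rw [div_left_inj' hr] at h h'
    simp only [Prod.mk.injEq] at he ⊢
    obtain ⟨rfl, rfl⟩ := he
    refine ⟨rfl, ?_, rfl⟩
    apply mul_right_cancel₀ (sub_ne_zero.2 huv)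
    linear_combination h - h'
  · refine card_le_card_of_injOn (fun Q => (Q.1, Q.2.1)) (fun _ _ => mem_coe.2 (mem_univ _)) ?_
    rintro ⟨a, b, c⟩ h ⟨a', b', c'⟩ h' he
    have h := (mem_filter.1 (mem_coe.1 h)).2
    have h' := (mem_filter.1 (mem_coe.1 h')).2
    simp only [quadEval] at h h'
    rw [div_eq_div_iff hp hr] at h h'
    simp only [Prod.mk.injEq] at he ⊢
    obtain ⟨rfl, rfl⟩ := he
    refine ⟨rfl, rfl, ?_⟩
    apply mul_right_cancel₀ (sub_ne_zero.2 hpr)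
    linear_combination h' - h

theorem MulChar.sum_add_mul_mul_inv_add_mul [DecidableEq F] {χ : MulChar F ℂ} (hχ : χ ≠ 1)
    {p r : F} (hp : p ≠ 0) (hr : r ≠ 0) (a b : F) :
    ∑ t, χ (a + t * p) * χ⁻¹ (b + t * r) =
      χ p * χ⁻¹ r * ((if a / p = b / r then (Fintype.card F : ℂ) else 0) - 1) := by
  have h : ∀ t, χ (a + t * p) * χ⁻¹ (b + t * r) =
      χ p * χ⁻¹ r * (χ (t + a / p) * χ⁻¹ (t + b / r)) := fun t => by
    rw [show a + t * p = p * (t + a / p) by field_simp; ring,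
      show b + t * r = r * (t + b / r) by field_simp; ring, map_mul, map_mul]
    ring
  rw [sum_congr rfl fun t _ => h t, ← mul_sum]
  congr 1
  split_ifs with hab
  · simp only [hab, ← MulChar.mul_apply, mul_inv_cancel]
    rw [Fintype.sum_equiv (Equiv.addRight (b / r)) (fun t => (1 : MulChar F ℂ) (t + b / r))
      (fun t => (1 : MulChar F ℂ) t) fun _ => rfl, MulChar.sum_one_eq_card_units,
      Fintype.card_units, Nat.cast_sub Fintype.card_pos]
    simp
  · rw [MulChar.sum_add_mul_inv_add hχ hab]
    ring

theorem quadCorr_quadEval (χ : MulChar F ℂ) (u : F × F × F × F) :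
    quadCorr (fun Q v => χ (quadEval Q v)) u = ∑ Q, χ (quadEval Q u.1) * χ (quadEval Q u.2.1) *
      χ⁻¹ (quadEval Q u.2.2.1) * χ⁻¹ (quadEval Q u.2.2.2) := by
  simp only [quadCorr, MulChar.star_apply']

theorem norm_quadCorr_quadEval_le_sq {χ : MulChar F ℂ} (hχ : χ ≠ 1) {u₁ u₂ u₃ u₄ : F}
    (h12 : u₁ ≠ u₂) (h13 : u₁ ≠ u₃) (h14 : u₁ ≠ u₄) (h23 : u₂ ≠ u₃) (h24 : u₂ ≠ u₄)
    (h34 : u₃ ≠ u₄) :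
    ‖quadCorr (fun Q v => χ (quadEval Q v)) (u₁, u₂, u₃, u₄)‖ ≤ (Fintype.card F : ℝ) ^ 2 := by
  classical
  rw [quadCorr_quadEval]
  set P : F × F × F := (1, -(u₁ + u₃), u₁ * u₃) with hP
  have hP1 : quadEval P u₁ = 0 := by simp only [hP, quadEval]; ring
  have hP3 : quadEval P u₃ = 0 := by simp only [hP, quadEval]; ring
  have hP2 : quadEval P u₂ ≠ 0 := by
    rw [show quadEval P u₂ = (u₂ - u₁) * (u₂ - u₃) by simp only [hP, quadEval]; ring]
    exact mul_ne_zero (sub_ne_zero.2 h12.symm) (sub_ne_zero.2 h23)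
  have hP4 : quadEval P u₄ ≠ 0 := by
    rw [show quadEval P u₄ = (u₄ - u₁) * (u₄ - u₃) by simp only [hP, quadEval]; ring]
    exact mul_ne_zero (sub_ne_zero.2 h14.symm) (sub_ne_zero.2 h34.symm)
  have hq : (Fintype.card F : ℂ) ≠ 0 := by exact_mod_cast Fintype.card_ne_zero
  set κ := χ (quadEval P u₂) * χ⁻¹ (quadEval P u₄)
  have hκ : ‖κ‖ = 1 := by
    rw [norm_mul, MulChar.norm_apply_of_ne_zero _ hP2, MulChar.norm_apply_of_ne_zero _ hP4, one_mul]
  set C : Finset (F × F × F) :=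
    {Q | quadEval Q u₂ / quadEval P u₂ = quadEval Q u₄ / quadEval P u₄} with hC
  have key : ∑ Q, χ (quadEval Q u₁) * χ (quadEval Q u₂) * χ⁻¹ (quadEval Q u₃) *
      χ⁻¹ (quadEval Q u₄) = κ * ∑ Q ∈ C, χ (quadEval Q u₁) * χ⁻¹ (quadEval Q u₃) := by
    apply mul_left_cancel₀ hq
    rw [card_mul_sum_eq_sum_sum_add_smul P]
    have h0 := sum_quadEval_mul_eq_zero hχ h13 h13 (fun x _ => χ⁻¹ x)
    have h1 : ∀ Q, ∑ t : F, χ (quadEval (Q + t • P) u₁) * χ (quadEval (Q + t • P) u₂) *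
        χ⁻¹ (quadEval (Q + t • P) u₃) * χ⁻¹ (quadEval (Q + t • P) u₄) =
        (Fintype.card F * κ) * (if quadEval Q u₂ / quadEval P u₂ = quadEval Q u₄ / quadEval P u₄
          then χ (quadEval Q u₁) * χ⁻¹ (quadEval Q u₃) else 0) -
        κ * (χ (quadEval Q u₁) * χ⁻¹ (quadEval Q u₃)) := fun Q => by
      simp only [quadEval_add_smul, hP1, hP3, mul_zero, add_zero]
      rw [sum_congr rfl fun t _ => show _ = χ (quadEval Q u₁) * χ⁻¹ (quadEval Q u₃) *
        (χ (quadEval Q u₂ + t * quadEval P u₂) * χ⁻¹ (quadEval Q u₄ + t * quadEval P u₄)) by ring,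
        ← mul_sum, MulChar.sum_add_mul_mul_inv_add_mul hχ hP2 hP4]
      split_ifs <;> ring
    rw [sum_congr rfl fun Q _ => h1 Q, sum_sub_distrib, ← mul_sum, ← mul_sum, h0, ← sum_filter]
    ring
  rw [key, norm_mul, hκ, one_mul]
  calc ‖∑ Q ∈ C, χ (quadEval Q u₁) * χ⁻¹ (quadEval Q u₃)‖
      ≤ ∑ Q ∈ C, (1 : ℝ) := norm_sum_le_of_le _ fun Q _ => by
        rw [norm_mul]
        exact mul_le_one₀ (MulChar.norm_apply_le_one _ _) (norm_nonneg _)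
          (MulChar.norm_apply_le_one _ _)
    _ = #C := by simp
    _ ≤ _ := by exact_mod_cast card_quadEval_div_eq_le h24 hP2 hP4

theorem norm_quadCorr_quadEval_le_cube (χ : MulChar F ℂ) (u : F × F × F × F) :
    ‖quadCorr (fun Q v => χ (quadEval Q v)) u‖ ≤ (Fintype.card F : ℝ) ^ 3 := by
  rw [quadCorr_quadEval]
  calc _ ≤ ∑ Q : F × F × F, (1 : ℝ) := norm_sum_le_of_le _ fun Q _ => by
        rw [norm_mul, norm_mul, norm_mul]
        have h := fun (ψ : MulChar F ℂ) v => MulChar.norm_apply_le_one ψ v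
        exact mul_le_one₀ (mul_le_one₀ (mul_le_one₀ (h _ _) (norm_nonneg _) (h _ _))
          (norm_nonneg _) (h _ _)) (norm_nonneg _) (h _ _)
    _ = _ := by simp; ring

theorem norm_quadCorr_quadEval_sq_le [DecidableEq F] {χ : MulChar F ℂ} (hχ : χ ≠ 1)
    (u₁ u₂ u₃ u₄ : F) :
    ‖quadCorr (fun Q v => χ (quadEval Q v)) (u₁, u₂, u₃, u₄)‖ ^ 2 ≤ (Fintype.card F : ℝ) ^ 4 +
      (Fintype.card F : ℝ) ^ 6 * ((if u₁ = u₃ then if u₂ = u₄ then 1 else 0 else 0) +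
        (if u₁ = u₄ then if u₂ = u₃ then 1 else 0 else 0) +
        (if u₁ = u₂ then if u₃ = u₄ then 1 else 0 else 0)) := by
  have hχ' : χ⁻¹ ≠ 1 := inv_ne_one.2 hχ
  set q := (Fintype.card F : ℝ)
  have hq : 0 ≤ q := Nat.cast_nonneg _
  have nonneg : ∀ a b c d : F, (0 : ℝ) ≤ if a = b then if c = d then 1 else 0 else 0 := by
    intro a b c d; split_ifs <;> norm_num
  have n1 := nonneg u₁ u₃ u₂ u₄
  have n2 := nonneg u₁ u₄ u₂ u₃
  have n3 := nonneg u₁ u₂ u₃ u₄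
  have big : ∀ x : ℝ, 1 ≤ x → ‖quadCorr (fun Q v => χ (quadEval Q v)) (u₁, u₂, u₃, u₄)‖ ^ 2 ≤
      q ^ 4 + q ^ 6 * x := fun x hx => by
    have := norm_quadCorr_quadEval_le_cube χ (u₁, u₂, u₃, u₄)
    calc _ ≤ (q ^ 3) ^ 2 := by gcongr
      _ ≤ q ^ 4 + q ^ 6 * x := by nlinarith [pow_nonneg hq 4, pow_nonneg hq 6]
  have zero : quadCorr (fun Q v => χ (quadEval Q v)) (u₁, u₂, u₃, u₄) = 0 → ∀ x : ℝ, 0 ≤ x →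
      ‖quadCorr (fun Q v => χ (quadEval Q v)) (u₁, u₂, u₃, u₄)‖ ^ 2 ≤ q ^ 4 + q ^ 6 * x :=
    fun h x hx => by
      rw [h]
      have := pow_nonneg hq 4
      have := mul_nonneg (pow_nonneg hq 6) hx
      simp only [norm_zero]
      nlinarith
  have n := add_nonneg (add_nonneg n1 n2) n3
  have zero' : ∀ ψ : MulChar F ℂ, ψ ≠ 1 → ∀ v a b : F, v ≠ a → v ≠ b → ∀ G : F → F → ℂ,
      (∀ Q, χ (quadEval Q u₁) * χ (quadEval Q u₂) * χ⁻¹ (quadEval Q u₃) * χ⁻¹ (quadEval Q u₄) =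
        ψ (quadEval Q v) * G (quadEval Q a) (quadEval Q b)) →
      ‖quadCorr (fun Q v => χ (quadEval Q v)) (u₁, u₂, u₃, u₄)‖ ^ 2 ≤ _ :=
    fun ψ hψ v a b ha hb G hG => zero (by
      rw [quadCorr_quadEval, ← sum_quadEval_mul_eq_zero hψ ha hb G]
      exact sum_congr rfl fun Q _ => hG Q) _ n
  by_cases h12 : u₁ = u₂
  · by_cases h34 : u₃ = u₄
    · exact big _ (by rw [if_pos h12, if_pos h34]; linarith)
    · subst h12
      by_cases h13 : u₃ = u₁
      · subst h13
        exact zero' _ hχ' u₄ u₃ u₃ (Ne.symm h34) (Ne.symm h34) (fun x _ => χ x * χ x * χ⁻¹ x)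
          fun Q => by ring
      · exact zero' _ hχ' u₃ u₁ u₄ h13 h34 (fun x y => χ x * χ x * χ⁻¹ y)
          fun Q => by ring
  by_cases h13 : u₁ = u₃
  · by_cases h24 : u₂ = u₄
    · exact big _ (by rw [if_pos h13, if_pos h24]; linarith)
    · subst h13
      exact zero' _ hχ u₂ u₁ u₄ (Ne.symm h12) h24 (fun x y => χ x * χ⁻¹ x * χ⁻¹ y)
        fun Q => by ring
  by_cases h14 : u₁ = u₄
  · by_cases h23 : u₂ = u₃
    · exact big _ (by rw [if_pos h14, if_pos h23]; linarith)
    · subst h14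
      exact zero' _ hχ u₂ u₁ u₃ (Ne.symm h12) h23 (fun x y => χ x * χ⁻¹ y * χ⁻¹ x)
        fun Q => by ring
  by_cases h23 : u₂ = u₃
  · subst h23
    exact zero' _ hχ u₁ u₂ u₄ h12 h14 (fun x y => χ x * χ⁻¹ x * χ⁻¹ y)
      fun Q => by ring
  by_cases h24 : u₂ = u₄
  · subst h24
    exact zero' _ hχ u₁ u₂ u₃ h12 h13 (fun x y => χ x * χ⁻¹ y * χ⁻¹ x)
      fun Q => by ring
  by_cases h34 : u₃ = u₄
  · subst h34
    exact zero' _ hχ u₁ u₂ u₃ h12 h13 (fun x y => χ x * χ⁻¹ y * χ⁻¹ y)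
      fun Q => by ring
  have := norm_quadCorr_quadEval_le_sq hχ h12 h13 h14 h23 h24 h34
  calc _ ≤ (q ^ 2) ^ 2 := by gcongr
    _ ≤ _ := by nlinarith [mul_nonneg (pow_nonneg hq 6) n]

theorem sum_norm_quadCorr_quadEval_sq_le {χ : MulChar F ℂ} (hχ : χ ≠ 1) :
    ∑ u, ‖quadCorr (fun Q v => χ (quadEval Q v)) u‖ ^ 2 ≤ 4 * (Fintype.card F : ℝ) ^ 8 := by
  classical
  simp only [Fintype.sum_prod_type]
  refine (sum_le_sum fun u₁ _ => sum_le_sum fun u₂ _ => sum_le_sum fun u₃ _ => sum_le_sum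
    fun u₄ _ => norm_quadCorr_quadEval_sq_le hχ u₁ u₂ u₃ u₄).trans (le_of_eq ?_)
  simp only [sum_add_distrib, mul_add, ← mul_sum, sum_const, card_univ, nsmul_eq_mul,
    Finset.sum_ite_eq, Finset.sum_ite_irrel, mem_univ, if_true, mul_one, mul_zero]
  ring

theorem sum_norm_sum_quadEval_pow_four_le {χ : MulChar F ℂ} (hχ : χ ≠ 1) :
    ∑ p : (F × F × F) × F × F × F,
      ‖∑ u, χ (quadEval p.1 u) * star (χ (quadEval p.2 u))‖ ^ 4 ≤ 4 * (Fintype.card F : ℝ) ^ 8 := by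
  refine le_trans (le_of_eq ?_) (sum_norm_quadCorr_quadEval_sq_le hχ)
  have := sum_norm_sum_pow_four (fun (p : (F × F × F) × F × F × F) u =>
    χ (quadEval p.1 u) * star (χ (quadEval p.2 u)))
  rw [sum_congr rfl fun u _ => (quadCorr_prod (fun Q v => χ (quadEval Q v))
    (fun Q v => star (χ (quadEval Q v))) u).trans (congrArg _ (quadCorr_star _ u))] at this
  apply Complex.ofReal_injective
  rw [this]
  push_cast
  exact sum_congr rfl fun u _ => Complex.mul_conj' _

end QuadraticFamily

section ShiftedProducts

variable {F : Type*} [Field F] [Fintype F]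

theorem sum_norm_quadCorr_add_pow_four_le {χ : MulChar F ℂ} (hχ : χ ≠ 1) :
    ((Fintype.card F : ℝ) - 1) ^ 2 * ∑ x, ‖quadCorr (fun u y => χ (y + u)) x‖ ^ 4 ≤
      16 * (Fintype.card F : ℝ) ^ 8 := by
  classical
  set s : Finset (F × F × F) := (univ.erase 0) ×ˢ (univ ×ˢ univ) with hs
  set φ : F × F × F → F × F × F := fun p => (p.1, p.1 * (p.2.1 + p.2.2), p.1 * (p.2.1 * p.2.2))
    with hφ
  set h : F × F × F → F × F × F → ℝ := fun Q R =>
    ‖∑ u, χ (quadEval Q u) * star (χ (quadEval R u))‖ ^ 4 with hh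
  have fib : ∀ Q, #{p ∈ s | φ p = Q} ≤ 2 := by
    intro Q
    by_cases hne : ({p ∈ s | φ p = Q}).Nonempty
    · obtain ⟨⟨c, x, y⟩, hp⟩ := hne
      have hp' : c ≠ 0 ∧ φ (c, x, y) = Q := by simpa [hs] using hp
      refine le_trans (card_le_card (t := {(c, x, y), (c, y, x)}) ?_) card_le_two
      rintro ⟨c', x', y'⟩ hm
      have hm' : c' ≠ 0 ∧ φ (c', x', y') = Q := by simpa [hs] using hm
      have he := hm'.2.trans hp'.2.symm
      simp only [hφ, Prod.mk.injEq] at he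
      obtain ⟨rfl, h1, h2⟩ := he
      have h1 := mul_left_cancel₀ hp'.1 h1
      have h2 := mul_left_cancel₀ hp'.1 h2
      have h3 : (x' - x) * (x' - y) = 0 := by linear_combination x' * h1 - h2
      rcases mul_eq_zero.1 h3 with h3 | h3
      · obtain rfl := sub_eq_zero.1 h3
        simp [add_left_cancel h1]
      · obtain rfl := sub_eq_zero.1 h3
        have : y' = x := by linear_combination h1
        simp [this]
    · simp [not_nonempty_iff_eq_empty.1 hne]
  have hnn : ∀ Q R, 0 ≤ h Q R := fun Q R => pow_nonneg (norm_nonneg _) _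
  have h1 : ∑ a ∈ s, ∑ b ∈ s, h (φ a) (φ b) ≤ 4 * ∑ Q, ∑ R, h Q R := by
    calc ∑ a ∈ s, ∑ b ∈ s, h (φ a) (φ b) ≤ ∑ a ∈ s, 2 * ∑ R, h (φ a) R :=
          sum_le_sum fun a _ => sum_comp_le_two_mul_sum s φ fib (h (φ a)) (hnn _)
      _ ≤ 2 * ∑ Q, 2 * ∑ R, h Q R := sum_comp_le_two_mul_sum s φ fib (fun Q => 2 * ∑ R, h Q R)
          fun Q => mul_nonneg zero_le_two (sum_nonneg fun R _ => hnn _ _)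
      _ = _ := by rw [← mul_sum]; ring
  have h2 : ∑ Q, ∑ R, h Q R ≤ 4 * (Fintype.card F : ℝ) ^ 8 := by
    have := sum_norm_sum_quadEval_pow_four_le hχ
    rwa [Fintype.sum_prod_type] at this
  have h3 : ∀ c ≠ 0, ∀ d ≠ 0, ∀ x y z w, h (φ (c, x, y)) (φ (d, z, w)) =
      ‖quadCorr (fun u y => χ (y + u)) (x, y, z, w)‖ ^ 4 := by
    intro c hc d hd x y z w
    have e : ∀ u, χ (quadEval (φ (c, x, y)) u) * star (χ (quadEval (φ (d, z, w)) u)) =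
        (χ c * star (χ d)) * (χ (x + u) * χ (y + u) * star (χ (z + u)) * star (χ (w + u))) := by
      intro u
      have e' : ∀ c x y : F, quadEval (φ (c, x, y)) u = c * ((x + u) * (y + u)) := by
        intro c x y; simp only [hφ, quadEval]; ring
      simp only [e', map_mul, star_mul']
      ring
    simp only [hh, quadCorr]
    rw [sum_congr rfl fun u _ => e u, ← mul_sum, norm_mul, norm_mul, norm_star,
      MulChar.norm_apply_of_ne_zero _ hc, MulChar.norm_apply_of_ne_zero _ hd, one_mul, one_mul]
  have h4 : ∑ a ∈ s, ∑ b ∈ s, h (φ a) (φ b) =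
      ((Fintype.card F : ℝ) - 1) ^ 2 * ∑ x, ‖quadCorr (fun u y => χ (y + u)) x‖ ^ 4 := by
    have hc : (#(univ.erase (0 : F)) : ℝ) = Fintype.card F - 1 := by
      rw [card_erase_of_mem (mem_univ _), card_univ, Nat.cast_sub Fintype.card_pos, Nat.cast_one]
    calc _ = ∑ c ∈ univ.erase (0 : F), ∑ x, ∑ y, ∑ d ∈ univ.erase (0 : F), ∑ z, ∑ w,
          ‖quadCorr (fun u y => χ (y + u)) (x, y, z, w)‖ ^ 4 := by
          simp only [hs, sum_product]
          exact sum_congr rfl fun c hc => sum_congr rfl fun x _ => sum_congr rfl fun y _ =>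
            sum_congr rfl fun d hd => sum_congr rfl fun z _ => sum_congr rfl fun w _ =>
              h3 c (ne_of_mem_erase hc) d (ne_of_mem_erase hd) x y z w
      _ = _ := by
          simp only [sum_const, nsmul_eq_mul, hc, ← mul_sum, Fintype.sum_prod_type]
          ring
  rw [← h4]
  linarith

theorem sum_norm_sum_mul_add_pow_four_le {χ₁ χ₂ χ₃ χ₄ : MulChar F ℂ} (h₁ : χ₁ ≠ 1) (h₂ : χ₂ ≠ 1)
    (h₃ : χ₃ ≠ 1) (h₄ : χ₄ ≠ 1) :
    ((Fintype.card F : ℝ) - 1) ^ 2 * ∑ u : F × F × F × F,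
      ‖∑ x, χ₁ (x + u.1) * (χ₂ (x + u.2.1) * (χ₃ (x + u.2.2.1) * χ₄ (x + u.2.2.2)))‖ ^ 4 ≤
      16 * (Fintype.card F : ℝ) ^ 8 := by
  set T : MulChar F ℂ → F × F × F × F → ℂ := fun χ => quadCorr (fun u y => χ (y + u)) with hT
  have e := sum_norm_sum_pow_four (fun (u : F × F × F × F) x =>
    χ₁ (x + u.1) * (χ₂ (x + u.2.1) * (χ₃ (x + u.2.2.1) * χ₄ (x + u.2.2.2))))
  have e' : ∀ y, quadCorr (fun (u : F × F × F × F) x =>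
      χ₁ (x + u.1) * (χ₂ (x + u.2.1) * (χ₃ (x + u.2.2.1) * χ₄ (x + u.2.2.2)))) y =
      T χ₁ y * (T χ₂ y * (T χ₃ y * T χ₄ y)) := by
    intro y
    rw [quadCorr_prod (fun u x => χ₁ (x + u)) (fun (u : F × F × F) x =>
        χ₂ (x + u.1) * (χ₃ (x + u.2.1) * χ₄ (x + u.2.2))),
      quadCorr_prod (fun u x => χ₂ (x + u)) (fun (u : F × F) x => χ₃ (x + u.1) * χ₄ (x + u.2)),
      quadCorr_prod (fun u x => χ₃ (x + u)) (fun u x => χ₄ (x + u))]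
  rw [sum_congr rfl fun y _ => e' y] at e
  have hle : ∑ u : F × F × F × F,
      ‖∑ x, χ₁ (x + u.1) * (χ₂ (x + u.2.1) * (χ₃ (x + u.2.2.1) * χ₄ (x + u.2.2.2)))‖ ^ 4 ≤
      ∑ y, (‖T χ₁ y‖ ^ 4 + ‖T χ₂ y‖ ^ 4 + ‖T χ₃ y‖ ^ 4 + ‖T χ₄ y‖ ^ 4) / 4 := by
    have e2 := congrArg norm e
    rw [Complex.norm_real, Real.norm_of_nonneg
      (sum_nonneg fun u _ => pow_nonneg (norm_nonneg _) _)] at e2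
    rw [e2]
    refine norm_sum_le_of_le _ fun y _ => ?_
    rw [norm_mul, norm_mul, norm_mul, ← mul_assoc, ← mul_assoc]
    exact mul_mul_mul_le_sum_pow_four _ _ _ _
  rw [← sum_div, sum_add_distrib, sum_add_distrib, sum_add_distrib] at hle
  have b₁ := sum_norm_quadCorr_add_pow_four_le h₁
  have b₂ := sum_norm_quadCorr_add_pow_four_le h₂
  have b₃ := sum_norm_quadCorr_add_pow_four_le h₃
  have b₄ := sum_norm_quadCorr_add_pow_four_le h₄
  have := mul_le_mul_of_nonneg_left hle (sq_nonneg ((Fintype.card F : ℝ) - 1))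
  linarith

/-- The sum of `χ₁ x * χ₂ (x + 1) * χ₃ (x + 2)` over the field. -/
noncomputable def tripleSum (χ₁ χ₂ χ₃ : MulChar F ℂ) : ℂ := ∑ x, χ₁ x * χ₂ (x + 1) * χ₃ (x + 2)

theorem norm_mul_mul_le_one (χ₁ χ₂ χ₃ : MulChar F ℂ) (x y z : F) :
    ‖χ₁ x * χ₂ y * χ₃ z‖ ≤ 1 := by
  rw [norm_mul, norm_mul]
  have h := fun (ψ : MulChar F ℂ) v => MulChar.norm_apply_le_one ψ v
  exact mul_le_one₀ (mul_le_one₀ (h _ _) (norm_nonneg _) (h _ _)) (norm_nonneg _) (h _ _)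

theorem norm_tripleSum_le_moebius (χ₁ χ₂ χ₃ : MulChar F ℂ) (d : F) {α β : F} (hα : α ≠ 0)
    (h0 : β ≠ 0) (h1 : β + 1 ≠ 0) (h2 : β + 2 ≠ 0) :
    ‖tripleSum χ₁ χ₂ χ₃‖ ≤ ‖∑ y, χ₁ (y + (d + α / β)) * (χ₂ (y + (d + α / (β + 1))) *
      (χ₃ (y + (d + α / (β + 2))) * (χ₁ * χ₂ * χ₃)⁻¹ (y + d)))‖ + 1 := by
  classical
  set f : F → ℂ := fun x => χ₁ x * χ₂ (x + 1) * χ₃ (x + 2) with hf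
  set g : F → ℂ := fun y => χ₁ (y + (d + α / β)) * (χ₂ (y + (d + α / (β + 1))) *
      (χ₃ (y + (d + α / (β + 2))) * (χ₁ * χ₂ * χ₃)⁻¹ (y + d))) with hg
  have hbij : Function.Bijective fun y => β + α * (y + d)⁻¹ :=
    (Equiv.addLeft β).bijective.comp ((mulLeft_bijective₀ α hα).comp
      ((inv_involutive (G := F)).bijective.comp (Equiv.addRight d).bijective))
  have key : ∀ y, f (β + α * (y + d)⁻¹) = f β * g y + if y = -d then f β else 0 := by
    intro y
    split_ifs with hy
    · subst hy
      simp [hg, MulChar.map_zero]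
    · have hyd : y + d ≠ 0 := fun h => hy (eq_neg_of_add_eq_zero_left h)
      have inv : ∀ {a : F}, a ≠ 0 → ∀ χ : MulChar F ℂ,
          χ (a + α * (y + d)⁻¹) = χ a * (χ (y + (d + α / a)) * χ⁻¹ (y + d)) := by
        intro a ha χ
        rw [MulChar.inv_apply', ← map_mul, ← map_mul]
        congr 1
        field_simp
        ring
      have e1 := inv h0 χ₁
      have e2 := inv h1 χ₂
      have e3 := inv h2 χ₃
      simp only [hf, hg, add_zero, mul_inv, MulChar.mul_apply]
      rw [show β + α * (y + d)⁻¹ + 1 = β + 1 + α * (y + d)⁻¹ by ring,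
        show β + α * (y + d)⁻¹ + 2 = β + 2 + α * (y + d)⁻¹ by ring, e1, e2, e3]
      ring
  have hS : tripleSum χ₁ χ₂ χ₃ = f β * ∑ y, g y + f β := by
    rw [tripleSum, ← Fintype.sum_bijective _ hbij (fun y => f (β + α * (y + d)⁻¹)) f fun _ => rfl,
      sum_congr rfl fun y _ => key y, sum_add_distrib, ← mul_sum]
    simp
  have hfβ : ‖f β‖ ≤ 1 := norm_mul_mul_le_one _ _ _ _ _ _
  rw [hS]
  refine (norm_add_le _ _).trans (add_le_add ?_ hfβ)
  rw [norm_mul]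
  exact mul_le_of_le_one_left (norm_nonneg _) hfβ

theorem norm_tripleSum_sub_one_pow_four_le {χ₁ χ₂ χ₃ : MulChar F ℂ} (h₁ : χ₁ ≠ 1) (h₂ : χ₂ ≠ 1)
    (h₃ : χ₃ ≠ 1) (h : χ₁ * χ₂ * χ₃ ≠ 1) (hS : 1 ≤ ‖tripleSum χ₁ χ₂ χ₃‖)
    (hq : 3 ≤ Fintype.card F) :
    ((Fintype.card F : ℝ) - 1) ^ 3 * (Fintype.card F - 3) * (‖tripleSum χ₁ χ₂ χ₃‖ - 1) ^ 4 ≤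
      16 * (Fintype.card F : ℝ) ^ 7 := by
  classical
  set q := (Fintype.card F : ℝ) with hqdef
  have hq3 : 3 ≤ q := by rw [hqdef]; exact_mod_cast hq
  set t := ‖tripleSum χ₁ χ₂ χ₃‖ - 1 with ht
  set B : Finset F := univ \ {0, -1, -2} with hB
  set P : Finset (F × F × F) := univ ×ˢ (univ.erase 0 ×ˢ B) with hP
  set w : F × F × F → F × F × F × F := fun p =>
    (p.1 + p.2.1 / p.2.2, p.1 + p.2.1 / (p.2.2 + 1), p.1 + p.2.1 / (p.2.2 + 2), p.1) with hw
  set G : F × F × F × F → ℝ := fun u => ‖∑ x, χ₁ (x + u.1) * (χ₂ (x + u.2.1) *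
    (χ₃ (x + u.2.2.1) * (χ₁ * χ₂ * χ₃)⁻¹ (x + u.2.2.2)))‖ ^ 4 with hG
  have hmem : ∀ d α β, (d, α, β) ∈ P → α ≠ 0 ∧ β ≠ 0 ∧ β + 1 ≠ 0 ∧ β + 2 ≠ 0 := by
    intro d α β hp
    simp only [hP, hB, mem_product, mem_univ, true_and, mem_erase, and_true, mem_sdiff,
      mem_insert, mem_singleton, not_or] at hp
    exact ⟨hp.1, hp.2.1, fun h => hp.2.2.1 (eq_neg_of_add_eq_zero_left h),
      fun h => hp.2.2.2 (eq_neg_of_add_eq_zero_left h)⟩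
  have hinj : Set.InjOn w P := by
    rintro ⟨d, α, β⟩ hp ⟨d', α', β'⟩ hp' he
    obtain ⟨hα, h0, h1, -⟩ := hmem _ _ _ (mem_coe.1 hp)
    obtain ⟨hα', h0', h1', -⟩ := hmem _ _ _ (mem_coe.1 hp')
    simp only [hw, Prod.mk.injEq] at he
    obtain ⟨e1, e2, -, rfl⟩ := he
    have e1 := add_left_cancel e1
    have e2 := add_left_cancel e2
    rw [div_eq_div_iff h0 h0'] at e1
    rw [div_eq_div_iff h1 h1'] at e2
    have : α = α' := by linear_combination e2 - e1
    subst this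
    rw [mul_left_cancel₀ hα e1]
  have hle : ∑ p ∈ P, t ^ 4 ≤ ∑ u, G u := by
    calc ∑ p ∈ P, t ^ 4 ≤ ∑ p ∈ P, G (w p) := sum_le_sum fun p hp => by
          obtain ⟨hα, h0, h1, h2⟩ := hmem p.1 p.2.1 p.2.2 hp
          have := norm_tripleSum_le_moebius χ₁ χ₂ χ₃ p.1 hα h0 h1 h2
          exact pow_le_pow_left₀ (by linarith) (by simp only [hw]; linarith) 4
      _ = ∑ u ∈ P.image w, G u := (sum_image hinj).symm
      _ ≤ ∑ u, G u := sum_le_univ_sum_of_nonneg fun u => pow_nonneg (norm_nonneg _) _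
  have hcard : q * ((q - 1) * (q - 3)) ≤ #P := by
    have c1 : (#(univ.erase (0 : F)) : ℝ) = q - 1 := by
      rw [card_erase_of_mem (mem_univ _), card_univ, Nat.cast_sub Fintype.card_pos, Nat.cast_one]
    have c2 : q - 3 ≤ #B := by
      have h3 : #({0, -1, -2} : Finset F) ≤ 3 := card_le_three
      have h4 : Fintype.card F - #({0, -1, -2} : Finset F) ≤ #B := by
        have := le_card_sdiff ({0, -1, -2} : Finset F) univ
        rwa [card_univ] at this
      have h5 : Fintype.card F ≤ #B + 3 := by omega
      have : (Fintype.card F : ℝ) ≤ #B + 3 := by exact_mod_cast h5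
      linarith
    rw [hP, card_product, card_product, card_univ]
    push_cast
    rw [c1]
    gcongr
    linarith
  rw [sum_const, nsmul_eq_mul] at hle
  have hfinal := sum_norm_sum_mul_add_pow_four_le h₁ h₂ h₃ (inv_ne_one.2 h)
  have ht4 : 0 ≤ t ^ 4 := by positivity
  have h1 : (q - 1) ^ 2 * (q * ((q - 1) * (q - 3)) * t ^ 4) ≤ 16 * q ^ 8 :=
    calc _ ≤ (q - 1) ^ 2 * (#P * t ^ 4) := by gcongr
      _ ≤ (q - 1) ^ 2 * ∑ u, G u := by gcongr
      _ ≤ _ := hfinal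
  have hq0 : 0 < q := by linarith
  refine le_of_mul_le_mul_left (le_trans (le_of_eq ?_) (h1.trans (le_of_eq ?_))) hq0 <;> ring

theorem norm_tripleSum_le_of_mul_ne_one {χ₁ χ₂ χ₃ : MulChar F ℂ} (h₁ : χ₁ ≠ 1) (h₂ : χ₂ ≠ 1)
    (h₃ : χ₃ ≠ 1) (h : χ₁ * χ₂ * χ₃ ≠ 1) {r : ℝ} (hr : 10 ≤ r) (hrq : r ^ 4 = Fintype.card F) :
    ‖tripleSum χ₁ χ₂ χ₃‖ ≤ 3 * r ^ 3 := by
  have hr3 : (1000 : ℝ) ≤ r ^ 3 := by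
    calc (1000 : ℝ) = 10 ^ 3 := by norm_num
      _ ≤ r ^ 3 := by gcongr
  rcases le_total ‖tripleSum χ₁ χ₂ χ₃‖ 1 with hS | hS
  · linarith
  set q := (Fintype.card F : ℝ) with hqdef
  have hq : (10000 : ℝ) ≤ q := by
    rw [← hrq]
    calc (10000 : ℝ) = 10 ^ 4 := by norm_num
      _ ≤ r ^ 4 := by gcongr
  have hq3 : 3 ≤ Fintype.card F := by
    have : (3 : ℝ) ≤ (Fintype.card F : ℝ) := by linarith
    exact_mod_cast this
  have key := norm_tripleSum_sub_one_pow_four_le h₁ h₂ h₃ h hS hq3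
  rw [← hqdef] at key
  set t := ‖tripleSum χ₁ χ₂ χ₃‖ - 1 with ht
  have ht4 : 0 ≤ t ^ 4 := by positivity
  have h1 : q ^ 4 / 2 ≤ (q - 1) ^ 3 * (q - 3) := by
    have : (q - 1) ^ 3 * (q - 3) = q ^ 4 / 2 + q ^ 3 * (q / 2 - 6) + (12 * q ^ 2 - 10 * q + 3) := by
      ring
    rw [this]
    have : 0 ≤ q ^ 3 * (q / 2 - 6) := mul_nonneg (by positivity) (by linarith)
    nlinarith
  have h2 : q ^ 4 / 2 * t ^ 4 ≤ 16 * q ^ 7 := (mul_le_mul_of_nonneg_right h1 ht4).trans key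
  have h3 : t ^ 4 ≤ 32 * q ^ 3 := by
    have hq4 : 0 < q ^ 4 := by positivity
    refine le_of_mul_le_mul_left ?_ hq4
    linarith
  have h4 : t ^ 4 ≤ (5 / 2 * r ^ 3) ^ 4 := by
    calc t ^ 4 ≤ 32 * q ^ 3 := h3
      _ = 32 * r ^ 12 := by rw [← hrq]; ring
      _ ≤ (5 / 2 * r ^ 3) ^ 4 := by
        have : 0 ≤ r ^ 12 := by positivity
        nlinarith
  have h5 : t ≤ 5 / 2 * r ^ 3 := le_of_pow_le_pow_left₀ (by norm_num) (by positivity) h4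
  linarith

theorem norm_sum_mul_one_add_le (f : F → ℂ) (hf : ∀ x, ‖f x‖ ≤ 1) (a : F) :
    ‖∑ x, f x * (1 : MulChar F ℂ) (x + a)‖ ≤ ‖∑ x, f x‖ + 1 := by
  classical
  have h : ∀ x, f x * (1 : MulChar F ℂ) (x + a) = f x - if x = -a then f x else 0 := by
    intro x
    split_ifs with hx
    · subst hx; simp [MulChar.map_zero]
    · rw [MulChar.one_apply (isUnit_iff_ne_zero.2 fun h => hx (eq_neg_of_add_eq_zero_left h))]
      ring
  rw [sum_congr rfl fun x _ => h x, sum_sub_distrib, sum_ite_eq' univ (-a), if_pos (mem_univ _)]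
  exact (norm_sub_le _ _).trans (by gcongr; exact hf _)

theorem norm_sum_add_mul_add_le (χ ψ : MulChar F ℂ) (h : ¬(χ = 1 ∧ ψ = 1)) {a b : F} (hab : a ≠ b)
    {r : ℝ} (hrq : r ^ 4 = Fintype.card F) :
    ‖∑ x, χ (x + a) * ψ (x + b)‖ ≤ r ^ 2 + 1 := by
  by_cases hψ : ψ = 1
  · subst hψ
    refine (norm_sum_mul_one_add_le _ (fun x => MulChar.norm_apply_le_one _ _) b).trans ?_
    rw [MulChar.sum_add_eq_zero fun hχ => h ⟨hχ, rfl⟩]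
    simpa using sq_nonneg r
  by_cases hχ : χ = 1
  · subst hχ
    simp only [mul_comm ((1 : MulChar F ℂ) _)]
    refine (norm_sum_mul_one_add_le _ (fun x => MulChar.norm_apply_le_one _ _) a).trans ?_
    rw [MulChar.sum_add_eq_zero hψ]
    simpa using sq_nonneg r
  have h1 := MulChar.norm_sum_add_mul_add_sq_le hχ hψ hab
  rw [← hrq, show r ^ 4 = (r ^ 2) ^ 2 by ring] at h1
  have := le_of_pow_le_pow_left₀ two_ne_zero (sq_nonneg r) h1
  linarith

theorem norm_tripleSum_le_of_mul_eq_one {χ₁ χ₂ χ₃ : MulChar F ℂ} (h₂ : χ₂ ≠ 1)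
    (h : χ₁ * χ₂ * χ₃ = 1) (hF : (2 : F) ≠ 0) {r : ℝ} (hrq : r ^ 4 = Fintype.card F) :
    ‖tripleSum χ₁ χ₂ χ₃‖ ≤ r ^ 2 + 2 := by
  set f : F → ℂ := fun x => χ₁ x * χ₂ (x + 1) * χ₃ (x + 2) with hf
  have hχ₁ : χ₁ = χ₂⁻¹ * χ₃⁻¹ := by
    rw [← mul_inv]
    exact eq_inv_of_mul_eq_one_left (by rw [← mul_assoc, h])
  have key : ∀ y : F, f y⁻¹ = χ₃ 2 * (χ₂ (y + 1) * χ₃ (y + 2⁻¹) * (1 : MulChar F ℂ) (y + 0)) := by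
    intro y
    rcases eq_or_ne y 0 with rfl | hy
    · simp [hf, MulChar.map_zero]
    · have e2 : χ₂⁻¹ y⁻¹ * χ₂ (y⁻¹ + 1) = χ₂ (y + 1) := by
        rw [MulChar.inv_apply', inv_inv, ← map_mul]
        congr 1
        field_simp
        ring
      have e3 : χ₃⁻¹ y⁻¹ * χ₃ (y⁻¹ + 2) = χ₃ 2 * χ₃ (y + 2⁻¹) := by
        rw [MulChar.inv_apply', inv_inv, ← map_mul, ← map_mul]
        congr 1
        field_simp
        ring
      rw [add_zero, MulChar.one_apply (isUnit_iff_ne_zero.2 hy), mul_one]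
      simp only [hf, hχ₁, MulChar.mul_apply]
      linear_combination χ₃⁻¹ y⁻¹ * χ₃ (y⁻¹ + 2) * e2 + χ₂ (y + 1) * e3
  have hS : tripleSum χ₁ χ₂ χ₃ =
      χ₃ 2 * ∑ y, χ₂ (y + 1) * χ₃ (y + 2⁻¹) * (1 : MulChar F ℂ) (y + 0) := by
    rw [tripleSum, ← Fintype.sum_bijective _ (inv_involutive (G := F)).bijective (fun y => f y⁻¹) f
      fun _ => rfl, sum_congr rfl fun y _ => key y, mul_sum]
  have h12 : (1 : F) ≠ 2⁻¹ := by
    intro h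
    have : (2 : F) = 1 := by rw [← inv_inv (2 : F), ← h, inv_one]
    exact one_ne_zero (α := F) (by linear_combination this)
  rw [hS, norm_mul, MulChar.norm_apply_of_ne_zero _ hF, one_mul]
  refine (norm_sum_mul_one_add_le _ (fun x => ?_) 0).trans ?_
  · rw [norm_mul]
    exact mul_le_one₀ (MulChar.norm_apply_le_one _ _) (norm_nonneg _) (MulChar.norm_apply_le_one _ _)
  · linarith [norm_sum_add_mul_add_le χ₂ χ₃ (fun h => h₂ h.1) h12 hrq]

/-- A bound for the complete character sums attached to three consecutive field elements,
saving a fourth root of the cardinality of the field. -/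
theorem norm_tripleSum_le (χ₁ χ₂ χ₃ : MulChar F ℂ) (h : ¬(χ₁ = 1 ∧ χ₂ = 1 ∧ χ₃ = 1))
    (hF : (2 : F) ≠ 0) {r : ℝ} (hr : 10 ≤ r) (hrq : r ^ 4 = Fintype.card F) :
    ‖tripleSum χ₁ χ₂ χ₃‖ ≤ 3 * r ^ 3 := by
  have hr2 : r ^ 2 + 2 ≤ 3 * r ^ 3 := by nlinarith [sq_nonneg r]
  have n1 := fun (ψ : MulChar F ℂ) v => MulChar.norm_apply_le_one ψ v
  have n2 : ∀ (χ ψ : MulChar F ℂ) x y, ‖χ x * ψ y‖ ≤ 1 := fun χ ψ x y => by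
    rw [norm_mul]
    exact mul_le_one₀ (n1 _ _) (norm_nonneg _) (n1 _ _)
  have pair : ∀ (χ ψ : MulChar F ℂ) (a b c : F), ¬(χ = 1 ∧ ψ = 1) → a ≠ b →
      (∀ x, χ₁ x * χ₂ (x + 1) * χ₃ (x + 2) =
        χ (x + a) * ψ (x + b) * (1 : MulChar F ℂ) (x + c)) →
      ‖tripleSum χ₁ χ₂ χ₃‖ ≤ 3 * r ^ 3 := fun χ ψ a b c hχ hab he => by
    rw [tripleSum, sum_congr rfl fun x _ => he x]
    refine (norm_sum_mul_one_add_le _ (fun x => n2 _ _ _ _) c).trans ?_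
    linarith [norm_sum_add_mul_add_le χ ψ hχ hab hrq]
  have h12 : (1 : F) ≠ 2 := fun h => one_ne_zero (α := F) (by linear_combination -h)
  by_cases h₃ : χ₃ = 1
  · subst h₃
    exact pair χ₁ χ₂ 0 1 2 (fun h' => h ⟨h'.1, h'.2, rfl⟩) zero_ne_one fun x => by rw [add_zero]
  by_cases h₂ : χ₂ = 1
  · subst h₂
    exact pair χ₁ χ₃ 0 2 1 (fun h' => h₃ h'.2) hF.symm fun x => by rw [add_zero]; ring
  by_cases h₁ : χ₁ = 1
  · subst h₁
    exact pair χ₂ χ₃ 1 2 0 (fun h' => h₃ h'.2) h12 fun x => by rw [add_zero]; ring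
  by_cases hp : χ₁ * χ₂ * χ₃ = 1
  · exact (norm_tripleSum_le_of_mul_eq_one h₂ hp hF hrq).trans hr2
  · exact norm_tripleSum_le_of_mul_ne_one h₁ h₂ h₃ hp hr hrq

end ShiftedProducts

section CharacterSieve

variable {F : Type*} [Field F] [Fintype F]

theorem tripleSum_one (hF : (2 : F) ≠ 0) :
    tripleSum (1 : MulChar F ℂ) 1 1 = ((Fintype.card F : ℝ) - 3 : ℝ) := by
  classical
  have h : ∀ x : F, (1 : MulChar F ℂ) x * (1 : MulChar F ℂ) (x + 1) * (1 : MulChar F ℂ) (x + 2) =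
      1 - if x ∈ ({0, -1, -2} : Finset F) then 1 else 0 := by
    intro x
    have h1 : ∀ y : F, (1 : MulChar F ℂ) y = if y = 0 then 0 else 1 := fun y => by
      split_ifs with hy
      · rw [hy, MulChar.map_zero]
      · exact MulChar.one_apply (isUnit_iff_ne_zero.2 hy)
    simp only [h1, mem_insert, mem_singleton, ← add_eq_zero_iff_eq_neg]
    by_cases a : x = 0 <;> by_cases b : x + 1 = 0 <;> by_cases c : x + 2 = 0 <;> simp [a, b, c]
  have hcard : #({0, -1, -2} : Finset F) = 3 := by
    refine card_eq_three.2 ⟨0, -1, -2, ?_, ?_, ?_, rfl⟩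
    · simp
    · simpa using hF
    · rw [Ne, neg_inj]
      exact fun h => one_ne_zero (α := F) (by linear_combination -h)
  rw [tripleSum, sum_congr rfl fun x _ => h x, sum_sub_distrib, sum_ite_mem, univ_inter, sum_const,
    sum_const, hcard, card_univ]
  simp

variable [Fintype (MulChar F ℂ)]

/-- `A` is a linear combination of characters of order dividing `N`, in which the trivial
character has coefficient `m` and the absolute values of the coefficients add up to at most `L`. -/
def HasCharExpansion (A : F → ℝ) (m L : ℝ) (N : ℕ) : Prop :=
  ∃ c : MulChar F ℂ → ℂ, (∀ x, (A x : ℂ) = ∑ χ, c χ * χ x) ∧ c 1 = m ∧ ∑ χ, ‖c χ‖ ≤ L ∧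
    ∀ χ, c χ ≠ 0 → χ ^ N = 1

namespace HasCharExpansion

variable {A A₁ A₂ A₃ : F → ℝ} {m m₁ m₂ m₃ L L₁ L₂ L₃ : ℝ} {N N₁ N₂ N₃ : ℕ}

omit [Fintype F] in
theorem mul (h₁ : HasCharExpansion A₁ m₁ L₁ N₁) (h₂ : HasCharExpansion A₂ m₂ L₂ N₂)
    (hN : N₁.Coprime N₂) :
    HasCharExpansion (fun x => A₁ x * A₂ x) (m₁ * m₂) (L₁ * L₂) (N₁ * N₂) := by
  obtain ⟨c, hc, hc1, hcL, hcN⟩ := h₁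
  obtain ⟨d, hd, hd1, hdL, hdN⟩ := h₂
  have shift : ∀ (ψ : MulChar F ℂ) {M : Type} [AddCommMonoid M] (f : MulChar F ℂ → M),
      ∑ χ, f χ = ∑ χ, f (ψ * χ) := fun ψ M _ f => (Equiv.sum_comp (Equiv.mulLeft ψ) f).symm
  refine ⟨fun χ => ∑ ψ, c ψ * d (ψ⁻¹ * χ), fun x => ?_, ?_, ?_, fun χ hχ => ?_⟩
  · push_cast
    simp only [sum_mul]
    rw [hc, sum_mul, sum_comm]
    refine sum_congr rfl fun ψ _ => ?_
    rw [shift ψ, hd, mul_sum]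
    refine sum_congr rfl fun χ _ => ?_
    rw [inv_mul_cancel_left, MulChar.mul_apply]
    ring
  · change ∑ ψ, c ψ * d (ψ⁻¹ * 1) = _
    rw [sum_eq_single 1, inv_one, one_mul, hc1, hd1, Complex.ofReal_mul]
    · intro ψ _ hψ
      by_contra hne
      obtain ⟨h1, h2⟩ := mul_ne_zero_iff.1 hne
      have h1 := hcN _ h1
      have h2 := hdN _ h2
      rw [mul_one, inv_pow, inv_eq_one] at h2
      have := Nat.dvd_gcd (orderOf_dvd_of_pow_eq_one h1) (orderOf_dvd_of_pow_eq_one h2)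
      rw [hN.gcd_eq_one, Nat.dvd_one, orderOf_eq_one_iff] at this
      exact hψ this
    · simp
  · calc ∑ χ, ‖∑ ψ, c ψ * d (ψ⁻¹ * χ)‖ ≤ ∑ χ, ∑ ψ, ‖c ψ‖ * ‖d (ψ⁻¹ * χ)‖ :=
          sum_le_sum fun χ _ => norm_sum_le_of_le _ fun ψ _ => (norm_mul _ _).le
      _ = ∑ ψ, ∑ χ, ‖c ψ‖ * ‖d χ‖ := by
          rw [sum_comm]
          refine sum_congr rfl fun ψ _ => ?_
          rw [shift ψ]
          simp only [inv_mul_cancel_left]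
      _ = (∑ ψ, ‖c ψ‖) * ∑ χ, ‖d χ‖ := by rw [sum_mul_sum]
      _ ≤ L₁ * L₂ := mul_le_mul hcL hdL (sum_nonneg fun _ _ => norm_nonneg _)
          ((sum_nonneg fun _ _ => norm_nonneg _).trans hcL)
  · obtain ⟨ψ, -, hψ⟩ := exists_ne_zero_of_sum_ne_zero hχ
    obtain ⟨h1, h2⟩ := mul_ne_zero_iff.1 hψ
    have h1 := hcN _ h1
    have h2 := hdN _ h2
    rw [← mul_inv_cancel_left ψ χ, mul_pow ψ, pow_mul, h1, one_pow, one_mul, mul_comm N₁, pow_mul,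
      h2, one_pow]

theorem of_sum_pow {χ : MulChar F ℂ} (a : ℕ → ℝ) (hχ : 0 < orderOf χ)
    (hA : ∀ x, (A x : ℂ) = ∑ j ∈ range (orderOf χ), (a j : ℂ) * (χ ^ j) x) :
    HasCharExpansion A (a 0) (∑ j ∈ range (orderOf χ), |a j|) (orderOf χ) := by
  classical
  refine ⟨fun ψ => ∑ j ∈ range (orderOf χ), if χ ^ j = ψ then (a j : ℂ) else 0, fun x => ?_, ?_, ?_,
    fun ψ hψ => ?_⟩
  · rw [hA]
    simp only [sum_mul]
    rw [sum_comm]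
    refine sum_congr rfl fun j _ => ?_
    simp [ite_mul]
  · change (∑ j ∈ range (orderOf χ), if χ ^ j = 1 then (a j : ℂ) else 0) = _
    rw [sum_eq_single_of_mem 0 (mem_range.2 hχ), if_pos (pow_zero _)]
    exact fun j hj hj0 => if_neg (pow_ne_one_of_lt_orderOf hj0 (mem_range.1 hj))
  · calc _ ≤ ∑ ψ, ∑ j ∈ range (orderOf χ), if χ ^ j = ψ then |a j| else 0 :=
          sum_le_sum fun ψ _ => norm_sum_le_of_le _ fun j _ => by split_ifs <;> simp
      _ = _ := by rw [sum_comm]; simp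
  · obtain ⟨j, -, hj⟩ := exists_ne_zero_of_sum_ne_zero hψ
    rw [← of_not_not fun h => hj (if_neg h), ← pow_mul, mul_comm, pow_mul, pow_orderOf_eq_one,
      one_pow]

theorem abs_sum_mul_mul_sub_le (h₁ : HasCharExpansion A₁ m₁ L₁ N₁)
    (h₂ : HasCharExpansion A₂ m₂ L₂ N₂) (h₃ : HasCharExpansion A₃ m₃ L₃ N₃) (hF : (2 : F) ≠ 0)
    {r : ℝ} (hr : 10 ≤ r) (hrq : r ^ 4 = Fintype.card F) :
    |∑ x, A₁ x * A₂ (x + 1) * A₃ (x + 2) - m₁ * m₂ * m₃ * (Fintype.card F - 3)| ≤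
      L₁ * L₂ * L₃ * (3 * r ^ 3) := by
  classical
  obtain ⟨c, hc, hc1, hcL, -⟩ := h₁
  obtain ⟨d, hd, hd1, hdL, -⟩ := h₂
  obtain ⟨e, he, he1, heL, -⟩ := h₃
  set main : MulChar F ℂ × MulChar F ℂ × MulChar F ℂ → ℂ := fun t =>
    if t = (1, 1, 1) then (((Fintype.card F : ℝ) - 3 : ℝ) : ℂ) else 0 with hmain
  have expand : ∑ x, (A₁ x : ℂ) * A₂ (x + 1) * A₃ (x + 2) =
      ∑ t : MulChar F ℂ × MulChar F ℂ × MulChar F ℂ, c t.1 * d t.2.1 * e t.2.2 * tripleSum t.1 t.2.1 t.2.2 := by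
    simp only [tripleSum, mul_sum, Fintype.sum_prod_type]
    rw [sum_congr rfl fun a _ => (sum_congr rfl fun b _ => sum_comm).trans sum_comm, sum_comm]
    refine sum_congr rfl fun x _ => ?_
    rw [hc, hd, he, sum_mul_sum, sum_mul]
    refine sum_congr rfl fun a _ => ?_
    rw [sum_mul]
    refine sum_congr rfl fun b _ => ?_
    rw [mul_sum]
    exact sum_congr rfl fun g _ => by ring
  have hsum : ∑ t : MulChar F ℂ × MulChar F ℂ × MulChar F ℂ, c t.1 * d t.2.1 * e t.2.2 * main t =
      ((m₁ * m₂ * m₃ * (Fintype.card F - 3) : ℝ) : ℂ) := by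
    simp only [hmain, mul_ite, mul_zero]
    rw [sum_ite_eq' univ, if_pos (mem_univ _), hc1, hd1, he1]
    push_cast
    ring
  have bound : ∀ t : MulChar F ℂ × MulChar F ℂ × MulChar F ℂ, ‖tripleSum t.1 t.2.1 t.2.2 - main t‖ ≤ 3 * r ^ 3 := by
    rintro ⟨χ₁, χ₂, χ₃⟩
    by_cases ht : (χ₁, χ₂, χ₃) = ((1, 1, 1) : MulChar F ℂ × MulChar F ℂ × MulChar F ℂ)
    · simp only [hmain, if_pos ht]
      obtain ⟨rfl, rfl, rfl⟩ := by simpa [Prod.mk.injEq] using ht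
      rw [tripleSum_one hF, sub_self, norm_zero]
      positivity
    · simp only [hmain, if_neg ht, sub_zero]
      exact norm_tripleSum_le _ _ _ (fun h' => ht (by rw [h'.1, h'.2.1, h'.2.2])) hF hr hrq
  have heq : ((∑ x, A₁ x * A₂ (x + 1) * A₃ (x + 2) - m₁ * m₂ * m₃ * (Fintype.card F - 3) : ℝ) : ℂ) =
      ∑ t : MulChar F ℂ × MulChar F ℂ × MulChar F ℂ, c t.1 * d t.2.1 * e t.2.2 * (tripleSum t.1 t.2.1 t.2.2 - main t) := by
    simp only [mul_sub, sum_sub_distrib]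
    rw [Complex.ofReal_sub, ← mul_sub, ← hsum, ← expand]
    push_cast
    rfl
  rw [← Real.norm_eq_abs, ← Complex.norm_real, heq]
  calc _ ≤ ∑ t : MulChar F ℂ × MulChar F ℂ × MulChar F ℂ, ‖c t.1‖ * ‖d t.2.1‖ * ‖e t.2.2‖ * (3 * r ^ 3) :=
        norm_sum_le_of_le _ fun t _ => by
          rw [norm_mul, norm_mul, norm_mul]
          gcongr
          exact bound t
    _ = (∑ χ, ‖c χ‖) * (∑ χ, ‖d χ‖) * (∑ χ, ‖e χ‖) * (3 * r ^ 3) := by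
        rw [← sum_mul, Fintype.sum_prod_type]
        simp only [Fintype.sum_prod_type, ← mul_sum, ← sum_mul]
    _ ≤ _ := by
        have hc0 : 0 ≤ ∑ χ, ‖c χ‖ := sum_nonneg fun _ _ => norm_nonneg _
        have hd0 : 0 ≤ ∑ χ, ‖d χ‖ := sum_nonneg fun _ _ => norm_nonneg _
        have he0 : 0 ≤ ∑ χ, ‖e χ‖ := sum_nonneg fun _ _ => norm_nonneg _
        have := hc0.trans hcL
        have := hd0.trans hdL
        gcongr

end HasCharExpansion

end CharacterSieve

section PrimitiveSieve

variable {F : Type*} [Field F]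

theorem MulChar.sum_range_orderOf_pow_apply (χ : MulChar F ℂ) (x : F) :
    ∑ j ∈ range (orderOf χ), (χ ^ j) x = if χ x = 1 then (orderOf χ : ℂ) else 0 := by
  rcases eq_or_ne x 0 with rfl | hx
  · simp
  · have h : ∀ j, (χ ^ j) x = χ x ^ j := fun j => by
      rw [← Units.val_mk0 hx, MulChar.pow_apply_coe]
    rw [sum_congr rfl fun j _ => h j]
    split_ifs with h1
    · simp [h1]
    · have := geom_sum_mul (χ x) (orderOf χ)
      rw [← h, pow_orderOf_eq_one, MulChar.one_apply (isUnit_iff_ne_zero.2 hx), sub_self] at this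
      exact (mul_eq_zero.1 this).resolve_right (sub_ne_zero.2 h1)

variable [Fintype F] [Fintype (MulChar F ℂ)]

open Classical in

theorem hasCharExpansion_apply_eq_one {χ : MulChar F ℂ} (hχ : 0 < orderOf χ) :
    HasCharExpansion (fun x => if χ x = 1 then 1 else 0) (1 / orderOf χ) 1 (orderOf χ) := by
  have hne : (orderOf χ : ℝ) ≠ 0 := by positivity
  have hne' : (orderOf χ : ℂ) ≠ 0 := by exact_mod_cast hχ.ne'
  have h := HasCharExpansion.of_sum_pow (A := fun x => if χ x = 1 then 1 else 0)
    (fun _ => 1 / (orderOf χ : ℝ)) hχ fun x => by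
      rw [← mul_sum, MulChar.sum_range_orderOf_pow_apply]
      split_ifs <;> simp [hne']
  rwa [sum_const, card_range, nsmul_eq_mul, abs_of_nonneg (by positivity),
    mul_one_div_cancel hne] at h

open Classical in
theorem hasCharExpansion_apply_ne_one {χ : MulChar F ℂ} (hχ : 0 < orderOf χ) :
    HasCharExpansion (fun x => if x ≠ 0 ∧ χ x ≠ 1 then 1 else 0) (1 - 1 / orderOf χ)
      (2 * (1 - 1 / orderOf χ)) (orderOf χ) := by
  have hne : (orderOf χ : ℝ) ≠ 0 := by positivity
  have hne' : (orderOf χ : ℂ) ≠ 0 := by exact_mod_cast hχ.ne'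
  have h1 : (1 : ℝ) ≤ orderOf χ := by exact_mod_cast hχ
  have h := HasCharExpansion.of_sum_pow (A := fun x => if x ≠ 0 ∧ χ x ≠ 1 then 1 else 0)
    (fun j => (if j = 0 then 1 else 0) - 1 / (orderOf χ : ℝ)) hχ fun x => by
      push_cast
      simp only [sub_mul, sum_sub_distrib, apply_ite Complex.ofReal, Complex.ofReal_one,
        Complex.ofReal_zero, ite_mul, zero_mul, one_mul]
      rw [← mul_sum, MulChar.sum_range_orderOf_pow_apply, sum_ite_eq' , if_pos (mem_range.2 hχ)]
      rcases eq_or_ne x 0 with rfl | hx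
      · simp [MulChar.map_zero]
      · rw [pow_zero, MulChar.one_apply (isUnit_iff_ne_zero.2 hx)]
        by_cases h : χ x = 1 <;> simp [h, hx, hne']
  convert h using 1
  · simp
  · obtain ⟨n, hn⟩ := Nat.exists_eq_succ_of_ne_zero hχ.ne'
    rw [hn, sum_range_succ', sum_congr rfl fun j _ => by
      rw [if_neg j.succ_ne_zero, zero_sub, abs_neg, abs_of_nonneg (by positivity)], sum_const,
      card_range, nsmul_eq_mul, if_pos rfl, abs_of_nonneg]
    · push_cast
      field_simp
      ring
    · rw [← hn, sub_nonneg, div_le_one (by positivity)]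
      exact h1

open Classical in
theorem hasCharExpansion_forall_apply_ne_one (χ : ℕ → MulChar F ℂ) (K : Finset ℕ)
    (hK : ∀ p ∈ K, p.Prime ∧ orderOf (χ p) = p) :
    HasCharExpansion (fun x => if x ≠ 0 ∧ ∀ p ∈ K, χ p x ≠ 1 then 1 else 0)
      (∏ p ∈ K, (1 - 1 / (p : ℝ))) (2 ^ #K * ∏ p ∈ K, (1 - 1 / (p : ℝ))) (∏ p ∈ K, p) := by
  induction K using Finset.induction_on with
  | empty =>
    refine ⟨fun ψ => if ψ = 1 then 1 else 0, fun x => ?_, by simp, ?_, fun ψ hψ => ?_⟩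
    · rw [sum_congr rfl fun ψ _ => ite_mul _ _ _ _]
      simp only [one_mul, zero_mul, sum_ite_eq', mem_univ, if_true]
      rcases eq_or_ne x 0 with rfl | hx
      · simp [MulChar.map_zero]
      · simp [hx, MulChar.one_apply (isUnit_iff_ne_zero.2 hx)]
    · rw [sum_congr rfl fun ψ _ => apply_ite norm _ _ _]
      simp
    · simpa using hψ
  | insert p K hp ih =>
    obtain ⟨hprime, hord⟩ := hK p (mem_insert_self _ _)
    have hK' : ∀ p ∈ K, p.Prime ∧ orderOf (χ p) = p := fun l hl => hK l (mem_insert_of_mem hl)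
    have h1 := hasCharExpansion_apply_ne_one (χ := χ p) (by rw [hord]; exact hprime.pos)
    rw [hord] at h1
    have hco : p.Coprime (∏ l ∈ K, l) := Nat.Coprime.prod_right fun l hl =>
      (Nat.coprime_primes hprime (hK' l hl).1).2 fun h => hp (h ▸ hl)
    have h2 := h1.mul (ih hK') hco
    rw [prod_insert hp, prod_insert hp, card_insert_of_notMem hp]
    convert h2 using 1
    · funext x
      simp only [forall_mem_insert]
      by_cases a : x = 0 <;> by_cases b : χ p x = 1 <;>
        by_cases c : ∀ l ∈ K, χ l x ≠ 1 <;> simp [a, b, c]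
    · ring

/-- The prime sieve: the primes in `K` are treated exactly, those in `T` by a union bound. -/
theorem exists_forall_apply_ne_one (χ : ℕ → MulChar F ℂ) {K T : Finset ℕ} (hKT : Disjoint K T)
    (hS : ∀ p ∈ K ∪ T, p.Prime ∧ orderOf (χ p) = p) (hF : (2 : F) ≠ 0)
    {r : ℝ} (hr : 10 ≤ r) (hrq : r ^ 4 = Fintype.card F)
    (h : 8 ^ #K * (3 * #T + 1) * (3 * r ^ 3) <
      ((Fintype.card F : ℝ) - 3) * (1 - 3 * ∑ p ∈ T, 1 / (p : ℝ))) :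
    ∃ x : F, ∀ i < 3, x + (i : ℕ) ≠ 0 ∧ ∀ p ∈ K ∪ T, χ p (x + (i : ℕ)) ≠ 1 := by
  classical
  by_contra! hcon
  set A : F → ℝ := fun x => if x ≠ 0 ∧ ∀ p ∈ K, χ p x ≠ 1 then 1 else 0 with hA
  set b : ℕ → F → ℝ := fun p x => if χ p x = 1 then 1 else 0 with hb
  set θ : ℝ := ∏ p ∈ K, (1 - 1 / (p : ℝ)) with hθ
  set q : ℝ := (Fintype.card F : ℝ) with hq
  set E : ℝ := 3 * r ^ 3 with hE
  have hK : ∀ p ∈ K, p.Prime ∧ orderOf (χ p) = p := fun p hp => hS p (mem_union_left _ hp)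
  have hT : ∀ p ∈ T, p.Prime ∧ orderOf (χ p) = p := fun p hp => hS p (mem_union_right _ hp)
  have hθ0 : 0 < θ := prod_pos fun p hp => by
    have : (1 : ℝ) < p := by exact_mod_cast (hK p hp).1.one_lt
    rw [sub_pos, div_lt_one (by linarith)]
    exact this
  have eA : HasCharExpansion A θ (2 ^ #K * θ) (∏ p ∈ K, p) :=
    hasCharExpansion_forall_apply_ne_one χ K hK
  have eAb : ∀ p ∈ T, HasCharExpansion (fun x => A x * b p x) (θ * (1 / p)) (2 ^ #K * θ * 1)
      ((∏ p ∈ K, p) * p) := fun p hp => by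
    have h1 := hasCharExpansion_apply_eq_one (χ := χ p) (by rw [(hT p hp).2]; exact (hT p hp).1.pos)
    rw [(hT p hp).2] at h1
    refine eA.mul h1 (Nat.Coprime.prod_left fun l hl => ?_)
    exact (Nat.coprime_primes (hK l hl).1 (hT p hp).1).2 fun h =>
      disjoint_left.1 hKT hl (h ▸ hp)
  have hA0 : ∀ x, 0 ≤ A x := fun x => by simp only [hA]; split_ifs <;> norm_num
  have hb0 : ∀ p x, 0 ≤ b p x := fun p x => by simp only [hb]; split_ifs <;> norm_num
  set W : F → ℝ := fun x => A x * A (x + 1) * A (x + 2) with hW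
  have hW0 : ∀ x, 0 ≤ W x := fun x => mul_nonneg (mul_nonneg (hA0 _) (hA0 _)) (hA0 _)
  have hpt : ∀ x, W x ≤ ∑ p ∈ T, W x * (b p x + b p (x + 1) + b p (x + 2)) := by
    intro x
    have hnn : ∀ p ∈ T, 0 ≤ b p x + b p (x + 1) + b p (x + 2) := fun p _ =>
      add_nonneg (add_nonneg (hb0 _ _) (hb0 _ _)) (hb0 _ _)
    rw [← mul_sum]
    by_cases hx : W x = 0
    · rw [hx, zero_mul]
    refine le_mul_of_one_le_right (hW0 x) ?_
    have hne : ∀ y, A y ≠ 0 → y ≠ 0 ∧ ∀ p ∈ K, χ p y ≠ 1 := fun y hy =>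
      of_not_not fun h => hy (if_neg h)
    obtain ⟨h01, h2⟩ := mul_ne_zero_iff.1 hx
    obtain ⟨h0, h1⟩ := mul_ne_zero_iff.1 h01
    obtain ⟨i, hi, hxi⟩ := hcon x
    have key : ∃ p ∈ T, χ p (x + (i : ℕ)) = 1 := by
      have hAi : A (x + (i : ℕ)) ≠ 0 := by
        interval_cases i
        · simpa using h0
        · simpa using h1
        · simpa using h2
      obtain ⟨p, hp, hp1⟩ := hxi (hne _ hAi).1
      rcases mem_union.1 hp with hp | hp
      · exact absurd hp1 ((hne _ hAi).2 p hp)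
      · exact ⟨p, hp, hp1⟩
    obtain ⟨p, hp, hp1⟩ := key
    refine le_trans ?_ (single_le_sum hnn hp)
    have hbp : b p (x + (i : ℕ)) = 1 := if_pos hp1
    have hb1 := hb0 p x
    have hb2 := hb0 p (x + 1)
    have hb3 := hb0 p (x + 2)
    interval_cases i <;> simp only [Nat.cast_zero, Nat.cast_one, Nat.cast_ofNat, add_zero] at hbp <;>
      linarith
  have s0 := abs_le.1 (eA.abs_sum_mul_mul_sub_le eA eA hF hr hrq)
  have hT1 : ∀ p ∈ T, ∑ x, W x * (b p x + b p (x + 1) + b p (x + 2)) ≤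
      3 * (θ ^ 3 * (1 / p) * (q - 3)) + 3 * ((2 ^ #K * θ) ^ 3 * E) := by
    intro p hp
    have s1 := abs_le.1 ((eAb p hp).abs_sum_mul_mul_sub_le eA eA hF hr hrq)
    have s2 := abs_le.1 (eA.abs_sum_mul_mul_sub_le (eAb p hp) eA hF hr hrq)
    have s3 := abs_le.1 (eA.abs_sum_mul_mul_sub_le eA (eAb p hp) hF hr hrq)
    have e : ∑ x, W x * (b p x + b p (x + 1) + b p (x + 2)) =
        ∑ x, A x * b p x * A (x + 1) * A (x + 2) + ∑ x, A x * (A (x + 1) * b p (x + 1)) * A (x + 2) +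
        ∑ x, A x * A (x + 1) * (A (x + 2) * b p (x + 2)) := by
      rw [← sum_add_distrib, ← sum_add_distrib]
      exact sum_congr rfl fun x _ => by simp only [hW]; ring
    rw [e]
    linarith [s1.2, s2.2, s3.2]
  have hle : ∑ x, W x ≤ ∑ p ∈ T, (3 * (θ ^ 3 * (1 / p) * (q - 3)) + 3 * ((2 ^ #K * θ) ^ 3 * E)) := by
    refine (sum_le_sum fun x _ => hpt x).trans ?_
    rw [sum_comm]
    exact sum_le_sum hT1
  have hr : ∑ p ∈ T, (3 * (θ ^ 3 * (1 / (p : ℝ)) * (q - 3)) + 3 * ((2 ^ #K * θ) ^ 3 * E)) =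
      θ ^ 3 * (3 * (q - 3) * ∑ p ∈ T, 1 / (p : ℝ) + 3 * #T * 8 ^ #K * E) := by
    rw [sum_add_distrib, sum_const, nsmul_eq_mul, mul_pow, ← pow_mul, mul_comm #K, pow_mul, mul_add,
      mul_sum, mul_sum]
    congr 1
    · exact sum_congr rfl fun p _ => by ring
    · norm_num
      ring
  rw [hr] at hle
  have h8 : (2 ^ #K * θ) * (2 ^ #K * θ) * (2 ^ #K * θ) = θ ^ 3 * 8 ^ #K := by
    rw [show (8 : ℝ) = 2 * 2 * 2 by norm_num, mul_pow, mul_pow]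
    ring
  rw [h8] at s0
  have hθ3 : 0 < θ ^ 3 := by positivity
  have := mul_lt_mul_of_pos_left h hθ3
  have hfin : θ ^ 3 * (8 ^ #K * (3 * #T + 1) * E) <
      θ ^ 3 * (3 * (q - 3) * ∑ p ∈ T, 1 / (p : ℝ) + 3 * #T * 8 ^ #K * E) + θ ^ 3 * 8 ^ #K * E -
      θ ^ 3 * (3 * (q - 3) * ∑ p ∈ T, 1 / (p : ℝ)) := by linarith [s0.1]
  linarith

omit [Fintype (MulChar F ℂ)] in
theorem isPrimitiveElem_of_forall_apply_ne_one (χ : ℕ → MulChar F ℂ)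
    (hχ : ∀ p ∈ (Fintype.card F - 1).primeFactors, orderOf (χ p) = p) {x : F} (hx : x ≠ 0)
    (h : ∀ p ∈ (Fintype.card F - 1).primeFactors, χ p x ≠ 1) : IsPrimitiveElem x := by
  classical
  set n := Fintype.card F - 1 with hn
  have hn0 : 0 < n := Nat.sub_pos_of_lt Fintype.one_lt_card
  have hcard : Fintype.card Fˣ = n := Fintype.card_units F
  have hcard' : Nat.card Fˣ = n := by rw [Nat.card_eq_fintype_card, hcard]
  set u := Units.mk0 x hx with hu
  have hord : orderOf u = n := by
    refine orderOf_eq_of_pow_and_pow_div_prime hn0 (by rw [← hcard, pow_card_eq_one]) ?_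
    intro p hp hpn hup
    obtain ⟨g, hg⟩ := IsCyclic.exists_generator (α := Fˣ)
    have hgn : orderOf g = n := by rw [orderOf_eq_card_of_forall_mem_zpowers hg, hcard']
    obtain ⟨m, hm⟩ := mem_powers_iff_mem_zpowers.2 (hg u)
    have hm : g ^ m = u := hm
    have hdvd : n ∣ m * (n / p) := by
      rw [← hgn, orderOf_dvd_iff_pow_eq_one, hgn, pow_mul, hm, hup]
    obtain ⟨d, hd⟩ := hpn
    have hd0 : 0 < d := Nat.pos_of_ne_zero fun h => by simp [hd, h] at hn0
    rw [hd, Nat.mul_div_cancel_left _ hp.pos] at hdvd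
    obtain ⟨k, rfl⟩ := Nat.dvd_of_mul_dvd_mul_right hd0 hdvd
    have hmem : p ∈ n.primeFactors := Nat.mem_primeFactors.2 ⟨hp, ⟨d, hd⟩, hn0.ne'⟩
    refine h p hmem ?_
    have hxu : x = ((g ^ k : Fˣ) : F) ^ p := by
      rw [← Units.val_mk0 hx, ← hu, ← hm, mul_comm, pow_mul, Units.val_pow_eq_pow_val (g ^ k)]
    have h1 := MulChar.pow_apply_coe (χ p) p (g ^ k)
    rw [hxu, map_pow, ← h1]
    rw [orderOf_dvd_iff_pow_eq_one.1 (hχ p hmem).dvd, MulChar.one_apply_coe]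
  intro y hy
  have htop : Subgroup.zpowers u = ⊤ :=
    (Subgroup.card_eq_iff_eq_top _).1 (by rw [Nat.card_zpowers, hord, hcard'])
  have hmem : Units.mk0 y hy ∈ Submonoid.powers u := by
    rw [mem_powers_iff_mem_zpowers, htop]
    exact Subgroup.mem_top _
  obtain ⟨k, hk⟩ := hmem
  exact ⟨k, by simpa [hu] using congrArg Units.val hk⟩

end PrimitiveSieve

section PrimeBounds

/-- A lower bound for the `i`-th prime number, counting from zero. -/
def nthPrimeLowerBound (i : ℕ) : ℕ := max (i + 2) ((30 * i - 51) / 8)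

theorem nthPrimeLowerBound_pos (i : ℕ) : 0 < nthPrimeLowerBound i := by
  unfold nthPrimeLowerBound
  omega

theorem thirty_mul_count_coprime_le (M : ℕ) :
    30 * Nat.count (Nat.Coprime 30) (M + 1) ≤ 8 * M + 28 := by
  induction M using Nat.strong_induction_on with
  | _ M ih =>
    rcases lt_or_ge M 30 with h | h
    · interval_cases M <;> decide
    · obtain ⟨m, rfl⟩ := Nat.exists_eq_add_of_le h
      have h1 := ih m (by omega)
      have h2 : Nat.count (Nat.Coprime 30) 30 = 8 := by decide
      rw [add_assoc, Nat.count_add, h2]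
      simp only [Nat.coprime_self_add_right]
      change 30 * (8 + Nat.count (Nat.Coprime 30) (m + 1)) ≤ _
      omega

theorem nthPrimeLowerBound_le_of_prime {S : Finset ℕ} {n M : ℕ} (hS : ∀ p ∈ S, p.Prime ∧ p ≤ M)
    (hn : #S = n + 1) : nthPrimeLowerBound n ≤ M := by
  have h1 : n + 2 ≤ M := by
    have : S ⊆ Icc 2 M := fun p hp => mem_Icc.2 ⟨(hS p hp).1.two_le, (hS p hp).2⟩
    have := card_le_card this
    rw [Nat.card_Icc] at this
    omega
  have h2 : #S + 1 ≤ Nat.count (Nat.Coprime 30) (M + 1) + 3 := by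
    have hsub : insert 1 (S \ {2, 3, 5}) ⊆ {k ∈ range (M + 1) | Nat.Coprime 30 k} := by
      intro p hp
      rw [mem_filter, mem_range]
      rcases mem_insert.1 hp with rfl | hp
      · exact ⟨by omega, by decide⟩
      · obtain ⟨hpS, hp⟩ := mem_sdiff.1 hp
        have hpp := (hS p hpS).1
        refine ⟨Nat.lt_succ_of_le (hS p hpS).2, ?_⟩
        rw [Nat.coprime_comm, hpp.coprime_iff_not_dvd]
        intro hd
        have : p ∈ Nat.primeFactors 30 := Nat.mem_primeFactors.2 ⟨hpp, hd, by norm_num⟩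
        have h30 : p ∣ 2 ∨ p ∣ 3 ∨ p ∣ 5 := by
          rw [show 30 = 2 * (3 * 5) by norm_num, hpp.dvd_mul, hpp.dvd_mul] at hd
          exact hd
        rw [Nat.prime_dvd_prime_iff_eq hpp Nat.prime_two,
          Nat.prime_dvd_prime_iff_eq hpp Nat.prime_three,
          Nat.prime_dvd_prime_iff_eq hpp Nat.prime_five] at h30
        simp only [mem_insert, mem_singleton] at hp
        exact hp h30
    have hc := card_le_card hsub
    rw [← Nat.count_eq_card_filter_range, card_insert_of_notMem] at hc
    · have h3 := le_card_sdiff ({2, 3, 5} : Finset ℕ) S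
      have h4 : #({2, 3, 5} : Finset ℕ) = 3 := by decide
      omega
    · exact fun h => Nat.not_prime_one (hS 1 (mem_sdiff.1 h).1).1
  have h3 := thirty_mul_count_coprime_le M
  unfold nthPrimeLowerBound
  omega

theorem prod_nthPrimeLowerBound_le {n : ℕ} {S : Finset ℕ} (hS : ∀ p ∈ S, p.Prime) (hn : #S = n) :
    ∏ i ∈ range n, nthPrimeLowerBound i ≤ ∏ p ∈ S, p := by
  induction n generalizing S with
  | zero => simp [card_eq_zero.1 hn]
  | succ n ih =>
    have hne : S.Nonempty := card_pos.1 (by omega)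
    have hmem := S.max'_mem hne
    rw [prod_range_succ, ← mul_prod_erase S _ hmem, mul_comm]
    refine Nat.mul_le_mul ?_ (ih (fun p hp => hS p (mem_of_mem_erase hp)) ?_)
    · exact nthPrimeLowerBound_le_of_prime (fun p hp => ⟨hS p hp, S.le_max' p hp⟩) hn
    · rw [card_erase_of_mem hmem, hn, Nat.add_sub_cancel]

theorem exists_disjoint_union_sum_inv_le {n k : ℕ} {S : Finset ℕ} (hS : ∀ p ∈ S, p.Prime)
    (hn : #S = n) (hk : k ≤ n) : ∃ K T : Finset ℕ, Disjoint K T ∧ K ∪ T = S ∧ #K = k ∧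
      ∑ p ∈ T, 1 / (p : ℝ) ≤ ∑ i ∈ Ico k n, 1 / (nthPrimeLowerBound i : ℝ) := by
  induction n generalizing S with
  | zero => exact ⟨S, ∅, disjoint_empty_right _, union_empty _, by omega, by simp⟩
  | succ n ih =>
    rcases hk.eq_or_lt with rfl | hk
    · exact ⟨S, ∅, disjoint_empty_right _, union_empty _, hn, by simp⟩
    have hne : S.Nonempty := card_pos.1 (by omega)
    have hmem := S.max'_mem hne
    obtain ⟨K, T, hd, hu, hK, hT⟩ := ih (S := S.erase (S.max' hne))
      (fun p hp => hS p (mem_of_mem_erase hp))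
      (by rw [card_erase_of_mem hmem, hn, Nat.add_sub_cancel]) (by omega)
    have hnot : S.max' hne ∉ K ∪ T := by rw [hu]; exact notMem_erase _ _
    rw [mem_union, not_or] at hnot
    refine ⟨K, insert (S.max' hne) T, ?_, ?_, hK, ?_⟩
    · exact disjoint_insert_right.2 ⟨hnot.1, hd⟩
    · rw [union_insert, hu, insert_erase hmem]
    · rw [sum_insert hnot.2, sum_Ico_succ_top (by omega), add_comm]
      refine add_le_add hT (one_div_le_one_div_of_le ?_ ?_)
      · exact_mod_cast nthPrimeLowerBound_pos n
      · exact_mod_cast nthPrimeLowerBound_le_of_prime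
          (fun p hp => ⟨hS p hp, S.le_max' p hp⟩) hn

theorem sum_Ico_inv_nthPrimeLowerBound_le (j : ℕ) :
    ∑ i ∈ Ico (20 + j) (50 + 2 * j), 1 / (nthPrimeLowerBound i : ℝ) ≤ 17 / 60 := by
  induction j with
  | zero => norm_num [sum_Ico_succ_top, nthPrimeLowerBound]
  | succ j ih =>
    refine le_trans ?_ ih
    have hle : ∀ m, 50 + 2 * j ≤ m →
        1 / (nthPrimeLowerBound m : ℝ) ≤ 1 / (nthPrimeLowerBound (20 + j) : ℝ) / 2 := by
      intro m hm
      have h0 : (0 : ℝ) < nthPrimeLowerBound (20 + j) := by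
        exact_mod_cast nthPrimeLowerBound_pos _
      have h1 : 2 * nthPrimeLowerBound (20 + j) ≤ nthPrimeLowerBound m := by
        unfold nthPrimeLowerBound
        omega
      rw [div_div, mul_comm]
      exact one_div_le_one_div_of_le (by positivity) (by exact_mod_cast h1)
    have h1 := hle (50 + 2 * j) le_rfl
    have h2 := hle (50 + 2 * j + 1) (by omega)
    rw [sum_eq_sum_Ico_succ_bot (show 20 + j < 50 + 2 * j by omega),
      show 50 + 2 * (j + 1) = 50 + 2 * j + 1 + 1 by ring, ← add_assoc,
      sum_Ico_succ_top (by omega), sum_Ico_succ_top (by omega)]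
    linarith

theorem pow_four_le_prod_nthPrimeLowerBound (j : ℕ) :
    (21 * 8 ^ (20 + (j + 1)) * (3 * (30 + (j + 1)) + 1)) ^ 4 ≤
      ∏ i ∈ range (51 + 2 * j), nthPrimeLowerBound i := by
  induction j with
  | zero => norm_num [prod_range_succ, nthPrimeLowerBound]
  | succ j ih =>
    have hstep : 21 * 8 ^ (20 + (j + 1 + 1)) * (3 * (30 + (j + 1 + 1)) + 1) ≤
        9 * (21 * 8 ^ (20 + (j + 1)) * (3 * (30 + (j + 1)) + 1)) := by
      rw [show 20 + (j + 1 + 1) = 20 + (j + 1) + 1 by ring, pow_succ]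
      have : 8 * (3 * (30 + (j + 1 + 1)) + 1) ≤ 9 * (3 * (30 + (j + 1)) + 1) := by omega
      calc _ = 21 * 8 ^ (20 + (j + 1)) * (8 * (3 * (30 + (j + 1 + 1)) + 1)) := by ring
        _ ≤ 21 * 8 ^ (20 + (j + 1)) * (9 * (3 * (30 + (j + 1)) + 1)) := by gcongr
        _ = _ := by ring
    have hlb : ∀ m, 51 ≤ m → 81 ≤ nthPrimeLowerBound m := fun m hm => by
      unfold nthPrimeLowerBound
      omega
    rw [show 51 + 2 * (j + 1) = 51 + 2 * j + 1 + 1 by ring, prod_range_succ, prod_range_succ,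
      mul_assoc (∏ i ∈ range _, _)]
    calc _ ≤ (9 * (21 * 8 ^ (20 + (j + 1)) * (3 * (30 + (j + 1)) + 1))) ^ 4 :=
          Nat.pow_le_pow_left hstep 4
      _ = (21 * 8 ^ (20 + (j + 1)) * (3 * (30 + (j + 1)) + 1)) ^ 4 * (81 * 81) := by ring
      _ ≤ _ := Nat.mul_le_mul ih (Nat.mul_le_mul (hlb _ (by omega)) (hlb _ (by omega)))

/-- The primes dividing `N` can be split into two parts that satisfy the requirements of the
sieve. -/
theorem exists_sieve_split {N : ℕ} (hN : N ≠ 0)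
    (h : 50 ≤ #N.primeFactors ∨ 2 ^ 302 ≤ N + 1) : ∃ K T : Finset ℕ, Disjoint K T ∧
      K ∪ T = N.primeFactors ∧ ∑ p ∈ T, 1 / (p : ℝ) ≤ 17 / 60 ∧
      (21 * 8 ^ #K * (3 * #T + 1)) ^ 4 < N + 1 := by
  set S := N.primeFactors with hS
  have hprime : ∀ p ∈ S, p.Prime := fun p hp => Nat.prime_of_mem_primeFactors hp
  have hmono : ∀ k n j, 20 + j ≤ k ∨ n ≤ k → n ≤ 50 + 2 * j →
      ∑ i ∈ Ico k n, 1 / (nthPrimeLowerBound i : ℝ) ≤ 17 / 60 := by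
    intro k n j hk hn
    refine le_trans (sum_le_sum_of_subset_of_nonneg ?_ fun i _ _ => by positivity)
      (sum_Ico_inv_nthPrimeLowerBound_le j)
    rcases hk with hk | hk
    · exact Ico_subset_Ico hk hn
    · simp [Ico_eq_empty_of_le hk]
  have hcardKT : ∀ {K T : Finset ℕ}, Disjoint K T → K ∪ T = S → #K + #T = #S := fun hd hu => by
    rw [← card_union_of_disjoint hd, hu]
  rcases le_or_gt (#S) 50 with hle | hgt
  · obtain ⟨K, T, hd, hu, hK, hT⟩ := exists_disjoint_union_sum_inv_le hprime rfl
      (min_le_left (#S) 20)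
    have hc := hcardKT hd hu
    refine ⟨K, T, hd, hu, hT.trans (hmono _ _ 0 (by omega) (by omega)), ?_⟩
    have hb : (21 * 8 ^ #K * (3 * #T + 1)) ^ 4 ≤ (21 * 8 ^ 20 * (3 * 30 + 1)) ^ 4 := by
      gcongr <;> omega
    refine hb.trans_lt ?_
    rcases h with h | h
    · have hn : #S = 50 := le_antisymm hle h
      have h1 := prod_nthPrimeLowerBound_le hprime hn
      have h2 := Nat.le_of_dvd (Nat.pos_of_ne_zero hN) (Nat.prod_primeFactors_dvd N)
      have h3 : (21 * 8 ^ 20 * (3 * 30 + 1)) ^ 4 ≤ ∏ i ∈ range 50, nthPrimeLowerBound i := by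
        norm_num [prod_range_succ, nthPrimeLowerBound]
      exact Nat.lt_succ_of_le (h3.trans (h1.trans h2))
    · rw [show 302 = 151 + 151 by norm_num, pow_add] at h
      exact lt_of_lt_of_le (by norm_num) h
  · obtain ⟨j, hj⟩ : ∃ j, #S = 51 + 2 * j ∨ #S = 52 + 2 * j := ⟨(#S - 51) / 2, by omega⟩
    obtain ⟨K, T, hd, hu, hK, hT⟩ := exists_disjoint_union_sum_inv_le hprime rfl
      (show 20 + (j + 1) ≤ #S by omega)
    have hc := hcardKT hd hu
    refine ⟨K, T, hd, hu, hT.trans (hmono _ _ (j + 1) (Or.inl le_rfl) (by omega)), ?_⟩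
    have hb : (21 * 8 ^ #K * (3 * #T + 1)) ^ 4 ≤
        (21 * 8 ^ (20 + (j + 1)) * (3 * (30 + (j + 1)) + 1)) ^ 4 := by
      gcongr <;> omega
    have h1 := prod_nthPrimeLowerBound_le hprime rfl
    have h2 := Nat.le_of_dvd (Nat.pos_of_ne_zero hN) (Nat.prod_primeFactors_dvd N)
    have h3 : ∏ i ∈ range (51 + 2 * j), nthPrimeLowerBound i ≤
        ∏ i ∈ range #S, nthPrimeLowerBound i :=
      prod_le_prod_of_subset_of_one_le' (range_subset_range.2 (by omega))
        fun i _ _ => nthPrimeLowerBound_pos i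
    exact Nat.lt_succ_of_le (hb.trans ((pow_four_le_prod_nthPrimeLowerBound j).trans
      (h3.trans (h1.trans h2))))

end PrimeBounds

section ConsecutivePrimitives

variable {F : Type*} [Field F] [Fintype F]

theorem hasConsecutivePrimitives_three_of_sieve (hF : (2 : F) ≠ 0) {K T : Finset ℕ}
    (hKT : Disjoint K T) (hu : K ∪ T = (Fintype.card F - 1).primeFactors)
    (hsum : ∑ p ∈ T, 1 / (p : ℝ) ≤ 17 / 60)
    (hcard : (21 * 8 ^ #K * (3 * #T + 1)) ^ 4 < Fintype.card F) :
    HasConsecutivePrimitives F 3 := by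
  classical
  have : Fintype (MulChar F ℂ) := Fintype.ofFinite _
  have hex : ∀ p, ∃ χ : MulChar F ℂ, p ∈ (Fintype.card F - 1).primeFactors → orderOf χ = p := by
    intro p
    by_cases hp : p ∈ (Fintype.card F - 1).primeFactors
    · obtain ⟨χ, hχ⟩ := MulChar.exists_mulChar_orderOf F (Nat.dvd_of_mem_primeFactors hp)
        (Complex.isPrimitiveRoot_exp p (Nat.prime_of_mem_primeFactors hp).ne_zero)
      exact ⟨χ, fun _ => hχ⟩
    · exact ⟨1, fun h => absurd h hp⟩
  choose χ hχ using hex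
  set q : ℝ := (Fintype.card F : ℝ) with hq
  set r : ℝ := q ^ (1 / 4 : ℝ) with hr
  have hq0 : 0 ≤ q := Nat.cast_nonneg _
  have hr0 : 0 ≤ r := Real.rpow_nonneg hq0 _
  have hrq : r ^ 4 = q := by
    rw [hr, ← Real.rpow_natCast, ← Real.rpow_mul hq0]
    norm_num
  have hlt : 21 * 8 ^ #K * (3 * #T + 1) < r := by
    refine lt_of_pow_lt_pow_left₀ 4 hr0 ?_
    rw [hrq, hq]
    exact_mod_cast hcard
  have h1 : (1 : ℝ) ≤ 8 ^ #K * (3 * #T + 1) :=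
    one_le_mul_of_one_le_of_one_le (one_le_pow₀ (by norm_num)) (by
      have : (0 : ℝ) ≤ #T := Nat.cast_nonneg _
      linarith)
  have hr10 : 10 ≤ r := by linarith
  have hq10 : (10000 : ℝ) ≤ q := by
    rw [← hrq]
    calc (10000 : ℝ) = 10 ^ 4 := by norm_num
      _ ≤ r ^ 4 := by gcongr
  have hmain : 8 ^ #K * (3 * #T + 1) * (3 * r ^ 3) < (q - 3) * (1 - 3 * ∑ p ∈ T, 1 / (p : ℝ)) := by
    have hr3 : 0 < r ^ 3 := by positivity
    calc 8 ^ #K * (3 * (#T : ℝ) + 1) * (3 * r ^ 3) < r / 21 * (3 * r ^ 3) := by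
          gcongr
          linarith
      _ = q / 7 := by rw [← hrq]; ring
      _ ≤ (q - 3) * (3 / 20) := by linarith
      _ ≤ _ := by
        gcongr
        · linarith
        · linarith
  obtain ⟨x, hx⟩ := exists_forall_apply_ne_one χ hKT (fun p hp =>
    ⟨Nat.prime_of_mem_primeFactors (hu ▸ hp), hχ p (hu ▸ hp)⟩) hF hr10 hrq hmain
  rw [hu] at hx
  refine ⟨x, fun i hi => isPrimitiveElem_of_forall_apply_ne_one χ hχ (hx i hi).1 (hx i hi).2,
    fun i hi j hj hij => ?_⟩
  have hij := add_left_cancel hij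
  have h12 : (1 : F) ≠ 2 := fun h => one_ne_zero (α := F) (by linear_combination -h)
  interval_cases i <;> interval_cases j <;> simp_all

end ConsecutivePrimitives

/-- For `q` an odd prime power with `ω(q-1) ≥ 50` or `q ≥ 2^{302}`, the field `𝔽_q`
contains three consecutive primitive elements. -/
theorem three_consecutive_primitives_of_omega_or_size (q : ℕ) (hq : IsPrimePow q)
    (hodd : Odd q) (h : 50 ≤ (q - 1).primeFactors.card ∨ 2 ^ 302 ≤ q)
    (F : Type*) [Field F] [Fintype F] (hF : Fintype.card F = q) :
    HasConsecutivePrimitives F 3 := by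
  have hq1 : 1 < q := hq.one_lt
  have h2 : (2 : F) ≠ 0 := by
    refine Ring.two_ne_zero fun hchar => ?_
    have := FiniteField.even_card_of_char_two hchar
    rw [hF, ← Nat.even_iff] at this
    exact Nat.not_even_iff_odd.2 hodd this
  subst hF
  obtain ⟨K, T, hKT, hu, hsum, hcard⟩ := exists_sieve_split (N := Fintype.card F - 1) (by omega)
    (by rwa [Nat.sub_add_cancel hq1.le])
  rw [Nat.sub_add_cancel hq1.le] at hcard
  exact hasConsecutivePrimitives_three_of_sieve h2 hKT hu hsum hcard
end

section
/- Let q be a prime power of characteristic p, let n be an integer with 3 ≤ n ≤ p, and let e be a divisor of q−1. Then N_n(e) ≥ θ(e)^n · (q − (n−1) W(e)^n √q). -/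
open Finset

/-- A nonzero element `g` is `e`-free if `g = h ^ d` with `d ∣ e` forces `d = 1`. -/
def EFree {F : Type*} [Field F] (e : ℕ) (g : F) : Prop :=
  g ≠ 0 ∧ ∀ (h : F) (d : ℕ), d ∣ e → g = h ^ d → d = 1

/-- `Ncount F n e` is the number `N(e₁, …, eₙ)` of `g ∈ F` such that `g + k - 1`
is `eₖ`-free for each `k = 1, …, n`. -/
noncomputable def Ncount (F : Type*) [Field F] (n : ℕ) (e : Fin n → ℕ) : ℕ :=
  Nat.card {g : F // ∀ k : Fin n, EFree (e k) (g + ((k : ℕ) : F))}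

/-- `Nn F n e = N(e, …, e)` counts `g ∈ F` with `g, g+1, …, g+n-1` all `e`-free. -/
noncomputable def Nn (F : Type*) [Field F] (n e : ℕ) : ℕ :=
  Ncount F n (fun _ => e)

/-- `θ(m) = ∏_{ℓ ∣ m, ℓ prime} (1 - 1/ℓ)`. -/
noncomputable def theta (m : ℕ) : ℝ :=
  ∏ l ∈ m.primeFactors, (1 - 1 / (l : ℝ))

/-- `W(m) = 2^{ω(m)}`, the number of squarefree divisors of `m`. -/
def W (m : ℕ) : ℕ := 2 ^ m.primeFactors.card

theorem exists_large_pow_re_ge_half {m : ℕ} (u : Fin m → Circle) (T : ℕ) :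
    ∃ t, T ≤ t ∧ ∀ j, (1 / 2 : ℝ) ≤ ((u j : ℂ) ^ t).re := by
  obtain ⟨a, φ, hφ, ha⟩ := CompactSpace.tendsto_subseq (fun k : ℕ => fun j => u j ^ (k * T))
  have hc := ha.cauchySeq
  obtain ⟨N, hN⟩ := Metric.cauchySeq_iff'.1 hc (1 / 2) (by norm_num)
  have h1 := hN (N + 1) (by omega)
  have hlt : φ N < φ (N + 1) := hφ (by omega)
  refine ⟨(φ (N + 1) - φ N) * T, Nat.le_mul_of_pos_left T (by omega), fun j => ?_⟩
  have h2 : dist (u j ^ (φ (N + 1) * T)) (u j ^ (φ N * T)) < 1 / 2 :=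
    lt_of_le_of_lt (dist_le_pi_dist (fun j => u j ^ (φ (N + 1) * T))
      (fun j => u j ^ (φ N * T)) j) h1
  have h3 : φ (N + 1) * T = (φ (N + 1) - φ N) * T + φ N * T := by
    rw [← add_mul]; congr 1; omega
  rw [h3, pow_add] at h2
  have h4 : ‖((u j : ℂ) ^ ((φ (N + 1) - φ N) * T)) - 1‖ < 1 / 2 := by
    have h5 : dist (u j ^ ((φ (N + 1) - φ N) * T) * u j ^ (φ N * T)) (u j ^ (φ N * T))
        = ‖((u j : ℂ) ^ ((φ (N + 1) - φ N) * T)) - 1‖ := by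
      have : (((u j ^ ((φ (N + 1) - φ N) * T) * u j ^ (φ N * T) : Circle)) : ℂ)
          - ((u j ^ (φ N * T) : Circle) : ℂ)
          = (((u j : ℂ) ^ ((φ (N + 1) - φ N) * T)) - 1) * ((u j ^ (φ N * T) : Circle) : ℂ) := by
        push_cast; ring
      change dist (((u j ^ ((φ (N + 1) - φ N) * T) * u j ^ (φ N * T) : Circle)) : ℂ)
        ((u j ^ (φ N * T) : Circle) : ℂ) = _
      rw [dist_eq_norm, this, norm_mul, Circle.norm_coe, mul_one]
    rw [← h5]; exact h2
  have h6 := (Complex.abs_re_le_norm (((u j : ℂ) ^ ((φ (N + 1) - φ N) * T)) - 1)).trans_lt h4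
  rw [abs_lt, Complex.sub_re, Complex.one_re] at h6
  linarith [h6.1]

theorem norm_le_of_norm_sum_pow_le {m : ℕ} (z : Fin m → ℂ) {ρ C : ℝ} (hρ : 0 < ρ) (t₀ : ℕ)
    (h : ∀ t, t₀ ≤ t → ‖∑ j, z j ^ t‖ ≤ C * ρ ^ t) (j₀ : Fin m) : ‖z j₀‖ ≤ ρ := by
  by_contra! hlt
  have hpos : 0 < ‖z j₀‖ := hρ.trans hlt
  obtain ⟨T, hT⟩ := pow_unbounded_of_one_lt (2 * C) ((one_lt_div hρ).mpr hlt)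
  obtain ⟨t, ht, hu⟩ := exists_large_pow_re_ge_half
    (fun j => Circle.exp (Complex.arg (z j))) (max T t₀)
  have hz : ∀ j, z j = (‖z j‖ : ℂ) * (Circle.exp (Complex.arg (z j)) : ℂ) := fun j => by
    rw [Circle.coe_exp]; exact (Complex.norm_mul_exp_arg_mul_I (z j)).symm
  have hre : ∀ j, (1 / 2) * ‖z j‖ ^ t ≤ (z j ^ t).re := fun j => by
    have : z j ^ t = ((‖z j‖ ^ t : ℝ) : ℂ) * (Circle.exp (Complex.arg (z j)) : ℂ) ^ t := by
      conv_lhs => rw [hz j]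
      rw [mul_pow]; push_cast; rfl
    rw [this, Complex.re_ofReal_mul]
    nlinarith [hu j, pow_nonneg (norm_nonneg (z j)) t]
  have h1 : (1 / 2) * ‖z j₀‖ ^ t ≤ C * ρ ^ t := by
    calc (1 / 2) * ‖z j₀‖ ^ t ≤ ∑ j, (1 / 2) * ‖z j‖ ^ t :=
          Finset.single_le_sum (f := fun j => (1 / 2) * ‖z j‖ ^ t)
            (fun j _ => by positivity) (Finset.mem_univ j₀)
      _ ≤ ∑ j, (z j ^ t).re := Finset.sum_le_sum fun j _ => hre j
      _ = (∑ j, z j ^ t).re := (Complex.re_sum _ _).symm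
      _ ≤ ‖∑ j, z j ^ t‖ := (le_abs_self _).trans (Complex.abs_re_le_norm _)
      _ ≤ C * ρ ^ t := h t ((le_max_right _ _).trans ht)
  have h2 : 2 * C < (‖z j₀‖ / ρ) ^ t :=
    hT.trans_le (pow_le_pow_right₀ ((one_lt_div hρ).mpr hlt).le ((le_max_left _ _).trans ht))
  rw [div_pow, lt_div_iff₀ (by positivity)] at h2
  linarith

theorem sum_pow_eq_of_newton {m : ℕ} (z : Fin m → ℂ) (c S : ℕ → ℂ) (hc0 : c 0 = 1)
    (hc : ∀ k, c k = (-1) ^ k * (univ.val.map z).esymm k)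
    (hS : ∀ k, k * c k = ∑ a ∈ antidiagonal k with a.1 < k, c a.1 * S a.2) (k : ℕ) (hk : 0 < k) :
    S k = - ∑ j, z j ^ k := by
  induction k using Nat.strong_induction_on with
  | _ k ih =>
  have hN := congrArg (MvPolynomial.aeval z) (MvPolynomial.mul_esymm_eq_sum (Fin m) ℂ k)
  simp only [map_mul, map_natCast, map_pow, map_neg, map_one, map_sum,
    MvPolynomial.aeval_esymm_eq_multiset_esymm, MvPolynomial.psum, MvPolynomial.aeval_X] at hN
  have e : ∀ k, (univ.val.map z).esymm k = (-1) ^ k * c k := fun k => by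
    rw [hc, ← mul_assoc, ← mul_pow]; simp
  have hN2 : (k : ℂ) * c k = - ∑ a ∈ antidiagonal k with a.1 < k, c a.1 * ∑ j, z j ^ a.2 := by
    have h1 : (k : ℂ) * c k = (-1) ^ k * (k * (univ.val.map z).esymm k) := by rw [hc]; ring
    rw [h1, hN, ← mul_assoc, ← pow_add, show k + (k + 1) = 2 * k + 1 by ring, pow_succ, pow_mul]
    simp only [neg_mul, mul_neg, mul_one, one_mul, even_two, Even.neg_pow, one_pow]
    congr 1
    refine Finset.sum_congr rfl fun a _ => ?_
    rw [hc]
  rw [hS] at hN2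
  have hmem : (0, k) ∈ (antidiagonal k).filter (fun a => a.1 < k) := by simp [hk]
  rw [← Finset.add_sum_erase _ _ hmem, ← Finset.add_sum_erase _ _ hmem, neg_add] at hN2
  have : ∑ x ∈ ((antidiagonal k).filter (fun a => a.1 < k)).erase (0, k), c x.1 * S x.2
      = - ∑ x ∈ ((antidiagonal k).filter (fun a => a.1 < k)).erase (0, k),
        c x.1 * ∑ j, z j ^ x.2 := by
    rw [← Finset.sum_neg_distrib]
    refine Finset.sum_congr rfl fun a ha => ?_
    simp only [mem_erase, mem_filter, HasAntidiagonal.mem_antidiagonal, ne_eq, Prod.ext_iff]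
      at ha
    rw [ih a.2 (by omega) (by omega), mul_neg]
  rw [this, hc0] at hN2
  simpa using hN2

open Polynomial in
theorem exists_esymm_eq (m : ℕ) (c : ℕ → ℂ) (hc0 : c 0 = 1) (hc : ∀ k, m < k → c k = 0) :
    ∃ z : Fin m → ℂ, ∀ k, c k = (-1) ^ k * (univ.val.map z).esymm k := by
  let P : ℂ[X] := ∑ i ∈ range (m + 1), monomial i (c (m - i))
  have hco : ∀ i, i ≤ m → P.coeff i = c (m - i) := fun i hi => by
    simp [P, finsetSum_coeff, coeff_monomial, hi]
  have hdeg : P.natDegree ≤ m := by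
    refine natDegree_sum_le_of_forall_le _ _ fun i hi => ?_
    exact (natDegree_monomial_le _).trans (by simp at hi; omega)
  have hm : P.coeff m = 1 := by rw [hco m le_rfl]; simp [hc0]
  have hmon : P.Monic := monic_of_natDegree_le_of_coeff_eq_one m hdeg hm
  have hd : P.natDegree = m := le_antisymm hdeg (le_natDegree_of_ne_zero (by simp [hm]))
  have hcard : P.roots.card = m := by
    rw [← hd]; exact (IsAlgClosed.splits P).natDegree_eq_card_roots.symm
  obtain ⟨l, hl⟩ : ∃ l : List ℂ, (l : Multiset ℂ) = P.roots := ⟨_, Multiset.coe_toList _⟩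
  have hlen : l.length = m := by rw [← hcard, ← hl, Multiset.coe_card]
  subst hlen
  refine ⟨l.get, fun k => ?_⟩
  have hmap : (univ.val.map l.get : Multiset ℂ) = P.roots := by
    rw [← hl, Fin.univ_val_map, List.ofFn_get]
  rw [hmap]
  rcases le_or_gt k l.length with hk | hk
  · have := coeff_eq_esymm_roots_of_card (p := P) (by rw [hcard, hd]) (k := l.length - k)
      (by omega)
    rw [hco _ (by omega), hmon.leadingCoeff, hd, one_mul] at this
    rwa [show l.length - (l.length - k) = k by omega] at this
  · rw [hc k hk, Multiset.esymm, Multiset.powersetCard_eq_empty _ (by omega)]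
    simp

section LFunction
open Polynomial UniqueFactorizationMonoid
open scoped Classical

variable {F : Type*} [Field F]

theorem finite_setOf_monic_natDegree [Finite F] (k : ℕ) :
    {g : F[X] | g.Monic ∧ g.natDegree = k}.Finite := by
  refine Set.Finite.of_injOn (f := fun g : F[X] => fun i : Fin (k + 1) => g.coeff i)
    (t := Set.univ) (fun _ _ => Set.mem_univ _) ?_ Set.finite_univ
  intro g hg h hh hgh
  ext i
  by_cases hi : i < k + 1
  · exact congrFun hgh ⟨i, hi⟩
  · rw [coeff_eq_zero_of_natDegree_lt (by rw [hg.2]; omega),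
      coeff_eq_zero_of_natDegree_lt (by rw [hh.2]; omega)]

/-- The monic polynomials of degree `k` over a finite field. -/
noncomputable def monicsOfDegree (F : Type*) [Field F] [Finite F] (k : ℕ) : Finset F[X] :=
  (finite_setOf_monic_natDegree (F := F) k).toFinset

theorem mem_monicsOfDegree [Finite F] {k : ℕ} {g : F[X]} :
    g ∈ monicsOfDegree F k ↔ g.Monic ∧ g.natDegree = k := by
  simp [monicsOfDegree]

/-- The monic irreducible polynomials of degree at most `k` over a finite field. -/
noncomputable def monicIrreds (F : Type*) [Field F] [Finite F] (k : ℕ) : Finset F[X] :=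
  ((range (k + 1)).biUnion (monicsOfDegree F)).filter Irreducible

theorem mem_monicIrreds [Finite F] {k : ℕ} {g : F[X]} :
    g ∈ monicIrreds F k ↔ g.Monic ∧ Irreducible g ∧ g.natDegree ≤ k := by
  simp only [monicIrreds, mem_filter, mem_biUnion, mem_range, mem_monicsOfDegree]
  constructor
  · rintro ⟨⟨a, h1, h2, rfl⟩, h3⟩
    exact ⟨h2, h3, by omega⟩
  · rintro ⟨h1, h2, h3⟩
    exact ⟨⟨_, by omega, h1, rfl⟩, h2⟩

theorem sum_natDegree_mul_card_pow_dvd [Finite F] {g : F[X]} (hg : g.Monic) :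
    ∑ P ∈ monicIrreds F g.natDegree,
      P.natDegree * #{j ∈ Icc 1 g.natDegree | P ^ j ∣ g} = g.natDegree := by
  have hmon : ∀ f ∈ normalizedFactors g, f.Monic := fun f hf => by
    rw [← normalize_normalized_factor f hf]
    exact monic_normalize (irreducible_of_normalized_factor f hf).ne_zero
  have hprod : (normalizedFactors g).prod = g := by
    rw [prod_normalizedFactors_eq hg.ne_zero, hg.normalize_eq_self]
  have h1 : g.natDegree = ∑ P ∈ (normalizedFactors g).toFinset,
      (normalizedFactors g).count P * P.natDegree := by
    conv_lhs => rw [← hprod, natDegree_multiset_prod_of_monic _ hmon,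
      Finset.sum_multiset_map_count]
    simp
  have hsub : (normalizedFactors g).toFinset ⊆ monicIrreds F g.natDegree := fun P hP => by
    rw [Multiset.mem_toFinset] at hP
    exact mem_monicIrreds.2 ⟨hmon P hP, irreducible_of_normalized_factor P hP,
      natDegree_le_of_dvd (dvd_of_mem_normalizedFactors hP) hg.ne_zero⟩
  conv_rhs => rw [h1]
  rw [Finset.sum_subset hsub (fun P _ hP => by
    rw [Multiset.count_eq_zero.2 (fun h => hP (Multiset.mem_toFinset.2 h)), zero_mul])]
  refine Finset.sum_congr rfl fun P hP => ?_
  obtain ⟨hPm, hPi, hPd⟩ := mem_monicIrreds.1 hP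
  rw [mul_comm]
  congr 1
  have hdvd : ∀ j, P ^ j ∣ g ↔ j ≤ (normalizedFactors g).count P := fun j => by
    rw [pow_dvd_iff_le_emultiplicity, emultiplicity_eq_count_normalizedFactors hPi hg.ne_zero,
      hPm.normalize_eq_self, Nat.cast_le]
  have hle : (normalizedFactors g).count P ≤ g.natDegree := by
    have h2 := natDegree_le_of_dvd ((hdvd _).2 le_rfl) hg.ne_zero
    rw [natDegree_pow] at h2
    exact le_trans (Nat.le_mul_of_pos_right _ hPi.natDegree_pos) h2
  have : {j ∈ Icc 1 g.natDegree | P ^ j ∣ g} = Icc 1 ((normalizedFactors g).count P) := by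
    ext j
    simp only [mem_filter, mem_Icc, hdvd]
    omega
  rw [this]; simp

/-- The `k`-th coefficient of the L-function of a multiplicative function on polynomials. -/
noncomputable def lCoeff [Finite F] (Φ : F[X] →* ℂ) (k : ℕ) : ℂ :=
  ∑ g ∈ monicsOfDegree F k, Φ g

/-- The sum of a multiplicative function against the von Mangoldt function in degree `r`. -/
noncomputable def lambdaSum [Finite F] (Φ : F[X] →* ℂ) (r : ℕ) : ℂ :=
  ∑ P ∈ monicIrreds F r, if P.natDegree ∣ r then P.natDegree * Φ P ^ (r / P.natDegree) else 0

theorem lCoeff_zero [Finite F] (Φ : F[X] →* ℂ) : lCoeff Φ 0 = 1 := by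
  have : monicsOfDegree F 0 = {1} := by
    ext g
    rw [mem_monicsOfDegree, mem_singleton]
    exact ⟨fun h => h.1.natDegree_eq_zero.1 h.2, by rintro rfl; simp⟩
  simp [lCoeff, this]

theorem sum_filter_pow_dvd [Finite F] (Φ : F[X] →* ℂ) {P : F[X]} (hP : P.Monic) (k j : ℕ) :
    ∑ g ∈ monicsOfDegree F k with P ^ j ∣ g, Φ g =
      if j * P.natDegree ≤ k then Φ P ^ j * lCoeff Φ (k - j * P.natDegree) else 0 := by
  split_ifs with h
  · rw [lCoeff, Finset.mul_sum]
    symm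
    refine Finset.sum_bij (fun g _ => P ^ j * g) ?_ ?_ ?_ ?_
    · intro g hg
      rw [mem_monicsOfDegree] at hg
      rw [mem_filter, mem_monicsOfDegree]
      refine ⟨⟨(hP.pow j).mul hg.1, ?_⟩, dvd_mul_right _ _⟩
      rw [(hP.pow j).natDegree_mul hg.1, natDegree_pow, hg.2]
      omega
    · intro g _ g' _ h
      exact mul_left_cancel₀ (hP.pow j).ne_zero h
    · intro g hg
      rw [mem_filter, mem_monicsOfDegree] at hg
      obtain ⟨⟨h1, h2⟩, g', rfl⟩ := hg
      have h3 : g'.Monic := (hP.pow j).of_mul_monic_left h1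
      refine ⟨g', ?_, rfl⟩
      rw [(hP.pow j).natDegree_mul h3, natDegree_pow] at h2
      exact mem_monicsOfDegree.2 ⟨h3, by omega⟩
    · intro g _
      rw [map_mul, map_pow]
  · refine Finset.sum_eq_zero fun g hg => ?_
    rw [mem_filter, mem_monicsOfDegree] at hg
    have := natDegree_le_of_dvd hg.2 hg.1.1.ne_zero
    rw [natDegree_pow] at this
    omega

theorem mul_lCoeff_eq [Finite F] (Φ : F[X] →* ℂ) (k : ℕ) :
    k * lCoeff Φ k = ∑ a ∈ antidiagonal k with a.1 < k, lCoeff Φ a.1 * lambdaSum Φ a.2 := by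
  have h1 : (k : ℂ) * lCoeff Φ k = ∑ P ∈ monicIrreds F k, ∑ j ∈ Icc 1 k,
      P.natDegree * ∑ g ∈ monicsOfDegree F k with P ^ j ∣ g, Φ g := by
    rw [lCoeff, Finset.mul_sum]
    have : ∀ g ∈ monicsOfDegree F k, (k : ℂ) * Φ g = ∑ P ∈ monicIrreds F k, ∑ j ∈ Icc 1 k,
        P.natDegree * if P ^ j ∣ g then Φ g else 0 := fun g hg => by
      obtain ⟨hm, rfl⟩ := mem_monicsOfDegree.1 hg
      conv_lhs => rw [← sum_natDegree_mul_card_pow_dvd hm]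
      rw [Nat.cast_sum, Finset.sum_mul]
      refine Finset.sum_congr rfl fun P _ => ?_
      rw [← Finset.mul_sum, ← Finset.sum_filter, Finset.sum_const, nsmul_eq_mul]
      push_cast; ring
    rw [Finset.sum_congr rfl this, Finset.sum_comm]
    refine Finset.sum_congr rfl fun P _ => ?_
    rw [Finset.sum_comm]
    refine Finset.sum_congr rfl fun j _ => ?_
    rw [← Finset.mul_sum, Finset.sum_filter]
  have h2 : ∑ a ∈ antidiagonal k with a.1 < k, lCoeff Φ a.1 * lambdaSum Φ a.2 =
      ∑ r ∈ Icc 1 k, lCoeff Φ (k - r) * lambdaSum Φ r := by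
    refine Finset.sum_bij (fun a _ => a.2) ?_ ?_ ?_ ?_
    · intro a ha
      simp only [mem_filter, HasAntidiagonal.mem_antidiagonal] at ha
      simp only [mem_Icc]; omega
    · intro a ha b hb h
      simp only [mem_filter, HasAntidiagonal.mem_antidiagonal] at ha hb
      exact Prod.ext (by omega) h
    · intro r hr
      simp only [mem_Icc] at hr
      exact ⟨(k - r, r), by simp only [mem_filter, HasAntidiagonal.mem_antidiagonal]; omega, rfl⟩
    · intro a ha
      simp only [mem_filter, HasAntidiagonal.mem_antidiagonal] at ha
      rw [show a.1 = k - a.2 by omega]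
  have h3 : ∀ r ∈ Icc 1 k, lambdaSum Φ r = ∑ P ∈ monicIrreds F k,
      if P.natDegree ∣ r then P.natDegree * Φ P ^ (r / P.natDegree) else 0 := fun r hr => by
    rw [mem_Icc] at hr
    refine Finset.sum_subset (fun P hP => ?_) (fun P hP hP' => if_neg fun hd => hP' ?_)
    · rw [mem_monicIrreds] at hP ⊢
      exact ⟨hP.1, hP.2.1, by omega⟩
    · rw [mem_monicIrreds] at hP ⊢
      exact ⟨hP.1, hP.2.1, Nat.le_of_dvd (by omega) hd⟩
  have h4 : ∑ r ∈ Icc 1 k, lCoeff Φ (k - r) * lambdaSum Φ r =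
      ∑ r ∈ Icc 1 k, ∑ P ∈ monicIrreds F k, lCoeff Φ (k - r) *
        if P.natDegree ∣ r then P.natDegree * Φ P ^ (r / P.natDegree) else 0 :=
    Finset.sum_congr rfl fun r hr => by rw [h3 r hr, Finset.mul_sum]
  rw [h1, h2, h4, Finset.sum_comm (s := Icc 1 k)]
  refine Finset.sum_congr rfl fun P hP => ?_
  obtain ⟨hPm, hPi, hPd⟩ := mem_monicIrreds.1 hP
  have hpos := hPi.natDegree_pos
  simp_rw [sum_filter_pow_dvd Φ hPm, mul_ite, mul_zero]
  rw [← Finset.sum_filter, ← Finset.sum_filter]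
  refine Finset.sum_bij (fun j _ => j * P.natDegree) ?_ ?_ ?_ ?_
  · intro j hj
    simp only [mem_filter, mem_Icc] at hj ⊢
    exact ⟨⟨Nat.mul_pos (by omega) hpos, hj.2⟩, dvd_mul_left _ _⟩
  · intro j _ j' _ h
    exact Nat.eq_of_mul_eq_mul_right hpos h
  · intro r hr
    simp only [mem_filter, mem_Icc] at hr
    obtain ⟨⟨hr1, hr2⟩, j, rfl⟩ := hr
    refine ⟨j, ?_, mul_comm _ _⟩
    simp only [mem_filter, mem_Icc]
    refine ⟨⟨Nat.pos_of_ne_zero (by rintro rfl; simp at hr1), ?_⟩, by rwa [mul_comm]⟩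
    exact le_trans (Nat.le_mul_of_pos_left _ hpos) hr2
  · intro j _
    rw [Nat.mul_div_cancel _ hpos]; ring

open IntermediateField in
theorem norm_algebraMap_sub {K : Type*} [Field K] [Algebra F K] [FiniteDimensional F K]
    (a : F) (x : K) :
    Algebra.norm F (algebraMap F K a - x) =
      ((minpoly F x).eval a) ^ (Module.finrank F K / (minpoly F x).natDegree) := by
  have hx : IsIntegral F x := IsIntegral.of_finite F x
  have hfin : Module.finrank F F⟮x⟯ * Module.finrank F⟮x⟯ K = Module.finrank F K :=
    Module.finrank_mul_finrank F F⟮x⟯ K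
  rw [adjoin.finrank hx] at hfin
  have hpos : 0 < (minpoly F x).natDegree := minpoly.natDegree_pos hx
  rw [← hfin, Nat.mul_div_cancel_left _ hpos]
  have h1 : algebraMap F K a - x =
      algebraMap F⟮x⟯ K (algebraMap F F⟮x⟯ a - AdjoinSimple.gen F x) := by
    rw [map_sub, AdjoinSimple.algebraMap_gen, ← IsScalarTower.algebraMap_apply]
  rw [← Algebra.norm_norm (S := F⟮x⟯), h1, Algebra.norm_algebraMap, map_pow]
  congr 1
  let pb := adjoin.powerBasis hx
  have hg : pb.gen = AdjoinSimple.gen F x := adjoin.powerBasis_gen hx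
  rw [Algebra.norm_eq_matrix_det pb.basis, ← minpoly_gen F x, ← hg, ← charpoly_leftMulMatrix,
    Matrix.eval_charpoly, map_sub]
  congr 2
  ext i j
  simp [Matrix.scalar_apply, Matrix.algebraMap_matrix_apply, Matrix.diagonal_apply]

theorem card_filter_minpoly_eq {K : Type*} [Field K] [Algebra F K] [Fintype K] [Finite F]
    {P : F[X]} (hm : P.Monic) (hi : Irreducible P) (hd : P.natDegree ∣ Module.finrank F K) :
    #{x : K | minpoly F x = P} = P.natDegree := by
  have : FiniteDimensional F K := Module.Finite.of_finite
  have : Fact (Irreducible P) := ⟨hi⟩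
  have hfr : Module.finrank F (AdjoinRoot P) = P.natDegree := by
    rw [(AdjoinRoot.powerBasis hi.ne_zero).finrank, AdjoinRoot.powerBasis_dim]
  obtain ⟨φ⟩ : Nonempty (AdjoinRoot P →ₐ[F] K) :=
    FiniteField.nonempty_algHom_of_finrank_dvd (by rwa [hfr])
  have hroot : aeval (φ (AdjoinRoot.root P)) P = 0 := by
    rw [aeval_algHom_apply]
    simp
  have hmin : minpoly F (φ (AdjoinRoot.root P)) = P := (minpoly.eq_of_irreducible_of_monic hi
    hroot hm).symm
  have hs : (P.map (algebraMap F K)).Splits := by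
    rw [← hmin]
    exact Normal.splits inferInstance _
  rw [← card_rootSet_eq_natDegree (PerfectField.separable_of_irreducible hi) hs,
    ← Set.toFinset_card]
  congr 1
  ext x
  simp only [mem_filter, mem_univ, true_and, Set.mem_toFinset, mem_rootSet]
  constructor
  · rintro rfl
    exact ⟨hi.ne_zero, minpoly.aeval F x⟩
  · rintro ⟨_, h⟩
    exact (minpoly.eq_of_irreducible_of_monic hi h hm).symm

theorem lambdaSum_eq {K : Type*} [Field K] [Algebra F K] [Fintype K] [Finite F] (Φ : F[X] →* ℂ) :
    lambdaSum Φ (Module.finrank F K) =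
      ∑ x : K, Φ (minpoly F x) ^ (Module.finrank F K / (minpoly F x).natDegree) := by
  have : FiniteDimensional F K := Module.Finite.of_finite
  set r := Module.finrank F K with hr
  have hmaps : ∀ x ∈ (univ : Finset K), minpoly F x ∈ monicIrreds F r := fun x _ => by
    have hx : IsIntegral F x := IsIntegral.of_finite F x
    exact mem_monicIrreds.2 ⟨minpoly.monic hx, minpoly.irreducible hx, minpoly.natDegree_le x⟩
  rw [← Finset.sum_fiberwise_of_maps_to hmaps, lambdaSum]
  refine Finset.sum_congr rfl fun P hP => ?_
  obtain ⟨hPm, hPi, hPd⟩ := mem_monicIrreds.1 hP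
  rw [Finset.sum_congr rfl (g := fun _ => Φ P ^ (r / P.natDegree))
    (fun x hx => by rw [(mem_filter.1 hx).2]), Finset.sum_const, nsmul_eq_mul]
  split_ifs with h
  · rw [card_filter_minpoly_eq hPm hPi h]
  · have : ({x : K | minpoly F x = P} : Finset K) = ∅ := by
      rw [Finset.filter_eq_empty_iff]
      rintro x _ rfl
      have hfin := Module.finrank_mul_finrank F (IntermediateField.adjoin F {x}) K
      rw [IntermediateField.adjoin.finrank (IsIntegral.of_finite F x)] at hfin
      exact h (Dvd.intro _ hfin)
    rw [this]; simp

end LFunction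

section CharacterSum
open Polynomial

variable {F : Type*} [Field F] {ι : Type*} [Fintype ι]

/-- The multiplicative function `g ↦ ∏ i, χ i (g (a i))` on polynomials. -/
noncomputable def evalCharProd (a : ι → F) (χ : ι → MulChar F ℂ) : F[X] →* ℂ where
  toFun g := ∏ i, χ i (g.eval (a i))
  map_one' := by simp
  map_mul' g h := by simp [Finset.prod_mul_distrib]

theorem evalCharProd_apply (a : ι → F) (χ : ι → MulChar F ℂ) (g : F[X]) :
    evalCharProd a χ g = ∏ i, χ i (g.eval (a i)) := rfl

theorem lCoeff_evalCharProd_eq_zero [Fintype F] {a : ι → F} (ha : Function.Injective a)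
    {χ : ι → MulChar F ℂ} {i₀ : ι} (hχ : χ i₀ ≠ 1) {k : ℕ} (hk : Fintype.card ι ≤ k) :
    lCoeff (evalCharProd a χ) k = 0 := by
  classical
  set u : F[X] := Lagrange.basis univ a i₀ with hu
  have hu1 : u.eval (a i₀) = 1 := Lagrange.eval_basis_self ha.injOn (mem_univ i₀)
  have hu0 : ∀ i ≠ i₀, u.eval (a i) = 0 := fun i hi =>
    Lagrange.eval_basis_of_ne hi.symm (mem_univ i)
  have hcard : 0 < Fintype.card ι := Fintype.card_pos_iff.2 ⟨i₀⟩
  have hud : ∀ t : F, (C t * u).degree < k := fun t => by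
    rw [← smul_eq_C_mul]
    refine lt_of_le_of_lt (degree_smul_le t u) ?_
    rw [hu, Lagrange.degree_basis ha.injOn (mem_univ i₀), card_univ]
    exact_mod_cast (by omega : Fintype.card ι - 1 < k)
  have hmem : ∀ (t : F) (g : F[X]), g ∈ monicsOfDegree F k → g + C t * u ∈ monicsOfDegree F k := by
    intro t g hg
    rw [mem_monicsOfDegree] at hg ⊢
    have hlt : (C t * u).degree < g.degree := by
      rw [degree_eq_natDegree hg.1.ne_zero, hg.2]; exact hud t
    exact ⟨hg.1.add_of_left hlt, by rw [natDegree_add_eq_left_of_degree_lt hlt, hg.2]⟩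
  have hshift : ∀ t : F, lCoeff (evalCharProd a χ) k =
      ∑ g ∈ monicsOfDegree F k, evalCharProd a χ (g + C t * u) := fun t => by
    symm
    refine Finset.sum_bij' (fun g _ => g + C t * u) (fun g _ => g + C (-t) * u)
      (fun g hg => hmem t g hg) (fun g hg => hmem (-t) g hg) ?_ ?_ (fun _ _ => rfl)
    · intro g _; simp
    · intro g _; simp
  have hsum : ∑ t : F, ∑ g ∈ monicsOfDegree F k, evalCharProd a χ (g + C t * u) = 0 := by
    rw [Finset.sum_comm]
    refine Finset.sum_eq_zero fun g _ => ?_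
    have : ∀ t : F, evalCharProd a χ (g + C t * u) =
        χ i₀ (g.eval (a i₀) + t) * ∏ i ∈ univ.erase i₀, χ i (g.eval (a i)) := fun t => by
      rw [evalCharProd_apply, ← Finset.mul_prod_erase univ _ (mem_univ i₀)]
      congr 1
      · simp [hu1]
      · refine Finset.prod_congr rfl fun i hi => ?_
        simp [hu0 i (ne_of_mem_erase hi)]
    have hsh : ∑ t, χ i₀ (g.eval (a i₀) + t) = ∑ t, χ i₀ t :=
      Equiv.sum_comp (Equiv.addLeft (g.eval (a i₀))) (fun t => χ i₀ t)
    simp_rw [this]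
    rw [← Finset.sum_mul, hsh, MulChar.sum_eq_zero_of_ne_one hχ, zero_mul]
  rw [← Finset.sum_congr rfl (fun t _ => hshift t), Finset.sum_const, nsmul_eq_mul] at hsum
  refine (mul_eq_zero.1 hsum).resolve_left ?_
  simp

theorem sum_prod_mulChar_norm_eq [Fintype F] (a : ι → F) (χ : ι → MulChar F ℂ) (K : Type*)
    [Field K] [Algebra F K] [Fintype K] :
    ∑ x : K, ∏ i, χ i (Algebra.norm F (algebraMap F K (a i) - x)) =
      lambdaSum (evalCharProd a χ) (Module.finrank F K) := by
  rw [lambdaSum_eq]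
  refine Finset.sum_congr rfl fun x _ => ?_
  simp_rw [norm_algebraMap_sub, map_pow]
  rw [evalCharProd_apply, Finset.prod_pow]

theorem exists_sum_prod_mulChar_norm_eq [Fintype F] {a : ι → F} (ha : Function.Injective a)
    {χ : ι → MulChar F ℂ} (hχ : ∃ i, χ i ≠ 1) :
    ∃ z : Fin (Fintype.card ι - 1) → ℂ, ∑ x, ∏ i, χ i (a i - x) = -∑ j, z j ∧
      ∀ (K : Type) [Field K] [Algebra F K] [Fintype K],
        ∑ x : K, ∏ i, χ i (Algebra.norm F (algebraMap F K (a i) - x)) =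
          -∑ j, z j ^ Module.finrank F K := by
  obtain ⟨i₀, hi₀⟩ := hχ
  obtain ⟨z, hz⟩ := exists_esymm_eq (Fintype.card ι - 1) (lCoeff (evalCharProd a χ))
    (lCoeff_zero _) (fun k hk => lCoeff_evalCharProd_eq_zero ha hi₀ (by omega))
  have hL : ∀ r, 0 < r → lambdaSum (evalCharProd a χ) r = -∑ j, z j ^ r := fun r hr =>
    sum_pow_eq_of_newton z (lCoeff (evalCharProd a χ)) (lambdaSum (evalCharProd a χ))
      (lCoeff_zero _) hz (mul_lCoeff_eq _) r hr
  refine ⟨z, ?_, fun K _ _ _ => ?_⟩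
  · simpa using (sum_prod_mulChar_norm_eq a χ F).trans (hL _ Module.finrank_pos)
  · have : FiniteDimensional F K := Module.Finite.of_finite
    exact (sum_prod_mulChar_norm_eq a χ K).trans (hL _ Module.finrank_pos)

end CharacterSum

section Independence
open Polynomial

/-- The matrix of multiplication by `∑ j, H j * z ^ j` on the span of `1, z, …, z ^ (d - 1)`,
where `z ^ d = A`. -/
def twistedCirculant {R : Type*} [CommRing R] (d : ℕ) (A : R) (H : ℕ → R) :
    Matrix (Fin d) (Fin d) R :=
  Matrix.of fun i j => if (i : ℕ) ≤ j then H (j - i) else A * H (j + d - i)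

theorem sum_twistedCirculant_mul_pow {R S : Type*} [CommRing R] [CommRing S] (φ : R →+* S)
    {d : ℕ} {A : R} (H : ℕ → R) {z : S} (hz : z ^ d = φ A) (i : Fin d) :
    ∑ j, φ (twistedCirculant d A H i j) * z ^ (j : ℕ) =
      z ^ (i : ℕ) * ∑ j : Fin d, φ (H j) * z ^ (j : ℕ) := by
  have : NeZero d := ⟨by have := i.2; omega⟩
  rw [Finset.mul_sum]
  symm
  refine Fintype.sum_equiv (Equiv.addLeft i) _ _ fun k => ?_
  have hk := k.2
  have hi := i.2
  rcases lt_or_ge ((i : ℕ) + k) d with h | h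
  · have hv : ((i + k : Fin d) : ℕ) = i + k := by rw [Fin.val_add, Nat.mod_eq_of_lt h]
    simp only [Equiv.coe_addLeft, twistedCirculant, Matrix.of_apply, hv]
    rw [if_pos (by omega), show (i : ℕ) + k - i = k by omega]
    ring
  · have hv : ((i + k : Fin d) : ℕ) = i + k - d := by
      rw [Fin.val_add, Nat.mod_eq_sub_mod h, Nat.mod_eq_of_lt (by omega)]
    simp only [Equiv.coe_addLeft, twistedCirculant, Matrix.of_apply, hv]
    rw [if_neg (by omega), show (i : ℕ) + k - d + d - i = k by omega, map_mul, ← hz]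
    have : z ^ (i : ℕ) * z ^ (k : ℕ) = z ^ d * z ^ ((i : ℕ) + k - d) := by
      rw [← pow_add, ← pow_add]; congr 1; omega
    linear_combination φ (H k) * this

theorem natDegree_det_twistedCirculant_le {R : Type*} [CommRing R] {d D m : ℕ} {A : R[X]}
    {H : ℕ → R[X]} (hA : A.natDegree ≤ m) (hH : ∀ j < d, (H j).natDegree ≤ D) :
    (twistedCirculant d A H).det.natDegree ≤ d * (m + D) := by
  rw [Matrix.det_apply]
  refine natDegree_sum_le_of_forall_le _ _ fun σ _ => ?_
  refine (natDegree_smul_le _ _).trans ((natDegree_prod_le _ _).trans ?_)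
  refine (Finset.sum_le_card_nsmul _ _ (m + D) fun i _ => ?_).trans (by simp)
  have h1 := i.2
  have h2 := (σ i).2
  simp only [twistedCirculant, Matrix.of_apply]
  split_ifs with h
  · exact (hH _ (by omega)).trans (by omega)
  · exact natDegree_mul_le.trans (Nat.add_le_add hA (hH _ (by omega)))

/-- The specialisation `F[Y][X] → F[X]` sending `Y` to `X ^ Q`. -/
noncomputable def specPow (F : Type*) [Field F] (Q : ℕ) : F[X][X] →+* F[X] :=
  eval₂RingHom (expand F Q : F[X] →+* F[X]) X

theorem specPow_C {F : Type*} [Field F] (Q : ℕ) (f : F[X]) : specPow F Q (C f) = expand F Q f := by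
  simp [specPow]

theorem specPow_map_C {F : Type*} [Field F] (Q : ℕ) (f : F[X]) : specPow F Q (f.map C) = f := by
  rw [specPow, coe_eval₂RingHom, eval₂_map]
  have : ((expand F Q : F[X] →+* F[X]).comp C) = C := by ext; simp
  rw [this, eval₂_C_X]

theorem eq_zero_of_specPow_eq_zero {F : Type*} [Field F] {Q : ℕ} {P : F[X][X]}
    (hP : P.natDegree < Q) (h : specPow F Q P = 0) : P = 0 := by
  have hQ : 0 < Q := by omega
  ext i k
  rcases lt_or_ge i Q with hi | hi
  · have h1 := congrArg (fun p => p.coeff (i + Q * k)) h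
    simp only [specPow, coe_eval₂RingHom, eval₂_eq_sum_range' _ hP, finsetSum_coeff,
      coeff_zero] at h1
    rw [Finset.sum_eq_single i] at h1
    · rw [coeff_mul_X_pow', if_pos (by omega)] at h1
      simpa [coeff_expand hQ, hQ] using h1
    · intro b hb hbi
      rw [mem_range] at hb
      rw [coeff_mul_X_pow']
      split_ifs with hle
      · rw [RingHom.coe_coe, coeff_expand hQ, if_neg]
        rintro ⟨c, hc⟩
        have h2 : i + Q * k = b + Q * c := by omega
        have h3 := congrArg (· % Q) h2
        simp only [Nat.add_mul_mod_self_left, Nat.mod_eq_of_lt hi, Nat.mod_eq_of_lt hb] at h3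
        exact hbi h3.symm
      · rfl
    · intro hi'; exact absurd (mem_range.2 hi) hi'
  · have : P.coeff i = 0 := coeff_eq_zero_of_natDegree_lt (by omega)
    simp [this]

/-- A `d`-th root of an element `A` of a field generates an extension of degree a multiple of any
number `d` such that `A ^ t` is a `d`-th power only if `d ∣ t`. -/
theorem eq_zero_of_aeval_root_eq_zero {K Ω : Type*} [Field K] [Field Ω] [Algebra K Ω]
    [IsAlgClosed Ω] {d : ℕ} {A : K} (hA : ∀ t (c : K), c ^ d = A ^ t ∨ c ^ d = -A ^ t → d ∣ t)
    (hd : 0 < d) {z : Ω} (hz : z ^ d = algebraMap K Ω A) {P : K[X]} (hP : P.natDegree < d)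
    (h : aeval z P = 0) : P = 0 := by
  have hz_int : IsIntegral K z :=
    ⟨X ^ d - C A, monic_X_pow_sub_C A hd.ne', by simp [hz]⟩
  set μ := minpoly K z with hμ
  have hdvd : μ ∣ X ^ d - C A := minpoly.dvd _ _ (by simp [hz])
  have hs : (μ.map (algebraMap K Ω)).Splits := IsAlgClosed.splits _
  have hmon : (μ.map (algebraMap K Ω)).Monic := (minpoly.monic hz_int).map _
  set s := (μ.map (algebraMap K Ω)).roots with hsdef
  have hroots : ∀ w ∈ s, w ^ d = algebraMap K Ω A := fun w hw => by
    have h1 : aeval w μ = 0 := by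
      have := isRoot_of_mem_roots hw
      rwa [IsRoot.def, eval_map_algebraMap] at this
    obtain ⟨g, hg⟩ := hdvd
    have h2 : aeval w (X ^ d - C A) = 0 := by rw [hg, map_mul, h1, zero_mul]
    simpa [sub_eq_zero] using h2
  have hcard : Multiset.card s = μ.natDegree := by
    rw [hsdef, ← hs.natDegree_eq_card_roots, natDegree_map]
  have hprod : s.prod ^ d = algebraMap K Ω (A ^ μ.natDegree) := by
    have h1 : (s.map fun w => w ^ d).prod = s.prod ^ d := by
      rw [Multiset.prod_map_pow, Multiset.map_id']
    rw [← h1, Multiset.map_congr rfl hroots, Multiset.map_const',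
      Multiset.prod_replicate, hcard, map_pow]
  have hcoeff : algebraMap K Ω (μ.coeff 0) = (-1) ^ μ.natDegree * s.prod := by
    have := hs.coeff_zero_eq_prod_roots_of_monic hmon
    rw [coeff_map, natDegree_map] at this
    exact this
  have hpow : algebraMap K Ω (μ.coeff 0 ^ d) =
      (-1) ^ (μ.natDegree * d) * algebraMap K Ω (A ^ μ.natDegree) := by
    rw [map_pow, hcoeff, mul_pow, hprod, pow_mul]
  have hdeg : d ∣ μ.natDegree := by
    refine hA _ (μ.coeff 0) ?_
    rcases neg_one_pow_eq_or Ω (μ.natDegree * d) with h1 | h1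
    · left
      apply (algebraMap K Ω).injective
      rw [hpow, h1, one_mul]
    · right
      apply (algebraMap K Ω).injective
      rw [hpow, h1, map_neg, neg_one_mul]
  by_contra hP0
  have h1 := natDegree_le_of_dvd (minpoly.dvd K z h) hP0
  have h2 := Nat.le_of_dvd (minpoly.natDegree_pos hz_int) hdeg
  omega

theorem dvd_of_pow_eq_mul_pow {R : Type*} [CommRing R] [IsDomain R] [WfDvdMonoid R] {π : R}
    (hπ : Prime π) {B x y : R} {d t m : ℕ} (hB : ¬π ∣ B) (hy : y ≠ 0) (hd : 0 < d)
    (h : x ^ d = (π ^ m * B) ^ t * y ^ d ∨ x ^ d = -(π ^ m * B) ^ t * y ^ d) : d ∣ t * m := by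
  have key : ∀ {a b : ℕ} {u v : R}, ¬π ∣ u → ¬π ∣ v → π ^ a * u = π ^ b * v → a ≤ b := by
    intro a b u v _ hv huv
    by_contra! hlt
    apply hv
    obtain ⟨c, rfl⟩ := Nat.exists_eq_add_of_lt hlt
    rw [show b + c + 1 = b + (c + 1) by ring, pow_add, mul_assoc] at huv
    have := mul_left_cancel₀ (pow_ne_zero b hπ.ne_zero) huv
    rw [← this, pow_succ', mul_assoc]
    exact dvd_mul_right _ _
  have hB0 : B ≠ 0 := by rintro rfl; exact hB (dvd_zero _)
  have hA0 : (π ^ m * B) ^ t * y ^ d ≠ 0 :=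
    mul_ne_zero (pow_ne_zero _ (mul_ne_zero (pow_ne_zero _ hπ.ne_zero) hB0)) (pow_ne_zero _ hy)
  have hx : x ≠ 0 := by
    rintro rfl
    rw [zero_pow hd.ne'] at h
    rcases h with h | h
    · exact hA0 h.symm
    · rw [neg_mul] at h
      exact hA0 (neg_eq_zero.1 h.symm)
  obtain ⟨u, x', hx', rfl⟩ := WfDvdMonoid.max_power_factor hx hπ.irreducible
  obtain ⟨v, y', hy', rfl⟩ := WfDvdMonoid.max_power_factor hy hπ.irreducible
  have h1 : ¬π ∣ x' ^ d := fun h => hx' (hπ.dvd_of_dvd_pow h)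
  have h2 : ¬π ∣ B ^ t * y' ^ d := fun h => by
    rcases hπ.dvd_or_dvd h with h | h
    · exact hB (hπ.dvd_of_dvd_pow h)
    · exact hy' (hπ.dvd_of_dvd_pow h)
  have h3 : u * d = m * t + v * d := by
    rcases h with h | h
    · have h4 : π ^ (u * d) * x' ^ d = π ^ (m * t + v * d) * (B ^ t * y' ^ d) := by
        rw [pow_add, pow_mul, pow_mul, pow_mul, ← mul_pow, h]; ring
      exact le_antisymm (key h1 h2 h4) (key h2 h1 h4.symm)
    · have h4 : π ^ (u * d) * x' ^ d = π ^ (m * t + v * d) * -(B ^ t * y' ^ d) := by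
        rw [pow_add, pow_mul, pow_mul, pow_mul, ← mul_pow, h]; ring
      have h5 : ¬π ∣ -(B ^ t * y' ^ d) := by rwa [dvd_neg]
      exact le_antisymm (key h1 h5 h4) (key h5 h1 h4.symm)
  rw [mul_comm t m, Nat.dvd_add_iff_left (dvd_mul_left d v), ← h3]
  exact dvd_mul_left d u

theorem eq_zero_of_sum_algebraMap_mul_pow_eq_zero {K Ω : Type*} [Field K] [Field Ω] [Algebra K Ω]
    [IsAlgClosed Ω] {d : ℕ} {A : K} (hA : ∀ t (c : K), c ^ d = A ^ t ∨ c ^ d = -A ^ t → d ∣ t)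
    (hd : 0 < d) {z : Ω} (hz : z ^ d = algebraMap K Ω A) {w : Fin d → K}
    (h : ∑ i, algebraMap K Ω (w i) * z ^ (i : ℕ) = 0) : w = 0 := by
  have hP : (∑ i : Fin d, monomial (i : ℕ) (w i)) = 0 := by
    refine eq_zero_of_aeval_root_eq_zero hA hd hz ?_ ?_
    · refine lt_of_le_of_lt (natDegree_sum_le_of_forall_le (n := d - 1) _ _ fun i _ => ?_)
        (by omega)
      exact (natDegree_monomial_le _).trans (by have := i.2; omega)
    · rw [map_sum, ← h]
      simp [aeval_monomial]
  ext i
  have := congrArg (fun p => p.coeff (i : ℕ)) hP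
  simpa [finsetSum_coeff, coeff_monomial, Fin.val_inj] using this

variable {F : Type*} [Field F]

theorem dvd_of_pow_eq_in_fractionRing {ι : Type*} [Fintype ι] {a : ι → F}
    (ha : Function.Injective a) {m : ι → ℕ} {d : ℕ} (hd : 0 < d) {f : F[X]}
    (hf : f = ∏ i, (X - C (a i)) ^ m i) {t : ℕ} {c : FractionRing F[X][X]}
    (hc : c ^ d = algebraMap F[X][X] _ (C f * f.map C ^ (d - 1)) ^ t ∨
      c ^ d = -algebraMap F[X][X] _ (C f * f.map C ^ (d - 1)) ^ t) (i : ι) : d ∣ t * m i := by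
  classical
  set π : F[X][X] := C (X - C (a i)) with hπ
  have hp : Prime π := prime_C_iff.2 (prime_X_sub_C _)
  set B : F[X][X] := C (∏ j ∈ univ.erase i, (X - C (a j)) ^ m j) * f.map C ^ (d - 1) with hB
  have hAB : C f * f.map C ^ (d - 1) = π ^ m i * B := by
    have h1 : f = (X - C (a i)) ^ m i * ∏ j ∈ univ.erase i, (X - C (a j)) ^ m j := by
      rw [hf, Finset.mul_prod_erase univ (fun j => (X - C (a j)) ^ m j) (mem_univ i)]
    rw [hπ, hB, ← mul_assoc, ← C_pow, ← C_mul, ← h1]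
  have hfm : f.Monic := by
    rw [hf]; exact monic_prod_of_monic _ _ fun j _ => (monic_X_sub_C _).pow _
  have hndvd : ¬π ∣ B := by
    intro h
    rcases hp.dvd_or_dvd h with h | h
    · rw [hπ, C_dvd_iff_dvd_coeff] at h
      have h1 := h 0
      rw [coeff_C_zero, (prime_X_sub_C (a i)).dvd_finsetProd_iff] at h1
      obtain ⟨j, hj, h2⟩ := h1
      have h3 := (prime_X_sub_C (a i)).dvd_of_dvd_pow h2
      rw [dvd_iff_isRoot, IsRoot.def, eval_sub, eval_X, eval_C, sub_eq_zero] at h3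
      exact ne_of_mem_erase hj (ha h3).symm
    · have h1 := hp.dvd_of_dvd_pow h
      rw [hπ, C_dvd_iff_dvd_coeff] at h1
      have h2 := h1 f.natDegree
      rw [coeff_map, coeff_natDegree, hfm.leadingCoeff, C_1] at h2
      exact not_isUnit_X_sub_C (a i) (isUnit_of_dvd_one h2)
  obtain ⟨x, y, hy, rfl⟩ := IsFractionRing.div_surjective (A := F[X][X]) c
  have hy0 : y ≠ 0 := nonZeroDivisors.ne_zero hy
  have hy1 : algebraMap F[X][X] (FractionRing F[X][X]) y ≠ 0 := by
    rwa [Ne, FaithfulSMul.algebraMap_eq_zero_iff]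
  refine dvd_of_pow_eq_mul_pow hp hndvd hy0 hd (x := x) ?_
  have hinj := FaithfulSMul.algebraMap_injective F[X][X] (FractionRing F[X][X])
  rw [div_pow, div_eq_iff (pow_ne_zero _ hy1), div_eq_iff (pow_ne_zero _ hy1), hAB] at hc
  refine hc.imp (fun h => hinj ?_) (fun h => hinj ?_)
  · simpa using h
  · simpa using h

theorem eq_zero_of_sum_pow_mul_specPow_eq_zero [Fintype F] {ι : Type*} [Fintype ι] {a : ι → F}
    (ha : Function.Injective a) {m : ι → ℕ} {d : ℕ} (hcop : ∀ t, (∀ i, d ∣ t * m i) → d ∣ t)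
    {f : F[X]} (hf : f = ∏ i, (X - C (a i)) ^ m i) {Q g D : ℕ} (hQ : Fintype.card F = Q)
    (hg : g * d + 1 = Q) {H : ℕ → F[X][X]} (hH : ∀ j < d, (H j).natDegree ≤ D)
    (hD : d * (2 * ((d - 1) * f.natDegree) + D) < Q)
    (h : ∑ j : Fin d, f ^ (g * (j : ℕ)) * specPow F Q (H j) = 0) : ∀ j < d, H j = 0 := by
  rcases Nat.eq_zero_or_pos d with rfl | hd
  · intro j hj; omega
  set A : F[X][X] := C f * f.map C ^ (d - 1) with hAdef
  set H' : ℕ → F[X][X] := fun j => f.map C ^ (d - 1 - j) * H j with hH'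
  have hfm : f.Monic := by
    rw [hf]; exact monic_prod_of_monic _ _ fun j _ => (monic_X_sub_C _).pow _
  have hpowdeg : ∀ k, k ≤ d - 1 → (f.map C ^ k : F[X][X]).natDegree ≤ (d - 1) * f.natDegree :=
    fun k hk => natDegree_pow_le.trans (Nat.mul_le_mul hk natDegree_map_le)
  have hAdeg : A.natDegree ≤ (d - 1) * f.natDegree :=
    (natDegree_C_mul_le _ _).trans (hpowdeg _ le_rfl)
  have hH'deg : ∀ j < d, (H' j).natDegree ≤ (d - 1) * f.natDegree + D := fun j hj =>
    natDegree_mul_le.trans (Nat.add_le_add (hpowdeg _ (by omega)) (hH j hj))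
  set M := twistedCirculant d A H' with hM
  have hz : (f ^ (g + 1)) ^ d = specPow F Q A := by
    rw [hAdef, map_mul, map_pow, specPow_C, specPow_map_C, ← hQ,
      FiniteField.expand_card, ← pow_mul, hQ, ← pow_add]
    congr 1
    obtain ⟨e, rfl⟩ : ∃ e, d = e + 1 := ⟨d - 1, by omega⟩
    rw [← hg]; simp; ring
  have hspec : ∑ j : Fin d, specPow F Q (H' j) * (f ^ (g + 1)) ^ (j : ℕ) = 0 := by
    rw [← mul_zero (f ^ (d - 1)), ← h, Finset.mul_sum]
    refine Finset.sum_congr rfl fun j _ => ?_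
    have hj := j.2
    simp only [hH', map_mul, map_pow, specPow_map_C]
    rw [show d - 1 = (d - 1 - j) + j by omega, ← pow_mul, pow_add]
    rw [show d - 1 - (j : ℕ) + j - j = d - 1 - j by omega]
    ring
  have hdet : M.det = 0 := by
    refine eq_zero_of_specPow_eq_zero (Q := Q) ?_ ?_
    · refine (natDegree_det_twistedCirculant_le hAdeg hH'deg).trans_lt (lt_of_le_of_lt ?_ hD)
      exact Nat.mul_le_mul_left _ (by omega)
    · rw [RingHom.map_det]
      refine Matrix.exists_mulVec_eq_zero_iff.1 ⟨fun j : Fin d => (f ^ (g + 1)) ^ (j : ℕ), ?_, ?_⟩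
      · intro h0
        have := congrFun h0 ⟨0, hd⟩
        simp at this
      · ext1 i
        have := sum_twistedCirculant_mul_pow (specPow F Q) H' hz i
        rw [hspec, mul_zero] at this
        simpa [Matrix.mulVec, dotProduct] using this
  obtain ⟨v, hv0, hv⟩ := Matrix.exists_vecMul_eq_zero_iff.2 hdet
  let K := FractionRing F[X][X]
  let Ω := AlgebraicClosure K
  have hinj : Function.Injective (algebraMap F[X][X] K) := IsFractionRing.injective _ _
  have hA : ∀ t (c : K), c ^ d = algebraMap _ K A ^ t ∨ c ^ d = -algebraMap _ K A ^ t → d ∣ t :=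
    fun t c hc => hcop t (dvd_of_pow_eq_in_fractionRing ha hd hf hc)
  obtain ⟨z, hz'⟩ := IsAlgClosed.exists_pow_nat_eq (algebraMap K Ω (algebraMap _ K A)) hd
  have hprod : (∑ i, algebraMap K Ω (algebraMap _ K (v i)) * z ^ (i : ℕ)) *
      (∑ j : Fin d, algebraMap K Ω (algebraMap _ K (H' j)) * z ^ (j : ℕ)) = 0 := by
    have h1 : ∀ i, _ := sum_twistedCirculant_mul_pow ((algebraMap K Ω).comp (algebraMap _ K)) H'
      (z := z) hz'
    simp only [RingHom.comp_apply] at h1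
    rw [Finset.sum_mul]
    simp_rw [mul_assoc, ← h1, Finset.mul_sum]
    rw [Finset.sum_comm]
    refine Finset.sum_eq_zero fun j _ => ?_
    have h2 := congrFun hv j
    simp only [Matrix.vecMul, dotProduct, Pi.zero_apply] at h2
    simp_rw [← mul_assoc, ← map_mul]
    rw [← Finset.sum_mul, ← map_sum, ← map_sum, h2]
    simp
  rcases mul_eq_zero.1 hprod with h0 | h0
  · have h1 := eq_zero_of_sum_algebraMap_mul_pow_eq_zero hA hd hz' h0
    refine absurd (_root_.funext fun i => hinj ?_) hv0
    simpa using congrFun h1 i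
  · have h1 := eq_zero_of_sum_algebraMap_mul_pow_eq_zero hA hd hz' h0
    intro j hj
    have h2 : H' j = 0 := hinj (by simpa using congrFun h1 ⟨j, hj⟩)
    exact (mul_eq_zero.1 h2).resolve_left (pow_ne_zero _ (hfm.map C).ne_zero)

end Independence

section Stepanov
open Polynomial

variable {F : Type*} [Field F]

/-- The coefficient of `T ^ s` in `P` has degree at most `c + s * m`. -/
def HasWeightLE (m c : ℕ) (P : F[X][X]) : Prop :=
  ∀ s, (P.coeff s).natDegree ≤ c + s * m

theorem HasWeightLE.mul {m c c' : ℕ} {P P' : F[X][X]} (h : HasWeightLE m c P)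
    (h' : HasWeightLE m c' P') : HasWeightLE m (c + c') (P * P') := by
  intro s
  rw [coeff_mul]
  refine natDegree_sum_le_of_forall_le _ _ fun a ha => natDegree_mul_le.trans ?_
  rw [HasAntidiagonal.mem_antidiagonal] at ha
  rw [← ha, add_mul]
  have := h a.1
  have := h' a.2
  omega

theorem hasWeightLE_one (m : ℕ) : HasWeightLE m 0 (1 : F[X][X]) := by
  intro s
  rw [coeff_one]
  split_ifs <;> simp

theorem HasWeightLE.pow {m c : ℕ} {P : F[X][X]} (h : HasWeightLE m c P) (n : ℕ) :
    HasWeightLE m (n * c) (P ^ n) := by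
  induction n with
  | zero => simpa using hasWeightLE_one m
  | succ n ih =>
    rw [pow_succ, add_mul, one_mul]
    exact ih.mul h

theorem HasWeightLE.mono {m c c' : ℕ} {P : F[X][X]} (h : HasWeightLE m c P) (hc : c ≤ c') :
    HasWeightLE m c' P := fun s => (h s).trans (by omega)

/-- The substitution `p(X) ↦ p(X + f(X) T)`, with values in `F[X][T]`. -/
noncomputable def shiftAlong (f : F[X]) : F[X] →ₐ[F] F[X][X] :=
  aeval (C X + C f * X)

theorem hasWeightLE_shiftAlong (f p : F[X]) :
    HasWeightLE f.natDegree p.natDegree (shiftAlong f p) := by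
  have h1 : HasWeightLE f.natDegree 1 (C X + C f * X : F[X][X]) := by
    intro s
    rw [coeff_add, coeff_C, coeff_C_mul, coeff_X]
    rcases s with _ | _ | s
    · simp
    · simp
    · simp
  intro s
  rw [shiftAlong, aeval_eq_sum_range, finsetSum_coeff]
  refine natDegree_sum_le_of_forall_le _ _ fun i hi => ?_
  rw [mem_range] at hi
  rw [coeff_smul]
  exact (natDegree_smul_le _ _).trans (((h1.pow i) s).trans (by omega))

theorem exists_shiftAlong_self_eq {f : F[X]} (hf : f ≠ 0) :
    ∃ U : F[X][X], shiftAlong f f = C f * U ∧ HasWeightLE f.natDegree 0 U := by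
  have h1 : (C X + C f * X) - C X ∣ (f.map (C.comp C : F →+* F[X][X])).eval (C X + C f * X) -
      (f.map (C.comp C : F →+* F[X][X])).eval (C X) := sub_dvd_eval_sub _ _ _
  have h2 : (f.map (C.comp C : F →+* F[X][X])).eval (C X + C f * X) = shiftAlong f f := by
    rw [eval_map, shiftAlong, aeval_def]; rfl
  have h3 : (f.map (C.comp C : F →+* F[X][X])).eval (C X) = C f := by
    rw [← Polynomial.map_map, eval_map_apply, eval_map, eval₂_C_X]
  rw [h2, h3, add_sub_cancel_left] at h1
  obtain ⟨v, hv⟩ := h1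
  refine ⟨1 + X * v, by linear_combination hv, fun s => ?_⟩
  have h4 := hasWeightLE_shiftAlong f f s
  rw [show shiftAlong f f = C f * (1 + X * v) by linear_combination hv, coeff_C_mul] at h4
  rcases eq_or_ne ((1 + X * v : F[X][X]).coeff s) 0 with h0 | h0
  · rw [h0]; simp
  · rw [natDegree_mul hf h0] at h4
    omega

theorem map_evalRingHom_shiftAlong (f p : F[X]) (x : F) :
    (shiftAlong f p).map (evalRingHom x) = p.comp (C x + C (f.eval x) * X) := by
  have : (mapRingHom (evalRingHom x)).comp (shiftAlong f : F[X] →+* F[X][X]) =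
      (compRingHom (C x + C (f.eval x) * X)) := by
    ext a
    · simp [shiftAlong, Polynomial.algebraMap_apply]
    · simp [shiftAlong]
  exact RingHom.congr_fun this p

/-- The conditions for `∑ r j k * f ^ (j * g) * X ^ (k * Q)` to vanish to order more than `s`
where `f ^ g = ζ`. -/
noncomputable def vanishingForm (f : F[X]) (U : F[X][X]) (ζ : F) (g d B s : ℕ) :
    (Fin d × Fin B → F[X]) →ₗ[F] F[X] where
  toFun r := ∑ jk, C (ζ ^ (jk.1 : ℕ)) * X ^ (jk.2 : ℕ) *
    (shiftAlong f (r jk) * U ^ (g * (jk.1 : ℕ))).coeff s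
  map_add' r r' := by
    rw [← Finset.sum_add_distrib]
    refine Finset.sum_congr rfl fun jk _ => ?_
    rw [Pi.add_apply, map_add, add_mul, coeff_add, mul_add]
  map_smul' c r := by
    rw [RingHom.id_apply, Finset.smul_sum]
    refine Finset.sum_congr rfl fun jk _ => ?_
    rw [Pi.smul_apply, map_smul, smul_mul_assoc, coeff_smul, mul_smul_comm]

theorem vanishingForm_mem_degreeLT {f : F[X]} {U : F[X][X]} (hU : HasWeightLE f.natDegree 0 U)
    (ζ : F) (g : ℕ) {d B D M s : ℕ} (hs : s < M) {r : Fin d × Fin B → F[X]}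
    (hr : ∀ jk, r jk ∈ degreeLT F D) :
    vanishingForm f U ζ g d B s r ∈ degreeLT F (D + M * f.natDegree + B) := by
  refine Submodule.sum_mem _ fun jk _ => ?_
  have hk := jk.2.2
  have h1 : (r jk).natDegree ≤ D := natDegree_le_of_degree_le (mem_degreeLT.1 (hr jk)).le
  have h2 := (((hasWeightLE_shiftAlong f (r jk)).mono h1).mul (hU.pow (g * (jk.1 : ℕ)))) s
  rw [mul_zero, add_zero] at h2
  have h3 : s * f.natDegree ≤ M * f.natDegree := Nat.mul_le_mul_right _ hs.le
  rw [mem_degreeLT]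
  refine degree_le_natDegree.trans_lt ?_
  rw [Nat.cast_lt, mul_assoc]
  refine (natDegree_C_mul_le _ _).trans_lt (natDegree_mul_le.trans_lt ?_)
  rw [natDegree_X_pow]
  omega

theorem finrank_degreeLT (n : ℕ) : Module.finrank F (degreeLT F n) = n := by
  rw [(degreeLTEquiv F n).finrank_eq, Module.finrank_fin_fun]

theorem exists_vanishingForm_eq_zero {f : F[X]} {U : F[X][X]} (hU : HasWeightLE f.natDegree 0 U)
    (ζ : F) (g : ℕ) {d B D M : ℕ} (hdim : M * (D + M * f.natDegree + B) < d * B * D) :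
    ∃ r : Fin d × Fin B → F[X], r ≠ 0 ∧ (∀ jk, (r jk).natDegree ≤ D) ∧
      ∀ s < M, vanishingForm f U ζ g d B s r = 0 := by
  have hfin : ∀ n, Module.Finite F (degreeLT F n) := fun n =>
    Module.Finite.equiv (degreeLTEquiv F n).symm
  let i : (Fin d × Fin B → degreeLT F D) →ₗ[F] (Fin d × Fin B → F[X]) :=
    LinearMap.pi fun jk => (degreeLT F D).subtype ∘ₗ LinearMap.proj jk
  have hi : ∀ r jk, i r jk = (r jk : F[X]) := fun _ _ => rfl
  let T : (Fin d × Fin B → degreeLT F D) →ₗ[F]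
      (Fin M → degreeLT F (D + M * f.natDegree + B)) :=
    LinearMap.pi fun s => LinearMap.codRestrict _ (vanishingForm f U ζ g d B s ∘ₗ i)
      fun r => vanishingForm_mem_degreeLT hU ζ g s.2 fun jk => (r jk).2
  have hker : LinearMap.ker T ≠ ⊥ := by
    refine LinearMap.ker_ne_bot_of_finrank_lt ?_
    simpa [Module.finrank_pi_fintype, finrank_degreeLT] using hdim
  obtain ⟨r, hr, hr0⟩ := Submodule.exists_mem_ne_zero_of_ne_bot hker
  refine ⟨i r, fun h => hr0 ?_, fun jk => ?_, fun s hs => ?_⟩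
  · ext1 jk
    exact Subtype.ext (congrFun h jk)
  · exact natDegree_le_of_degree_le (mem_degreeLT.1 (r jk).2).le
  · exact congrArg Subtype.val (congrFun (LinearMap.mem_ker.1 hr) ⟨s, hs⟩)

theorem pow_X_sub_C_dvd_of_vanishingForm_eq_zero [Fintype F] {Q : ℕ} (hQ : Fintype.card F = Q)
    {f : F[X]} {U : F[X][X]} (hU : shiftAlong f f = C f * U) {ζ : F} {g d B M : ℕ} (hM : M ≤ Q)
    {r : Fin d × Fin B → F[X]} (hr : ∀ s < M, vanishingForm f U ζ g d B s r = 0) {x : F}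
    (hx0 : f.eval x ≠ 0) (hx : f.eval x ^ g = ζ) :
    (X - C x) ^ M ∣ ∑ jk, r jk * f ^ (g * (jk.1 : ℕ)) * X ^ (Q * (jk.2 : ℕ)) := by
  set c := f.eval x with hc
  set L : F[X] := C x + C c * X with hL
  set P : F[X] := ∑ jk, r jk * f ^ (g * (jk.1 : ℕ)) * X ^ (Q * (jk.2 : ℕ)) with hP
  have hLQ : L ^ Q = C x + C c * X ^ Q := by
    rw [← hQ, ← FiniteField.expand_card, hL]; simp
  have hfL : f.comp L = C c * U.map (evalRingHom x) := by
    rw [hL, hc, ← map_evalRingHom_shiftAlong, hU]; simp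
  have hdvd : X ^ M ∣ P.comp L := by
    rw [X_pow_dvd_iff]
    intro s hs
    have h1 : ∀ jk : Fin d × Fin B,
        ((r jk * f ^ (g * (jk.1 : ℕ)) * X ^ (Q * (jk.2 : ℕ))).comp L).coeff s =
        eval x (C (ζ ^ (jk.1 : ℕ)) * X ^ (jk.2 : ℕ) *
          (shiftAlong f (r jk) * U ^ (g * (jk.1 : ℕ))).coeff s) := fun jk => by
      set G := shiftAlong f (r jk) * U ^ (g * (jk.1 : ℕ)) with hG
      have h2 : (r jk * f ^ (g * (jk.1 : ℕ)) * X ^ (Q * (jk.2 : ℕ))).comp L =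
          C (ζ ^ (jk.1 : ℕ)) * (G.map (evalRingHom x) * (C x + C c * X ^ Q) ^ (jk.2 : ℕ)) := by
        rw [mul_comp, mul_comp, pow_comp, pow_comp, X_comp, hfL, pow_mul, pow_mul L, hLQ, hG,
          Polynomial.map_mul, map_evalRingHom_shiftAlong, Polynomial.map_pow, ← hx, mul_pow,
          mul_pow, pow_mul (U.map _), C_pow, C_pow]
        ring
      have h3 : X ^ Q ∣ (C x + C c * X ^ Q) ^ (jk.2 : ℕ) - C x ^ (jk.2 : ℕ) :=
        dvd_trans (Dvd.intro_left (C c) (by ring)) (sub_dvd_pow_sub_pow _ _ _)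
      obtain ⟨w, hw⟩ := h3
      have h4 : G.map (evalRingHom x) * (C x + C c * X ^ Q) ^ (jk.2 : ℕ) =
          G.map (evalRingHom x) * C (x ^ (jk.2 : ℕ)) + X ^ Q * (G.map (evalRingHom x) * w) := by
        rw [C_pow]; linear_combination (G.map (evalRingHom x)) * hw
      rw [h2, coeff_C_mul, h4, coeff_add, coeff_X_pow_mul', if_neg (by omega), coeff_mul_C,
        coeff_map]
      simp only [coe_evalRingHom, eval_mul, eval_C, eval_pow, eval_X]
      ring
    rw [hP, Polynomial.sum_comp, finsetSum_coeff, Finset.sum_congr rfl fun jk _ => h1 jk,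
      ← eval_finsetSum]
    have h2 := hr s hs
    rw [vanishingForm, LinearMap.coe_mk, AddHom.coe_mk] at h2
    rw [h2, eval_zero]
  obtain ⟨w, hw⟩ := hdvd
  have h5 := congrArg (fun p => p.comp (C c⁻¹ * (X - C x))) hw
  simp only [comp_assoc] at h5
  have h6 : L.comp (C c⁻¹ * (X - C x)) = X := by
    simp only [hL, add_comp, C_comp, mul_comp, X_comp]
    rw [← mul_assoc, ← C_mul, mul_inv_cancel₀ hx0]; simp
  rw [h6, comp_X, mul_comp, pow_comp, X_comp, mul_pow] at h5
  rw [h5]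
  exact (dvd_mul_left _ _).mul_right _

theorem card_mul_le_of_stepanov [Fintype F] {ι : Type*} [Fintype ι] {a : ι → F}
    (ha : Function.Injective a) {m : ι → ℕ} {d : ℕ} (hcop : ∀ t, (∀ i, d ∣ t * m i) → d ∣ t)
    {f : F[X]} (hf : f = ∏ i, (X - C (a i)) ^ m i) {Q g : ℕ} (hQ : Fintype.card F = Q)
    (hg : g * d + 1 = Q) (hf1 : 1 ≤ f.natDegree) {D B M : ℕ} (hM : M ≤ Q)
    (hD : 2 * ((d - 1) * f.natDegree) + D ≤ g)
    (hdim : M * (D + M * f.natDegree + B) < d * B * D) {ζ : F} {s : Finset F}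
    (hs : ∀ x ∈ s, f.eval x ≠ 0 ∧ f.eval x ^ g = ζ) :
    #s * M ≤ Q * (f.natDegree + B) := by
  have hf0 : f ≠ 0 := by rintro rfl; simp at hf1
  obtain ⟨U, hU, hUw⟩ := exists_shiftAlong_self_eq hf0
  obtain ⟨r, hr0, hrD, hr⟩ := exists_vanishingForm_eq_zero hUw ζ g hdim
  set P : F[X] := ∑ jk, r jk * f ^ (g * (jk.1 : ℕ)) * X ^ (Q * (jk.2 : ℕ)) with hP
  have hP0 : P ≠ 0 := by
    intro h0
    let H : ℕ → F[X][X] := fun j => if hj : j < d then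
      ∑ k : Fin B, (r (⟨j, hj⟩, k)).map C * C (X ^ (k : ℕ)) else 0
    have hH : ∀ j : Fin d, H j = ∑ k : Fin B, (r (j, k)).map C * C (X ^ (k : ℕ)) := fun j =>
      dif_pos j.2
    have hHdeg : ∀ j < d, (H j).natDegree ≤ D := fun j hj => by
      rw [hH ⟨j, hj⟩]
      refine natDegree_sum_le_of_forall_le _ _ fun k _ => ?_
      exact (natDegree_mul_C_le _ _).trans (natDegree_map_le.trans (hrD _))
    have hsum : ∑ j : Fin d, f ^ (g * (j : ℕ)) * specPow F Q (H j) = 0 := by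
      rw [← h0, hP, Fintype.sum_prod_type]
      refine Finset.sum_congr rfl fun j _ => ?_
      rw [hH, map_sum, Finset.mul_sum]
      refine Finset.sum_congr rfl fun k _ => ?_
      rw [map_mul, specPow_map_C, specPow_C, map_pow, expand_X, ← pow_mul]
      ring
    have h1 := eq_zero_of_sum_pow_mul_specPow_eq_zero ha hcop hf hQ hg hHdeg (by
      have := Nat.mul_le_mul_left d hD
      rw [mul_comm d g] at this
      omega) hsum
    apply hr0
    ext ⟨j, k⟩ i
    have h2 := congrArg (fun p => (p.coeff i).coeff (k : ℕ)) (h1 j j.2)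
    simp only [hH, finsetSum_coeff, coeff_mul_C, coeff_map, coeff_zero, coeff_C_mul_X_pow] at h2
    simpa [Fin.val_inj] using h2
  have hdvd : ∏ x ∈ s, (X - C x) ^ M ∣ P := by
    refine Finset.prod_dvd_of_coprime ?_ fun x hx =>
      pow_X_sub_C_dvd_of_vanishingForm_eq_zero hQ hU hM hr (hs x hx).1 (hs x hx).2
    intro x _ y _ hxy
    exact (isCoprime_X_sub_C_of_isUnit_sub (sub_ne_zero.2 hxy).isUnit).pow
  have hdeg := natDegree_le_of_dvd hdvd hP0
  rw [natDegree_prod_of_monic _ _ fun x _ => (monic_X_sub_C x).pow M] at hdeg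
  simp only [natDegree_pow, natDegree_X_sub_C, mul_one, Finset.sum_const, smul_eq_mul] at hdeg
  refine hdeg.trans (natDegree_sum_le_of_forall_le _ _ fun jk _ => ?_)
  refine natDegree_mul_le.trans ?_
  rw [natDegree_X_pow, mul_add]
  refine Nat.add_le_add (natDegree_mul_le.trans ?_) (Nat.mul_le_mul_left _ jk.2.2.le)
  rw [natDegree_pow]
  have hj := jk.1.2
  have h1 := hrD jk
  have h2 : g * (jk.1 : ℕ) + g ≤ Q := by
    have : g * ((jk.1 : ℕ) + 1) ≤ g * d := Nat.mul_le_mul_left _ hj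
    rw [mul_add, mul_one] at this
    omega
  have h3 : (g * (jk.1 : ℕ) + g) * f.natDegree ≤ Q * f.natDegree := Nat.mul_le_mul_right _ h2
  have h4 : g ≤ g * f.natDegree := Nat.le_mul_of_pos_right _ hf1
  rw [add_mul] at h3
  omega

theorem mul_card_le_of_stepanov {F : Type*} [Field F] [Fintype F] {ι : Type*} [Fintype ι]
    {a : ι → F} (ha : Function.Injective a) {m : ι → ℕ} {d : ℕ}
    (hcop : ∀ t, (∀ i, d ∣ t * m i) → d ∣ t)
    {f : F[X]} (hf : f = ∏ i, (X - C (a i)) ^ m i) {q g : ℕ} (hQ : Fintype.card F = q ^ 2)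
    (hg : g * d + 1 = q ^ 2) (hf1 : 1 ≤ f.natDegree) (hd : d ∣ q - 1)
    (hq : 4 + 4 * d ^ 2 * f.natDegree ≤ q) {ζ : F} {s : Finset F}
    (hs : ∀ x ∈ s, f.eval x ≠ 0 ∧ f.eval x ^ g = ζ) :
    d * #s ≤ q ^ 2 + 6 * d * (f.natDegree + 1) * q := by
  set m' := f.natDegree with hm'
  obtain ⟨M', hM'⟩ := hd
  obtain ⟨M, rfl⟩ : ∃ M, q = M + 1 := ⟨q - 1, by omega⟩
  rw [Nat.add_sub_cancel] at hM'
  have hd0 : 0 < d := Nat.pos_of_ne_zero (by rintro rfl; simp at hM'; omega)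
  have hgd : 2 * d * m' ≤ g := by
    refine Nat.le_of_mul_le_mul_right (c := d) ?_ hd0
    nlinarith
  obtain ⟨D, rfl⟩ := Nat.exists_eq_add_of_le hgd
  have key := card_mul_le_of_stepanov ha hcop hf hQ hg hf1 (D := D) (B := M' + 2 * m' + 3)
    (M := M) (by nlinarith) ?_ ?_ hs
  · rw [← hm'] at key
    refine Nat.le_of_mul_le_mul_left (c := M) ?_ (by omega)
    have h1 : d * (#s * M) ≤ d * ((M + 1) ^ 2 * (m' + (M' + 2 * m' + 3))) :=
      Nat.mul_le_mul_left _ key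
    have h2 : d * ((M + 1) ^ 2 * (m' + (M' + 2 * m' + 3))) =
        M * (M + 1) ^ 2 + 3 * d * (m' + 1) * (M + 1) * (M + 1) := by
      rw [hM']; ring
    have h3 : 3 * d * (m' + 1) * (M + 1) * (M + 1) ≤ 3 * d * (m' + 1) * (M + 1) * (2 * M) :=
      Nat.mul_le_mul_left _ (by omega)
    linarith
  · rw [← hm']
    obtain ⟨e, rfl⟩ : ∃ e, d = e + 1 := ⟨d - 1, by omega⟩
    rw [Nat.add_sub_cancel]
    nlinarith
  · rw [← hm']
    have h0 : d * D + 2 * d ^ 2 * m' + 1 = (M + 1) ^ 2 := by rw [← hg]; ring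
    have h1 : d * (M' + 2 * m' + 3) * D = M * D + (2 * m' + 3) * (d * D) := by
      rw [hM']; ring
    have h2 : M' ≤ M := by rw [hM']; exact Nat.le_mul_of_pos_left _ hd0
    have h3 : M * (M * m' + (M' + 2 * m' + 3)) ≤ M * (M * m' + (M + 2 * m' + 3)) :=
      Nat.mul_le_mul_left _ (by omega)
    have h4 : 2 * (M + 2 * d ^ 2 * m' + 1) ≤ (M + 1) ^ 2 := by nlinarith
    have h5 : (2 * m' + 3) * (2 * (M + 2 * d ^ 2 * m' + 1)) ≤ (2 * m' + 3) * (M + 1) ^ 2 :=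
      Nat.mul_le_mul_left _ h4
    have h6 : (2 * m' + 3) * (d * D + 2 * d ^ 2 * m' + 1) = (2 * m' + 3) * (M + 1) ^ 2 := by
      rw [h0]
    rw [h1]
    nlinarith

end Stepanov

section Weil
open Polynomial

theorem exists_eq_pow_of_isCyclic {G : Type*} [CommGroup G] [Finite G] [IsCyclic G] {ι : Type*}
    (χ : ι → G) : ∃ (ψ : G) (m : ι → ℕ), (∀ i, 1 ≤ m i ∧ χ i = ψ ^ m i) ∧
      ∀ t, (∀ i, orderOf ψ ∣ t * m i) → orderOf ψ ∣ t := by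
  obtain ⟨⟨ψ, hψ⟩, hgen⟩ := IsCyclic.exists_generator (α := Subgroup.closure (Set.range χ))
  have h : ∀ i, ∃ k, 1 ≤ k ∧ χ i = ψ ^ k := fun i => by
    have h1 := hgen ⟨χ i, Subgroup.subset_closure ⟨i, rfl⟩⟩
    rw [← mem_powers_iff_mem_zpowers, Submonoid.mem_powers_iff] at h1
    obtain ⟨k, hk⟩ := h1
    have hk' : ψ ^ k = χ i := congrArg Subtype.val hk
    exact ⟨k + orderOf ψ, by have := orderOf_pos ψ; omega, by
      rw [pow_add, pow_orderOf_eq_one, mul_one, hk']⟩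
  choose m hm using h
  refine ⟨ψ, m, hm, fun t ht => orderOf_dvd_of_pow_eq_one ?_⟩
  have hle : Subgroup.closure (Set.range χ) ≤ (powMonoidHom t : G →* G).ker := by
    rw [Subgroup.closure_le]
    rintro _ ⟨i, rfl⟩
    rw [SetLike.mem_coe, MonoidHom.mem_ker, powMonoidHom_apply, (hm i).2, ← pow_mul, mul_comm]
    exact orderOf_dvd_iff_pow_eq_one.1 (ht i)
  exact MonoidHom.mem_ker.1 (hle hψ)

variable {F : Type*} [Field F] [Fintype F]

theorem isCyclic_mulChar : IsCyclic (MulChar F ℂ) :=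
  let ⟨e⟩ := MulChar.mulEquiv_units F ℂ
  isCyclic_of_injective e.toMonoidHom e.injective

theorem pow_eq_one_of_mulChar_apply_eq_one (χ : MulChar F ℂ) {u : F} (h : χ u = 1) :
    u ^ ((Fintype.card F - 1) / orderOf χ) = 1 := by
  classical
  have hu : u ≠ 0 := by
    intro h0
    rw [h0, MulChar.map_zero] at h
    exact zero_ne_one h
  obtain ⟨χ₀, hχ₀⟩ := (isCyclic_mulChar (F := F)).exists_generator
  have hord : orderOf χ₀ = Fintype.card F - 1 := by
    rw [orderOf_eq_card_of_forall_mem_zpowers hχ₀,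
      MulChar.card_eq_card_units_of_hasEnoughRootsOfUnity, Nat.card_eq_fintype_card,
      Fintype.card_units]
  have hq : 0 < Fintype.card F - 1 := by have := Fintype.one_lt_card (α := F); omega
  obtain ⟨k, hk⟩ : ∃ k, χ₀ ^ k = χ := by
    have := hχ₀ χ
    rwa [← mem_powers_iff_mem_zpowers, Submonoid.mem_powers_iff] at this
  have hinj : ∀ w : F, w ≠ 0 → χ₀ w = 1 → w = 1 := fun w hw hw1 => by
    by_contra hne
    obtain ⟨φ, hφ⟩ := MulChar.exists_apply_ne_one_of_hasEnoughRootsOfUnity F ℂ hne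
    have := hχ₀ φ
    rw [← mem_powers_iff_mem_zpowers, Submonoid.mem_powers_iff] at this
    obtain ⟨j, rfl⟩ := this
    apply hφ
    rw [← Units.val_mk0 hw, MulChar.pow_apply_coe, Units.val_mk0, hw1, one_pow]
  have h1 : u ^ k = 1 := by
    refine hinj _ (pow_ne_zero _ hu) ?_
    rw [map_pow, ← h, ← hk, ← Units.val_mk0 hu, MulChar.pow_apply_coe]
  have h2 : u ^ (Fintype.card F - 1) = 1 := FiniteField.pow_card_sub_one_eq_one u hu
  rw [← hk, orderOf_pow, hord, Nat.div_div_self (Nat.gcd_dvd_left _ _) hq.ne']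
  exact pow_gcd_eq_one.2 ⟨h2, h1⟩

theorem pow_eq_pow_of_mulChar_norm_eq {K : Type*} [Field K] [Fintype K] [Algebra F K]
    (χ : MulChar F ℂ) {x y : K} (hy : y ≠ 0)
    (h : χ (Algebra.norm F x) = χ (Algebra.norm F y)) :
    x ^ ((Fintype.card K - 1) / orderOf χ) = y ^ ((Fintype.card K - 1) / orderOf χ) := by
  have hny : Algebra.norm F y ≠ 0 := Algebra.norm_ne_zero_iff.2 hy
  have h1 : χ (Algebra.norm F (x / y)) = 1 := by
    have h2 : χ (Algebra.norm F (x / y)) * χ (Algebra.norm F y) = χ (Algebra.norm F y) := by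
      rw [← map_mul, ← map_mul, div_mul_cancel₀ _ hy, h]
    refine mul_right_cancel₀ (b := χ (Algebra.norm F y)) (fun h0 => ?_) (by rw [h2, one_mul])
    exact (hny.isUnit.map χ).ne_zero h0
  have h3 := congrArg (algebraMap F K) (pow_eq_one_of_mulChar_apply_eq_one χ h1)
  rw [map_pow, map_one, FiniteField.algebraMap_norm_eq_pow, ← pow_mul, Nat.card_eq_fintype_card,
    Nat.card_eq_fintype_card] at h3
  have h4 : Fintype.card F - 1 ∣ Fintype.card K - 1 := by
    rw [Module.card_eq_pow_finrank (K := F) (V := K)]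
    exact Nat.sub_one_dvd_pow_sub_one _ _
  have h5 := χ.orderOf_dvd_card_sub_one
  rw [Nat.div_mul_div_comm h4 h5, mul_comm (Fintype.card F - 1), Nat.mul_div_mul_right _ _
    (by have := Fintype.one_lt_card (α := F); omega), div_pow, div_eq_one_iff_eq
    (pow_ne_zero _ hy)] at h3
  exact h3

theorem norm_sum_le_of_card_fiber_le {α : Type*} (s : Finset α) (φ : α → ℂ) (V : Finset ℂ)
    (hV : ∑ v ∈ V, v = 0) (hnorm : ∀ v ∈ V, ‖v‖ ≤ 1) (hmaps : ∀ x ∈ s, φ x ∈ V) {B : ℝ}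
    (hB : ∀ v ∈ V, (#{x ∈ s | φ x = v} : ℝ) ≤ B) : ‖∑ x ∈ s, φ x‖ ≤ #V * B - #s := by
  have h1 : ∑ x ∈ s, φ x = -∑ v ∈ V, ((B - #{x ∈ s | φ x = v} : ℝ) : ℂ) * v := by
    have h2 : ∑ x ∈ s, φ x = ∑ v ∈ V, (#{x ∈ s | φ x = v} : ℂ) * v := by
      rw [← Finset.sum_fiberwise_of_maps_to hmaps]
      refine Finset.sum_congr rfl fun v _ => ?_
      rw [Finset.sum_congr rfl (g := fun _ => v) (fun x hx => (mem_filter.1 hx).2),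
        Finset.sum_const, nsmul_eq_mul]
    rw [h2, eq_neg_iff_add_eq_zero, ← Finset.sum_add_distrib, ← mul_zero (B : ℂ), ← hV,
      Finset.mul_sum]
    refine Finset.sum_congr rfl fun v _ => ?_
    push_cast
    ring
  rw [h1, norm_neg]
  refine (norm_sum_le _ _).trans ?_
  have h3 : ∀ v ∈ V, ‖((B - #{x ∈ s | φ x = v} : ℝ) : ℂ) * v‖ ≤ B - #{x ∈ s | φ x = v} := by
    intro v hv
    rw [norm_mul, Complex.norm_real, Real.norm_eq_abs, abs_of_nonneg (sub_nonneg.2 (hB v hv))]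
    exact mul_le_of_le_one_right (sub_nonneg.2 (hB v hv)) (hnorm v hv)
  refine (Finset.sum_le_sum h3).trans (le_of_eq ?_)
  rw [Finset.sum_sub_distrib, Finset.sum_const, nsmul_eq_mul, ← Nat.cast_sum,
    ← Finset.card_eq_sum_card_fiberwise hmaps]

theorem norm_sum_mulChar_norm_le {K : Type*} [Field K] [Fintype K] [Algebra F K] {ι : Type*}
    [Fintype ι] [Nonempty ι] {a : ι → F} (ha : Function.Injective a) {ψ : MulChar F ℂ}
    (hψ : ψ ≠ 1) {m : ι → ℕ} (hm : ∀ i, 1 ≤ m i)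
    (hcop : ∀ t, (∀ i, orderOf ψ ∣ t * m i) → orderOf ψ ∣ t) {q : ℕ}
    (hK : Fintype.card K = q ^ 2) (hd : orderOf ψ ∣ q - 1)
    (hq : 4 + 4 * orderOf ψ ^ 2 * ∑ i, m i ≤ q) :
    ‖∑ x : K, ψ (Algebra.norm F (∏ i, (algebraMap F K (a i) - x) ^ m i))‖ ≤
      (6 * orderOf ψ * (∑ i, m i + 1) + Fintype.card ι : ℕ) * q := by
  classical
  set d := orderOf ψ with hddef
  have hd1 : 1 < d := by
    have h0 : d ≠ 0 := ψ.orderOf_pos.ne'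
    have h1 : d ≠ 1 := fun h => hψ (orderOf_eq_one_iff.1 h)
    omega
  set N := ∑ i, m i with hN
  set b : ι → K := fun i => algebraMap F K (a i) with hb
  have hbinj : Function.Injective b := (algebraMap F K).injective.comp ha
  set f : K[X] := ∏ i, (X - C (b i)) ^ m i with hf
  have hfdeg : f.natDegree = N := by
    rw [hf, natDegree_prod_of_monic _ _ fun i _ => (monic_X_sub_C _).pow _]
    simp [hN]
  have hN1 : 1 ≤ N := by
    obtain ⟨i⟩ := ‹Nonempty ι›
    exact (hm i).trans (Finset.single_le_sum (fun _ _ => Nat.zero_le _) (mem_univ i))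
  have hfx : ∀ x, ∏ i, (b i - x) ^ m i = (-1) ^ N * f.eval x := fun x => by
    rw [hf, eval_prod, hN, ← Finset.prod_pow_eq_pow_sum, ← Finset.prod_mul_distrib]
    refine Finset.prod_congr rfl fun i _ => ?_
    rw [eval_pow, ← mul_pow]
    simp
  have hneg : ((-1) ^ N : K) ≠ 0 := pow_ne_zero _ (neg_ne_zero.2 one_ne_zero)
  set φ : K → ℂ := fun x => ψ (Algebra.norm F (∏ i, (b i - x) ^ m i)) with hφ
  set s : Finset K := {x | f.eval x ≠ 0} with hs
  have hnorm0 : ∀ x, f.eval x ≠ 0 → Algebra.norm F (∏ i, (b i - x) ^ m i) ≠ 0 := fun x hx => by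
    rw [hfx, Algebra.norm_ne_zero_iff]
    exact mul_ne_zero hneg hx
  have hsum : ∑ x, φ x = ∑ x ∈ s, φ x := by
    symm
    refine Finset.sum_subset (subset_univ _) fun x _ hx => ?_
    have : f.eval x = 0 := by simpa [hs] using hx
    simp only [hφ, hfx, this, mul_zero, Algebra.norm_zero, MulChar.map_zero]
  have hcard : q ^ 2 ≤ #s + Fintype.card ι := by
    rw [← hK, ← Finset.card_univ, ← Finset.card_filter_add_card_filter_not
      (s := univ) (p := fun x => f.eval x ≠ 0)]
    refine Nat.add_le_add_left ?_ _
    rw [← Finset.card_univ (α := ι)]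
    refine (Finset.card_le_card (t := univ.image b) fun x hx => ?_).trans card_image_le
    have h0 : f.eval x = 0 := by simpa using hx
    rw [hf, eval_prod, Finset.prod_eq_zero_iff] at h0
    obtain ⟨i, _, hi⟩ := h0
    rw [eval_pow, eval_sub, eval_X, eval_C] at hi
    exact mem_image.2 ⟨i, mem_univ i, (sub_eq_zero.1 (pow_eq_zero_iff (by
      have := hm i; omega) |>.1 hi)).symm⟩
  have hμ := Complex.isPrimitiveRoot_exp d (by omega)
  set μ := Complex.exp (2 * Real.pi * Complex.I / d) with hμdef
  have hinj : Set.InjOn (fun k => μ ^ k) ((range d : Finset ℕ) : Set ℕ) := hμ.injOn_pow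
  set V := (range d).image fun k => μ ^ k with hVdef
  have hVcard : #V = d := by rw [hVdef, card_image_of_injOn hinj, card_range]
  have hVsum : ∑ v ∈ V, v = 0 := by
    rw [hVdef, sum_image hinj]; exact hμ.geom_sum_eq_zero hd1
  have hVnorm : ∀ v ∈ V, ‖v‖ ≤ 1 := fun v hv => by
    obtain ⟨k, _, rfl⟩ := mem_image.1 hv
    simp [hμ.norm'_eq_one (by omega)]
  have hmaps : ∀ x ∈ s, φ x ∈ V := fun x hx => by
    have : NeZero d := ⟨by omega⟩
    obtain ⟨k, hk, hk'⟩ := MulChar.exists_apply_eq_pow (pow_orderOf_eq_one ψ) hμ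
      (hnorm0 x (by simpa [hs] using hx))
    exact mem_image.2 ⟨k, mem_range.2 hk, hk'.symm⟩
  have hdR : (0 : ℝ) < d := by exact_mod_cast (by omega : 0 < d)
  have hfib : ∀ v ∈ V, (#{x ∈ s | φ x = v} : ℝ) ≤
      ((q ^ 2 + 6 * d * (N + 1) * q : ℕ) : ℝ) / d := fun v _ => by
    rcases Finset.eq_empty_or_nonempty {x ∈ s | φ x = v} with h | ⟨y, hy⟩
    · rw [h]; simp only [card_empty, Nat.cast_zero]; positivity
    · rw [le_div_iff₀' hdR, ← Nat.cast_mul, Nat.cast_le]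
      rw [mem_filter] at hy
      have hy0 : f.eval y ≠ 0 := by simpa [hs] using hy.1
      have hdK : d ∣ q ^ 2 - 1 := hd.trans (Nat.sub_one_dvd_pow_sub_one _ _)
      have hg : (Fintype.card K - 1) / d * d + 1 = q ^ 2 := by
        have := Nat.one_le_pow 2 q (by omega)
        rw [hK, Nat.div_mul_cancel hdK]; omega
      rw [← hfdeg]
      refine mul_card_le_of_stepanov hbinj hcop hf hK hg (by omega) hd (by rwa [hfdeg])
        (ζ := f.eval y ^ ((Fintype.card K - 1) / d)) fun x hx => ?_
      rw [mem_filter] at hx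
      refine ⟨by simpa [hs] using hx.1, ?_⟩
      have h1 := pow_eq_pow_of_mulChar_norm_eq ψ (x := ∏ i, (b i - x) ^ m i)
        (y := ∏ i, (b i - y) ^ m i) (by rw [hfx]; exact mul_ne_zero hneg hy0)
        (hx.2.trans hy.2.symm)
      rw [hfx, hfx, mul_pow, mul_pow] at h1
      exact mul_left_cancel₀ (pow_ne_zero _ hneg) h1
  have key := norm_sum_le_of_card_fiber_le s φ V hVsum hVnorm hmaps hfib
  rw [← hsum, hVcard, mul_div_cancel₀ _ hdR.ne'] at key
  refine key.trans ?_
  have h1 : (q : ℝ) ^ 2 ≤ #s + Fintype.card ι := by exact_mod_cast hcard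
  have h2 : (1 : ℝ) ≤ q := by exact_mod_cast (by omega : 1 ≤ q)
  have h3 : (0 : ℝ) ≤ Fintype.card ι := Nat.cast_nonneg _
  push_cast
  nlinarith

/-- Weil's bound for sums of products of multiplicative characters. -/
theorem norm_sum_prod_mulChar_le {ι : Type*} [Fintype ι] {a : ι → F}
    (ha : Function.Injective a) {χ : ι → MulChar F ℂ} (hχ : ∃ i, χ i ≠ 1) :
    ‖∑ x : F, ∏ i, χ i (a i - x)‖ ≤ (Fintype.card ι - 1) * √(Fintype.card F) := by
  have hne : Nonempty ι := let ⟨i, _⟩ := hχ; ⟨i⟩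
  set q := Fintype.card F with hq
  have hq1 : 1 < q := Fintype.one_lt_card
  have hcyc : IsCyclic (MulChar F ℂ) := isCyclic_mulChar
  obtain ⟨ψ, m, hm, hcop⟩ := exists_eq_pow_of_isCyclic χ
  have hψ : ψ ≠ 1 := by
    rintro rfl
    obtain ⟨i, hi⟩ := hχ
    exact hi (by rw [(hm i).2, one_pow])
  obtain ⟨z, hz₁, hz⟩ := exists_sum_prod_mulChar_norm_eq ha hχ
  obtain ⟨p, hp⟩ := CharP.exists F
  have hpp : Fact p.Prime := ⟨CharP.char_is_prime F p⟩
  have hbound : ∀ t, 4 + 4 * orderOf ψ ^ 2 * ∑ i, m i ≤ t → ‖∑ j, (z j ^ 2) ^ t‖ ≤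
      (6 * orderOf ψ * (∑ i, m i + 1) + Fintype.card ι : ℕ) * (q : ℝ) ^ t := fun t ht => by
    have : NeZero (2 * t) := ⟨by omega⟩
    let K := FiniteField.Extension F p (2 * t)
    have : Fintype K := Fintype.ofFinite K
    have h1 := hz K
    rw [FiniteField.finrank_extension] at h1
    have hK : Fintype.card K = (q ^ t) ^ 2 := by
      rw [← Nat.card_eq_fintype_card, FiniteField.natCard_extension, Nat.card_eq_fintype_card,
        mul_comm, pow_mul]
    have h2 := norm_sum_mulChar_norm_le (K := K) ha hψ (fun i => (hm i).1) hcop hK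
      (ψ.orderOf_dvd_card_sub_one.trans (Nat.sub_one_dvd_pow_sub_one _ _))
      (ht.trans (Nat.lt_pow_self hq1).le)
    rw [← Nat.cast_pow]
    refine le_trans (le_of_eq ?_) h2
    simp_rw [← pow_mul]
    rw [← norm_neg, ← h1]
    congr 1
    refine Finset.sum_congr rfl fun x _ => ?_
    rw [map_prod, map_prod]
    refine Finset.prod_congr rfl fun i _ => ?_
    rw [(hm i).2, MulChar.pow_apply' _ (by have := (hm i).1; omega), map_pow, map_pow]
  have hqR : (0 : ℝ) < q := by exact_mod_cast (by omega : 0 < q)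
  have hroot : ∀ j, ‖z j‖ ≤ √q := fun j => by
    have := norm_le_of_norm_sum_pow_le (fun j => z j ^ 2) hqR _ hbound j
    rw [norm_pow] at this
    exact Real.le_sqrt_of_sq_le this
  rw [hz₁, norm_neg]
  refine (norm_sum_le _ _).trans ((Finset.sum_le_card_nsmul _ _ _ fun j _ => hroot j).trans ?_)
  rw [card_univ, Fintype.card_fin, nsmul_eq_mul, Nat.cast_sub Fintype.card_pos, Nat.cast_one]

end Weil

section Sieve

variable {F : Type*} [Field F] [Fintype F]

theorem exists_eq_pow_of_pow_card_sub_one_div_eq_one {ℓ : ℕ} (hℓ : ℓ ∣ Fintype.card F - 1) {x : F}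
    (hx : x ≠ 0) (h : x ^ ((Fintype.card F - 1) / ℓ) = 1) : ∃ y, x = y ^ ℓ := by
  classical
  obtain ⟨g, hg⟩ := IsCyclic.exists_generator (α := Fˣ)
  have hord : orderOf g = Fintype.card F - 1 := by
    rw [orderOf_eq_card_of_forall_mem_zpowers hg, Nat.card_eq_fintype_card, Fintype.card_units]
  have hq : 0 < Fintype.card F - 1 := by have := Fintype.one_lt_card (α := F); omega
  obtain ⟨k, hk⟩ : ∃ k, g ^ k = Units.mk0 x hx := by
    have := hg (Units.mk0 x hx)
    rwa [← mem_powers_iff_mem_zpowers, Submonoid.mem_powers_iff] at this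
  have hkx : (g : F) ^ k = x := by rw [← Units.val_pow_eq_pow_val, hk, Units.val_mk0]
  have h1 : g ^ (k * ((Fintype.card F - 1) / ℓ)) = 1 := by
    rw [pow_mul, hk]
    exact Units.ext (by simpa using h)
  obtain ⟨m, hm⟩ := hℓ
  have hℓ0 : 0 < ℓ := Nat.pos_of_ne_zero (by rintro rfl; omega)
  rw [← orderOf_dvd_iff_pow_eq_one, hord, hm, Nat.mul_div_cancel_left _ hℓ0] at h1
  obtain ⟨t, rfl⟩ := Nat.dvd_of_mul_dvd_mul_right (Nat.pos_of_ne_zero (by rintro rfl; omega)) h1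
  exact ⟨g ^ t, by rw [← pow_mul, mul_comm, hkx]⟩

open scoped Classical in
theorem exists_mulChar_geom_sum_eq {ℓ : ℕ} (hℓ : ℓ ∣ Fintype.card F - 1) :
    ∃ ψ : MulChar F ℂ, orderOf ψ = ℓ ∧ ∀ x ≠ 0,
      ∑ j ∈ range ℓ, ψ x ^ j = if ∃ y, x = y ^ ℓ then (ℓ : ℂ) else 0 := by
  have hq : 0 < Fintype.card F - 1 := by have := Fintype.one_lt_card (α := F); omega
  have hℓ0 : ℓ ≠ 0 := by rintro rfl; rw [zero_dvd_iff] at hℓ; omega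
  obtain ⟨ψ, rfl⟩ := MulChar.exists_mulChar_orderOf F hℓ (Complex.isPrimitiveRoot_exp ℓ hℓ0)
  have hψ : ∀ y ≠ 0, ψ y ^ orderOf ψ = 1 := fun y hy => by
    rw [← MulChar.pow_apply' _ hℓ0, pow_orderOf_eq_one, MulChar.one_apply hy.isUnit]
  refine ⟨ψ, rfl, fun x hx => ?_⟩
  split_ifs with h
  · obtain ⟨y, rfl⟩ := h
    rw [map_pow, hψ y (by rintro rfl; exact hx (zero_pow hℓ0))]
    simp
  · have h1 : ψ x ≠ 1 := fun h1 => h (exists_eq_pow_of_pow_card_sub_one_div_eq_one hℓ hx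
      (pow_eq_one_of_mulChar_apply_eq_one ψ h1))
    rw [geom_sum_eq h1, hψ x hx, sub_self, zero_div]

open scoped Classical in
theorem exists_sum_mulChar_eq_indicator [Fintype (MulChar F ℂ)] (s : Finset ℕ)
    (hs : ∀ ℓ ∈ s, ℓ.Prime ∧ ℓ ∣ Fintype.card F - 1) :
    ∃ w : MulChar F ℂ → ℂ, w 1 = 1 ∧ ∑ χ, ‖w χ‖ ≤ 2 ^ #s ∧
      (∀ χ, w χ ≠ 0 → χ ^ ∏ ℓ ∈ s, ℓ = 1) ∧ ∀ x ≠ 0,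
        (∏ ℓ ∈ s, (1 - 1 / (ℓ : ℂ))) * ∑ χ, w χ * χ x =
          if ∀ ℓ ∈ s, ¬∃ y, x = y ^ ℓ then 1 else 0 := by
  induction s using Finset.induction_on with
  | empty =>
    refine ⟨Pi.single 1 1, by simp, ?_, fun χ h => ?_, fun x hx => ?_⟩
    · rw [Finset.sum_eq_single 1 (fun χ _ h => by simp [h]) (by simp)]
      simp
    · by_contra h1
      exact h (Pi.single_eq_of_ne (by simpa using h1) _)
    · rw [Finset.sum_eq_single 1 (fun χ _ h => by simp [h]) (by simp)]
      simp [MulChar.one_apply hx.isUnit]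
  | insert ℓ s hℓs ih =>
    obtain ⟨w, hw1, hwn, hws, hwx⟩ := ih fun m hm => hs m (mem_insert_of_mem hm)
    obtain ⟨hℓ, hℓq⟩ := hs ℓ (mem_insert_self _ _)
    obtain ⟨ψ, hψ, hψx⟩ := exists_mulChar_geom_sum_eq hℓq
    obtain ⟨l, rfl⟩ : ∃ l, ℓ = l + 1 := ⟨ℓ - 1, by have := hℓ.pos; omega⟩
    have hl : (l : ℂ) ≠ 0 := Nat.cast_ne_zero.2 (by have := hℓ.two_le; omega)
    have hl1 : (l : ℂ) + 1 ≠ 0 := Nat.cast_add_one_ne_zero l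
    refine ⟨fun χ => w χ - ∑ j ∈ range l, (l : ℂ)⁻¹ * w (χ * (ψ ^ (j + 1))⁻¹), ?_, ?_,
      fun χ hχ => ?_, fun x hx => ?_⟩
    · dsimp only
      rw [hw1, Finset.sum_eq_zero, sub_zero]
      intro j hj
      rw [mul_eq_zero]
      right
      by_contra h
      have h1 := hws _ h
      rw [one_mul, inv_pow, inv_eq_one, ← pow_mul, ← orderOf_dvd_iff_pow_eq_one, hψ,
        hℓ.dvd_mul] at h1
      rcases h1 with h1 | h1
      · have := Nat.le_of_dvd (by omega) h1
        rw [mem_range] at hj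
        omega
      · obtain ⟨m, hm, hm'⟩ := (hℓ.prime.dvd_finsetProd_iff _).1 h1
        rw [← (Nat.prime_dvd_prime_iff_eq hℓ (hs m (mem_insert_of_mem hm)).1).1 hm'] at hm
        exact hℓs hm
    · rw [card_insert_of_notMem hℓs, pow_succ, mul_two]
      have h1 : ∀ η : MulChar F ℂ, ∑ χ, ‖w (χ * η)‖ = ∑ χ, ‖w χ‖ := fun η =>
        Equiv.sum_comp (Equiv.mulRight η) fun χ => ‖w χ‖
      have hl' : (l : ℝ) ≠ 0 := by exact_mod_cast hl
      refine (Finset.sum_le_sum fun χ _ => (norm_sub_le _ _).trans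
        (add_le_add_right (norm_sum_le _ _) _)).trans ?_
      rw [Finset.sum_add_distrib, Finset.sum_comm]
      simp_rw [norm_mul, ← Finset.mul_sum, h1]
      rw [Finset.sum_const, card_range, nsmul_eq_mul, norm_inv, Complex.norm_natCast,
        inv_mul_cancel_left₀ hl']
      exact add_le_add hwn hwn
    · rw [prod_insert hℓs, mul_comm]
      by_cases h : w χ = 0
      · dsimp only at hχ
        rw [h, zero_sub, neg_ne_zero] at hχ
        obtain ⟨j, _, hj⟩ := Finset.exists_ne_zero_of_sum_ne_zero hχ
        have h1 := hws _ (right_ne_zero_of_mul hj)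
        rw [mul_pow, inv_pow, mul_inv_eq_one] at h1
        rw [pow_mul, h1, ← hψ, pow_right_comm, pow_right_comm ψ, pow_orderOf_eq_one, one_pow, one_pow]
      · rw [pow_mul, hws _ h, one_pow]
    · have h1 : ∀ j, ∑ χ, w (χ * (ψ ^ (j + 1))⁻¹) * χ x = ψ x ^ (j + 1) * ∑ χ, w χ * χ x :=
        fun j => by
          rw [← Equiv.sum_comp (Equiv.mulRight (ψ ^ (j + 1))), Finset.mul_sum]
          refine Finset.sum_congr rfl fun χ _ => ?_
          rw [Equiv.coe_mulRight, mul_inv_cancel_right, MulChar.mul_apply,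
            MulChar.pow_apply' _ (Nat.add_one_ne_zero j)]
          ring
      have h2 : ∑ χ, (w χ - ∑ j ∈ range l, (l : ℂ)⁻¹ * w (χ * (ψ ^ (j + 1))⁻¹)) * χ x =
          (1 - (l : ℂ)⁻¹ * ∑ j ∈ range l, ψ x ^ (j + 1)) * ∑ χ, w χ * χ x := by
        simp_rw [sub_mul, Finset.sum_sub_distrib, Finset.sum_mul]
        rw [Finset.sum_comm, one_mul, mul_assoc, Finset.sum_mul, Finset.mul_sum]
        simp_rw [mul_assoc, ← Finset.mul_sum, h1]
      have h3 := hψx x hx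
      rw [Finset.sum_range_succ', pow_zero, ← eq_sub_iff_add_eq] at h3
      rw [h2, h3, prod_insert hℓs, mul_mul_mul_comm, hwx x hx]
      simp only [forall_mem_insert]
      by_cases h : ∃ y, x = y ^ (l + 1)
      · rw [if_pos h, Nat.cast_add_one, add_sub_cancel_right, inv_mul_cancel₀ hl, sub_self,
          mul_zero, zero_mul, if_neg fun h' => h'.1 h]
      · have h4 : (1 - 1 / ((l + 1 : ℕ) : ℂ)) * (1 - (l : ℂ)⁻¹ * (0 - 1)) = 1 := by
          push_cast
          field_simp
          ring
        rw [if_neg h, h4, one_mul]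
        simp only [h, not_false_eq_true, true_and]

theorem eFree_iff {F : Type*} [Field F] {e : ℕ} (he : e ≠ 0) {g : F} :
    EFree e g ↔ g ≠ 0 ∧ ∀ ℓ ∈ e.primeFactors, ¬∃ y, g = y ^ ℓ := by
  refine and_congr_right fun _ => ⟨?_, fun h y d hd hg => ?_⟩
  · rintro h ℓ hℓ ⟨y, hy⟩
    exact (Nat.prime_of_mem_primeFactors hℓ).one_lt.ne'
      (h y ℓ (Nat.dvd_of_mem_primeFactors hℓ) hy)
  · by_contra hd1
    obtain ⟨ℓ, hℓ, c, rfl⟩ := Nat.exists_prime_and_dvd hd1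
    exact h ℓ (hℓ.mem_primeFactors ((dvd_mul_right _ _).trans hd) he)
      ⟨y ^ c, by rw [hg, ← pow_mul, mul_comm]⟩

theorem card_le_card_filter_add_natCast_ne_zero [DecidableEq F] (n : ℕ) :
    Fintype.card F ≤ #{x : F | ∀ k : Fin n, x + ((k : ℕ) : F) ≠ 0} + n := by
  rw [← Finset.card_univ, ← Finset.card_filter_add_card_filter_not
    (s := univ) (p := fun x : F => ∀ k : Fin n, x + ((k : ℕ) : F) ≠ 0)]
  refine Nat.add_le_add_left ?_ _
  refine (Finset.card_le_card (t := univ.image fun k : Fin n => -((k : ℕ) : F))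
    fun x hx => ?_).trans (card_image_le.trans (by simp))
  simp only [mem_filter, mem_univ, true_and, not_forall, not_not] at hx
  obtain ⟨k, hk⟩ := hx
  exact mem_image.2 ⟨k, mem_univ k, (eq_neg_of_add_eq_zero_left hk).symm⟩

theorem norm_sum_prod_mulChar_add_natCast_le (p : ℕ) [CharP F p] {n : ℕ} (hn : n ≤ p)
    {χ : Fin n → MulChar F ℂ} (hχ : χ ≠ 1) :
    ‖∑ x : F, ∏ k, χ k (x + ((k : ℕ) : F))‖ ≤ (n - 1) * √(Fintype.card F) := by
  have ha : Function.Injective fun k : Fin n => ((k : ℕ) : F) := fun i j h =>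
    Fin.ext (CharP.natCast_injOn_Iio F p (i.2.trans_le hn) (j.2.trans_le hn) h)
  have h := norm_sum_prod_mulChar_le ha (Function.ne_iff.1 hχ)
  rw [Fintype.card_fin, ← Equiv.sum_comp (Equiv.neg F)] at h
  simpa [add_comm] using h

open scoped Classical in
theorem natCast_Nn_eq [Fintype (MulChar F ℂ)] {n e : ℕ} (he : e ≠ 0) {w : MulChar F ℂ → ℂ}
    (hw : ∀ x ≠ 0, (∏ ℓ ∈ e.primeFactors, (1 - 1 / (ℓ : ℂ))) * ∑ χ, w χ * χ x =
      if ∀ ℓ ∈ e.primeFactors, ¬∃ y, x = y ^ ℓ then 1 else 0) :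
    (Nn F n e : ℂ) = (theta e : ℂ) ^ n * ∑ χ : Fin n → MulChar F ℂ,
      (∏ k, w (χ k)) * ∑ x : F, ∏ k, χ k (x + ((k : ℕ) : F)) := by
  have hθ : (theta e : ℂ) = ∏ ℓ ∈ e.primeFactors, (1 - 1 / (ℓ : ℂ)) := by
    simp [theta]
  have hw' : ∀ x, (if EFree e x then 1 else 0) = (theta e : ℂ) * ∑ χ, w χ * χ x := fun x => by
    rw [hθ, eFree_iff he]
    rcases eq_or_ne x 0 with rfl | hx
    · simp only [MulChar.map_zero, mul_zero, Finset.sum_const_zero, ne_eq, not_true_eq_false,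
        false_and, if_false]
    · simp only [hw x hx, ne_eq, hx, not_false_eq_true, true_and]
  have h : ∀ x : F, (if ∀ k : Fin n, EFree e (x + ((k : ℕ) : F)) then (1 : ℂ) else 0) =
      (theta e : ℂ) ^ n * ∏ k : Fin n, ∑ χ, w χ * χ (x + ((k : ℕ) : F)) := fun x => by
    have := Finset.prod_boole (M₀ := ℂ) (s := univ)
      (p := fun k : Fin n => EFree e (x + ((k : ℕ) : F)))
    simp only [mem_univ, true_imp_iff] at this
    rw [← this, Finset.prod_congr rfl fun k _ => hw' _, Finset.prod_mul_distrib,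
      Finset.prod_const, card_univ, Fintype.card_fin]
  rw [Nn, Ncount, Nat.card_eq_fintype_card, Fintype.card_subtype, ← Finset.sum_boole,
    Finset.sum_congr rfl fun x _ => h x, ← Finset.mul_sum]
  congr 1
  simp_rw [Finset.mul_sum (univ : Finset F)]
  rw [Finset.sum_comm]
  refine Finset.sum_congr rfl fun x _ => ?_
  simp_rw [← Finset.prod_mul_distrib]
  exact Fintype.prod_sum fun (k : Fin n) χ => w χ * χ (x + ((k : ℕ) : F))

theorem norm_sum_prod_one_apply_sub_card_le (n : ℕ) :
    ‖∑ x : F, ∏ k : Fin n, (1 : MulChar F ℂ) (x + ((k : ℕ) : F)) - Fintype.card F‖ ≤ n := by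
  classical
  have h : ∑ x : F, ∏ k : Fin n, (1 : MulChar F ℂ) (x + ((k : ℕ) : F)) =
      #{x : F | ∀ k : Fin n, x + ((k : ℕ) : F) ≠ 0} := by
    rw [← Finset.sum_boole]
    refine Finset.sum_congr rfl fun x _ => ?_
    rw [Finset.prod_congr rfl (g := fun k : Fin n => if x + ((k : ℕ) : F) ≠ 0 then (1 : ℂ) else 0)
      fun k _ => ?_, Finset.prod_boole]
    · simp
    · split_ifs with h
      · exact MulChar.one_apply h.isUnit
      · rw [not_not.1 h, MulChar.map_zero]
  have h1 := card_le_card_filter_add_natCast_ne_zero (F := F) n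
  have h2 : #{x : F | ∀ k : Fin n, x + ((k : ℕ) : F) ≠ 0} ≤ Fintype.card F := card_le_univ _
  rw [h, norm_sub_rev, ← Nat.cast_sub h2, Complex.norm_natCast, Nat.cast_le]
  omega

end Sieve

/-- For `3 ≤ n ≤ p` and `e ∣ q - 1`,
`N_n(e) ≥ θ(e)^n (q - (n-1) W(e)^n √q)`. -/
theorem Nn_lower_bound (q p n : ℕ) (hq : IsPrimePow q)
    (F : Type*) [Field F] [Fintype F] (hF : Fintype.card F = q) (hp : CharP F p)
    (hn3 : 3 ≤ n) (hnp : n ≤ p) (e : ℕ) (he : e ∣ q - 1) :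
    theta e ^ n * ((q : ℝ) - ((n : ℝ) - 1) * (W e : ℝ) ^ n * Real.sqrt q) ≤
      (Nn F n e : ℝ) := by
  classical
  subst hF
  have hpq : p ≤ Fintype.card F := Nat.le_of_dvd Fintype.card_pos
    ((CharP.cast_eq_zero_iff F p _).1 (FiniteField.cast_card_eq_zero F))
  have he0 : e ≠ 0 := by
    rintro rfl
    have := zero_dvd_iff.1 he
    omega
  have : Fintype (MulChar F ℂ) := Fintype.ofFinite _
  obtain ⟨w, hw1, hwn, -, hw⟩ := exists_sum_mulChar_eq_indicator (F := F) e.primeFactors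
    fun ℓ hℓ => ⟨Nat.prime_of_mem_primeFactors hℓ, (Nat.dvd_of_mem_primeFactors hℓ).trans he⟩
  set S : (Fin n → MulChar F ℂ) → ℂ := fun χ => ∑ x : F, ∏ k, χ k (x + ((k : ℕ) : F)) with hS
  set T := ∑ χ : Fin n → MulChar F ℂ, (∏ k, w (χ k)) * S χ with hT
  have hN : (Nn F n e : ℂ) = (theta e : ℂ) ^ n * T := natCast_Nn_eq he0 hw
  have hNre : (Nn F n e : ℝ) = theta e ^ n * T.re := by
    rw [← Complex.ofReal_pow] at hN
    rw [← Complex.re_ofReal_mul, ← hN, Complex.natCast_re]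
  have hθ : 0 ≤ theta e := Finset.prod_nonneg fun ℓ hℓ => by
    have : (1 : ℝ) ≤ ℓ := by exact_mod_cast (Nat.prime_of_mem_primeFactors hℓ).one_le
    exact sub_nonneg.2 (div_le_one_of_le₀ this (by positivity))
  rw [hNre]
  refine mul_le_mul_of_nonneg_left ?_ (pow_nonneg hθ n)
  set B := ((n : ℝ) - 1) * √(Fintype.card F) with hB
  have hn : (3 : ℝ) ≤ n := by exact_mod_cast hn3
  have hsqrt : 3 / 2 ≤ √(Fintype.card F : ℝ) := Real.le_sqrt_of_sq_le (by
    have : (3 : ℝ) ≤ Fintype.card F := by exact_mod_cast hn3.trans (hnp.trans hpq)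
    linarith)
  have hB0 : 0 ≤ B := mul_nonneg (by linarith) (Real.sqrt_nonneg _)
  have hnB : (n : ℝ) ≤ B := by rw [hB]; nlinarith
  have hbound : ∀ χ, ‖S χ - if χ = 1 then (Fintype.card F : ℂ) else 0‖ ≤ B := fun χ => by
    split_ifs with h
    · subst h
      exact (norm_sum_prod_one_apply_sub_card_le n).trans hnB
    · rw [sub_zero]
      exact norm_sum_prod_mulChar_add_natCast_le p hnp h
  have hTB : ‖T - Fintype.card F‖ ≤ (W e : ℝ) ^ n * B := by
    have h1 : T - Fintype.card F = ∑ χ : Fin n → MulChar F ℂ,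
        (∏ k, w (χ k)) * (S χ - if χ = 1 then (Fintype.card F : ℂ) else 0) := by
      simp_rw [mul_sub, Finset.sum_sub_distrib, mul_ite, mul_zero]
      rw [Finset.sum_ite_eq' univ 1, if_pos (mem_univ _)]
      simp [hw1, hT]
    have h2 : ∑ χ : Fin n → MulChar F ℂ, ∏ k, ‖w (χ k)‖ ≤ (W e : ℝ) ^ n := by
      rw [← Fintype.sum_pow fun χ => ‖w χ‖]
      refine pow_le_pow_left₀ (Finset.sum_nonneg fun _ _ => norm_nonneg _) (hwn.trans ?_) n
      simp [W]
    rw [h1]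
    refine (norm_sum_le _ _).trans (le_trans ?_ (mul_le_mul_of_nonneg_right h2 hB0))
    rw [Finset.sum_mul]
    refine Finset.sum_le_sum fun χ _ => ?_
    rw [norm_mul, norm_prod]
    exact mul_le_mul_of_nonneg_left (hbound χ) (Finset.prod_nonneg fun _ _ => norm_nonneg _)
  have h3 := (abs_le.1 ((Complex.abs_re_le_norm _).trans hTB)).1
  rw [Complex.sub_re, Complex.natCast_re, hB] at h3
  linarith
end
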